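/- Let k be a field and F a field generator of A = k[X,Y] such that the set Γ(F,A) (curves C ⊂ Spec A for which the composite C ↪ Spec A → Spec k[F] is an isomorphism) has more than 2 elements. Then there exists a coordinate system (X',Y') of A with F = α(Y')·X' + β(Y') for some α, β ∈ k[Y']. -/

import Mathlib

open MvPolynomial

/-- The set `Γ_alg(F,A)` of primes `p` of `A = k[X,Y]` such that the composite
`k[F] ↪ A → A/p` is an isomorphism (it is in bijection with `Γ(F,A)`). -/
def GammaAlg (k : Type) [Field k] (F : MvPolynomial (Fin 2) k) :
    Set (Ideal (MvPolynomial (Fin 2) k)) :=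
  {p | p.IsPrime ∧ Function.Bijective
    (fun q : Polynomial k => Ideal.Quotient.mk p (Polynomial.aeval F q))}

namespace FieldGen

section Hahn
variable {E : Type} [Field E]

lemma order_add_of_lt {x y : HahnSeries ℤ E} (hx : x ≠ 0) (hy : y ≠ 0) (h : x.order < y.order) :
    (x + y).order = x.order ∧ (x + y).leadingCoeff = x.leadingCoeff := by
  have h' : x.orderTop < y.orderTop := by
    rw [← HahnSeries.order_eq_orderTop_of_ne_zero hx, ← HahnSeries.order_eq_orderTop_of_ne_zero hy]
    exact_mod_cast h
  have h2 := HahnSeries.leadingCoeff_add_eq_left h'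
  have hxy : x + y ≠ 0 := by
    rw [← HahnSeries.leadingCoeff_ne_zero, h2]
    exact HahnSeries.leadingCoeff_ne_zero.2 hx
  refine ⟨?_, h2⟩
  have h1 := HahnSeries.orderTop_add_eq_left h'
  rw [← HahnSeries.order_eq_orderTop_of_ne_zero hx,
    ← HahnSeries.order_eq_orderTop_of_ne_zero hxy] at h1
  exact_mod_cast h1

lemma order_add_of_eq {x y : HahnSeries ℤ E} (h : x.order = y.order)
    (hl : x.leadingCoeff + y.leadingCoeff ≠ 0) :
    (x + y).order = x.order ∧ (x + y).leadingCoeff = x.leadingCoeff + y.leadingCoeff := by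
  have hc : (x + y).coeff x.order = x.leadingCoeff + y.leadingCoeff := by
    rw [HahnSeries.coeff_add, HahnSeries.leadingCoeff_eq, HahnSeries.leadingCoeff_eq, h]
  have hxy : x + y ≠ 0 := by
    intro h0
    rw [h0] at hc
    exact hl (by simpa using hc.symm)
  have h1 : (x + y).order ≤ x.order := HahnSeries.order_le_of_coeff_ne_zero (by rwa [hc])
  have h2 : x.order ≤ (x + y).order := by
    have := HahnSeries.min_order_le_order_add hxy
    rwa [← h, min_self] at this
  have h3 := le_antisymm h1 h2
  exact ⟨h3, by rw [HahnSeries.leadingCoeff_eq, h3, hc]⟩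

lemma coeff_zero_mul {x y : HahnSeries ℤ E} (hx : 0 ≤ x.orderTop) (hy : 0 ≤ y.orderTop) :
    (x * y).coeff 0 = x.coeff 0 * y.coeff 0 := by
  by_cases hx0 : x = 0
  · simp [hx0]
  by_cases hy0 : y = 0
  · simp [hy0]
  rw [HahnSeries.zero_le_orderTop_iff] at hx hy
  have hm := HahnSeries.order_mul hx0 hy0
  rcases hx.lt_or_eq with h | h
  · rw [HahnSeries.coeff_eq_zero_of_lt_order (x := x * y) (by omega),
      HahnSeries.coeff_eq_zero_of_lt_order h, zero_mul]
  rcases hy.lt_or_eq with h' | h'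
  · rw [HahnSeries.coeff_eq_zero_of_lt_order (x := x * y) (by omega),
      HahnSeries.coeff_eq_zero_of_lt_order h', mul_zero]
  · have := HahnSeries.coeff_mul_order_add_order x y
    rw [← h, ← h'] at this
    simpa [HahnSeries.leadingCoeff_eq, ← h, ← h'] using this

lemma orderTop_mul_nonneg {x y : HahnSeries ℤ E} (hx : 0 ≤ x.orderTop) (hy : 0 ≤ y.orderTop) :
    0 ≤ (x * y).orderTop := by
  rw [HahnSeries.orderTop_mul]
  exact add_nonneg hx hy

lemma orderTop_add_nonneg {x y : HahnSeries ℤ E} (hx : 0 ≤ x.orderTop) (hy : 0 ≤ y.orderTop) :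
    0 ≤ (x + y).orderTop :=
  le_trans (le_min hx hy) HahnSeries.min_orderTop_le_orderTop_add

end Hahn

/-- A valuation model on `L` with Laurent series values, adapted to the pencil generated by `t`
and to a function `u` of order zero. -/
structure Model (k K L E : Type) [Field k] [Field K] [Field L] [Field E] [Algebra k K]
    [Algebra K L] [Algebra k L] [Algebra k E] where
  ι : L →+* HahnSeries ℤ E
  ι_k : ∀ c : k, ι (algebraMap k L c) = HahnSeries.C (algebraMap k E c)
  t : K
  e : ℕ
  e_pos : 0 < e
  order_t : (ι (algebraMap K L t)).order = -(e : ℤ)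
  order_K : ∀ c : K, c ≠ 0 → ∃ c0 : k, c0 ≠ 0 ∧ ∃ m : ℤ,
    (ι (algebraMap K L c)).order = -((e : ℤ) * m) ∧
    (ι (algebraMap K L c)).leadingCoeff
      = algebraMap k E c0 * (ι (algebraMap K L t)).leadingCoeff ^ m
  u : L
  U : E
  ι_u : ι u = HahnSeries.C U
  U_tr : Transcendental k U
  tr : ∀ z : E, z ∉ (algebraMap k E).fieldRange → Transcendental k z
  dom : ∀ W : ValuationSubring L,
    (∀ c : Polynomial k, c ≠ 0 → Polynomial.aeval u c ∈ W ∧ (Polynomial.aeval u c)⁻¹ ∈ W) →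
    algebraMap K L t ∉ W → ∀ g : L, g ≠ 0 → (ι g).order = 0 → g ∈ W

namespace Model

variable {k K L E : Type} [Field k] [Field K] [Field L] [Field E] [Algebra k K]
    [Algebra K L] [Algebra k L] [Algebra k E] (M : Model k K L E)

/-- The order of an element. -/
noncomputable def v (l : L) : ℤ := (M.ι l).order

/-- The leading coefficient of an element. -/
noncomputable def lc : L →*₀ E where
  toFun l := (M.ι l).leadingCoeff
  map_zero' := by simp
  map_one' := by simp
  map_mul' x y := by simp

lemma ι_ne {l : L} (h : l ≠ 0) : M.ι l ≠ 0 := (map_ne_zero _).2 h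

lemma lc_apply (l : L) : M.lc l = (M.ι l).leadingCoeff := rfl

lemma lc_ne {l : L} (h : l ≠ 0) : M.lc l ≠ 0 := (map_ne_zero _).2 h

lemma v_mul {x y : L} (hx : x ≠ 0) (hy : y ≠ 0) : M.v (x * y) = M.v x + M.v y := by
  simp only [v, map_mul]
  exact HahnSeries.order_mul (M.ι_ne hx) (M.ι_ne hy)

lemma v_one : M.v 1 = 0 := by simp [v]

lemma v_inv (x : L) : M.v x⁻¹ = - M.v x := by
  by_cases hx : x = 0
  · simp [hx, v]
  have := M.v_mul hx (inv_ne_zero hx)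
  rw [mul_inv_cancel₀ hx, v_one] at this
  omega

lemma v_pow (x : L) (n : ℕ) : M.v (x ^ n) = n * M.v x := by
  simp [v]

lemma v_zpow (x : L) (n : ℤ) : M.v (x ^ n) = n * M.v x := by
  cases n with
  | ofNat n => simpa using M.v_pow x n
  | negSucc n =>
    rw [zpow_negSucc, v_inv, v_pow, Int.negSucc_eq]
    push_cast
    ring

lemma v_add_of_lt {x y : L} (hx : x ≠ 0) (hy : y ≠ 0) (h : M.v x < M.v y) :
    M.v (x + y) = M.v x ∧ M.lc (x + y) = M.lc x := by
  simp only [v, lc_apply, map_add]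
  exact order_add_of_lt (M.ι_ne hx) (M.ι_ne hy) h

lemma v_add_of_eq {x y : L} (h : M.v x = M.v y)
    (hl : M.lc x + M.lc y ≠ 0) :
    M.v (x + y) = M.v x ∧ M.lc (x + y) = M.lc x + M.lc y := by
  simp only [v, lc_apply, map_add]
  exact order_add_of_eq h hl

/-- The leading coefficient of the pencil generator. -/
noncomputable def θ : E := M.lc (algebraMap K L M.t)

lemma v_t : M.v (algebraMap K L M.t) = -(M.e : ℤ) := M.order_t

lemma t_ne : M.t ≠ 0 := by
  intro h
  have := M.v_t
  have h2 := M.e_pos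
  rw [h] at this
  simp [v] at this
  omega

lemma θ_ne : M.θ ≠ 0 := M.lc_ne ((map_ne_zero _).2 M.t_ne)

/-- The degree zero leading coefficient attached to an element. -/
noncomputable def Ψ : L →*₀ E where
  toFun l := M.lc l ^ M.e * M.θ ^ M.v l
  map_zero' := by simp [M.e_pos.ne']
  map_one' := by simp [v_one]
  map_mul' x y := by
    by_cases hx : x = 0
    · simp [hx, M.e_pos.ne']
    by_cases hy : y = 0
    · simp [hy, M.e_pos.ne']
    rw [map_mul, M.v_mul hx hy, zpow_add₀ M.θ_ne]
    ring

lemma Ψ_apply (l : L) : M.Ψ l = M.lc l ^ M.e * M.θ ^ M.v l := rfl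

/-- The constants of the residue field. -/
abbrev F0 (_M : Model k K L E) : Subfield E := (algebraMap k E).fieldRange

lemma mem_of_pow_mem {z : E} {n : ℕ} (hn : 0 < n) (h : z ^ n ∈ M.F0) : z ∈ M.F0 := by
  by_contra h'
  obtain ⟨c, hc⟩ := h
  refine M.tr z h' ⟨Polynomial.X ^ n - Polynomial.C c, ?_, ?_⟩
  · exact Polynomial.X_pow_sub_C_ne_zero hn c
  · simp [← hc]

lemma Ψ_K (c : K) : M.Ψ (algebraMap K L c) ∈ M.F0 := by
  by_cases hc : c = 0
  · simp [hc, zero_mem]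
  obtain ⟨c0, h0, m, h1, h2⟩ := M.order_K c hc
  refine ⟨c0 ^ M.e, ?_⟩
  rw [Ψ_apply, v, h1, lc_apply, h2]
  change _ = (_ * M.θ ^ m) ^ M.e * _
  rw [mul_pow, mul_assoc, ← zpow_natCast (M.θ ^ m), ← zpow_mul, ← zpow_add₀ M.θ_ne]
  have : m * (M.e : ℤ) + -(M.e * m) = 0 := by ring
  rw [this]
  simp

lemma lc_mem {h : L} (hh : M.Ψ h ∈ M.F0) (hv : M.v h = 0) : M.lc h ∈ M.F0 := by
  rw [Ψ_apply, hv, zpow_zero, mul_one] at hh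
  exact M.mem_of_pow_mem M.e_pos hh

lemma v_u : M.v M.u = 0 := by rw [v, M.ι_u, HahnSeries.order_C]

lemma lc_u : M.lc M.u = M.U := by
  rw [lc_apply, M.ι_u, HahnSeries.C_apply, HahnSeries.leadingCoeff_of_single]

lemma U_not_mem : M.U ∉ M.F0 := by
  rintro ⟨c, hc⟩
  exact M.U_tr (hc ▸ isAlgebraic_algebraMap c)

lemma Ψ_u : M.Ψ M.u ∉ M.F0 := by
  rw [Ψ_apply, v_u, lc_u, zpow_zero, mul_one]
  exact fun h => M.U_not_mem (M.mem_of_pow_mem M.e_pos h)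

end Model
end FieldGen

namespace FieldGen
namespace Model
variable {k K L E : Type} [Field k] [Field K] [Field L] [Field E] [Algebra k K]
    [Algebra K L] [Algebra k L] [Algebra k E] (M : Model k K L E)

/-- A monic polynomial of minimal degree whose value at `s` has non-constant `Ψ`. -/
structure IsMin (s : L) (φ : Polynomial K) : Prop where
  tr : Transcendental K s
  monic : φ.Monic
  not_mem : M.Ψ (Polynomial.aeval s φ) ∉ M.F0
  mem : ∀ f : Polynomial K, f.natDegree < φ.natDegree → M.Ψ (Polynomial.aeval s f) ∈ M.F0

lemma exists_isMin {s : L} (tr : Transcendental K s)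
    (gen : ∀ l : L, ∃ h h' : Polynomial K, Polynomial.aeval s h' ≠ 0 ∧
      l * Polynomial.aeval s h' = Polynomial.aeval s h) : ∃ φ, M.IsMin s φ := by
  classical
  have hex : ∃ n, ∃ f : Polynomial K, f.natDegree = n ∧ M.Ψ (Polynomial.aeval s f) ∉ M.F0 := by
    by_contra hcon
    push Not at hcon
    obtain ⟨h, h', h0, h1⟩ := gen M.u
    apply M.Ψ_u
    have h2 : M.u = Polynomial.aeval s h / Polynomial.aeval s h' := by
      rw [← h1, mul_div_assoc, div_self h0, mul_one]
    rw [h2, map_div₀]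
    exact div_mem (hcon _ h rfl) (hcon _ h' rfl)
  obtain ⟨f, hf, hf'⟩ := Nat.find_spec hex
  have hf0 : f ≠ 0 := by
    rintro rfl
    exact hf' (by simp [zero_mem])
  have hl : f.leadingCoeff ≠ 0 := Polynomial.leadingCoeff_ne_zero.2 hf0
  refine ⟨f * Polynomial.C f.leadingCoeff⁻¹, tr, Polynomial.monic_mul_leadingCoeff_inv hf0, ?_, ?_⟩
  · intro hm
    apply hf'
    rw [map_mul, map_mul, Polynomial.aeval_C] at hm
    have := mul_mem hm (M.Ψ_K f.leadingCoeff)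
    rwa [mul_assoc, ← map_mul, ← map_mul, ← map_mul, inv_mul_cancel₀ hl, map_one,
      mul_one] at this
  · intro g hg
    by_contra hcon
    rw [Polynomial.natDegree_mul_C (inv_ne_zero hl), hf] at hg
    exact Nat.find_min hex hg ⟨g, rfl, hcon⟩

lemma isMin_X {s : L} (tr : Transcendental K s) (hs : M.Ψ s ∉ M.F0) :
    M.IsMin s Polynomial.X := by
  refine ⟨tr, Polynomial.monic_X, by simpa using hs, fun f hf => ?_⟩
  rw [Polynomial.natDegree_X, Nat.lt_one_iff] at hf
  rw [Polynomial.eq_C_of_natDegree_eq_zero hf, Polynomial.aeval_C]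
  exact M.Ψ_K _

variable {M} {s : L} {φ : Polynomial K}

namespace IsMin
variable (hφ : M.IsMin s φ)
include hφ

lemma ev_ne {h : Polynomial K} (hh : h ≠ 0) : Polynomial.aeval s h ≠ 0 :=
  fun h0 => hφ.tr ⟨h, hh, h0⟩

lemma φ_ne : Polynomial.aeval s φ ≠ 0 := hφ.ev_ne hφ.monic.ne_zero

lemma natDegree_pos : 0 < φ.natDegree := by
  by_contra h
  apply hφ.not_mem
  rw [Polynomial.eq_C_of_natDegree_eq_zero (by omega : φ.natDegree = 0), Polynomial.aeval_C]
  exact M.Ψ_K _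

lemma exists_z : ∃ z : E, ∃ e₁ : ℕ, 0 < e₁ ∧ Transcendental k z ∧
    ∀ h : L, h ≠ 0 → M.Ψ h ∈ M.F0 → ∀ m : ℤ, M.v h + m * M.v (Polynomial.aeval s φ) = 0 →
      ∃ j : ℤ, m = e₁ * j ∧ ∃ c : k, c ≠ 0 ∧
        M.lc h * M.lc (Polynomial.aeval s φ) ^ m = algebraMap k E c * z ^ j := by
  set b := Polynomial.aeval s φ with hb
  have hb0 : b ≠ 0 := hφ.φ_ne
  let G : AddSubgroup ℤ :=
    { carrier := {m | ∃ h : L, h ≠ 0 ∧ M.Ψ h ∈ M.F0 ∧ M.v h + m * M.v b = 0}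
      zero_mem' := ⟨1, one_ne_zero, by simp [one_mem], by simp [v_one]⟩
      add_mem' := by
        rintro m m' ⟨h, h1, h2, h3⟩ ⟨h', h1', h2', h3'⟩
        refine ⟨h * h', mul_ne_zero h1 h1', ?_, ?_⟩
        · rw [map_mul]; exact mul_mem h2 h2'
        · rw [M.v_mul h1 h1']; linarith
      neg_mem' := by
        rintro m ⟨h, h1, h2, h3⟩
        refine ⟨h⁻¹, inv_ne_zero h1, ?_, ?_⟩
        · rw [map_inv₀]; exact inv_mem h2
        · rw [M.v_inv]; linarith }
  obtain ⟨a, ha⟩ := Int.subgroup_cyclic G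
  have hmem : ∀ m, m ∈ G ↔ a ∣ m := by
    intro m
    rw [ha, ← AddSubgroup.zmultiples_eq_closure, Int.mem_zmultiples_iff]
  have heG : (M.e : ℤ) ∈ G := by
    refine ⟨algebraMap K L M.t ^ M.v b, zpow_ne_zero _ ((map_ne_zero _).2 M.t_ne), ?_, ?_⟩
    · rw [← map_zpow₀]; exact M.Ψ_K _
    · rw [M.v_zpow, M.v_t]; ring
  have ha0 : a ≠ 0 := by
    rintro rfl
    have := (hmem _).1 heG
    have h2 := M.e_pos
    rw [zero_dvd_iff] at this
    omega
  have hn : 0 < a.natAbs := Int.natAbs_pos.2 ha0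
  obtain ⟨h1, h10, h1Ψ, h1v⟩ := (hmem (a.natAbs : ℤ)).2 (Int.dvd_natAbs.2 dvd_rfl)
  have key : ∀ h : L, h ≠ 0 → M.Ψ h ∈ M.F0 → ∀ m : ℤ, M.v h + m * M.v b = 0 →
      ∃ j : ℤ, m = a.natAbs * j ∧ ∃ c : k, c ≠ 0 ∧
        M.lc h * M.lc b ^ m = algebraMap k E c * (M.lc h1 * M.lc b ^ a.natAbs) ^ j := by
    intro h h0 hΨ m hm
    obtain ⟨j, hj⟩ : (a.natAbs : ℤ) ∣ m := Int.natAbs_dvd.2 ((hmem m).1 ⟨h, h0, hΨ, hm⟩)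
    refine ⟨j, hj, ?_⟩
    have hq0 : h * (h1 ^ j)⁻¹ ≠ 0 := mul_ne_zero h0 (inv_ne_zero (zpow_ne_zero _ h10))
    have hqΨ : M.Ψ (h * (h1 ^ j)⁻¹) ∈ M.F0 := by
      rw [map_mul, map_inv₀, map_zpow₀]
      exact mul_mem hΨ (inv_mem (zpow_mem h1Ψ j))
    have hqv : M.v (h * (h1 ^ j)⁻¹) = 0 := by
      rw [M.v_mul h0 (inv_ne_zero (zpow_ne_zero _ h10)), M.v_inv, M.v_zpow]
      rw [hj] at hm
      linear_combination hm - j * h1v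
    obtain ⟨c, hc⟩ := M.lc_mem hqΨ hqv
    refine ⟨c, ?_, ?_⟩
    · rintro rfl
      exact M.lc_ne hq0 (by rw [← hc, map_zero])
    · rw [hc, map_mul, map_inv₀, map_zpow₀, mul_zpow, ← zpow_natCast (M.lc b), ← zpow_mul, ← hj]
      field_simp [zpow_ne_zero j (M.lc_ne h10)]
  refine ⟨_, _, hn, M.tr _ ?_, key⟩
  intro hz
  apply hφ.not_mem
  refine M.mem_of_pow_mem hn ?_
  have hv : M.v (h1 * b ^ a.natAbs) = 0 := by
    rw [M.v_mul h10 (pow_ne_zero _ hb0), M.v_pow]; exact h1v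
  have h2 : M.Ψ (h1 * b ^ a.natAbs) ∈ M.F0 := by
    rw [Ψ_apply, hv, zpow_zero, mul_one, map_mul, map_pow]
    exact pow_mem hz _
  rw [map_mul, map_pow] at h2
  have := mul_mem (inv_mem h1Ψ) h2
  rwa [← mul_assoc, inv_mul_cancel₀ ((map_ne_zero _).2 h10), one_mul] at this

end IsMin

/-- The leading form of the value of `h` at `s` in terms of `φ` and `z`. -/
def HasLead (M : Model k K L E) (s : L) (φ : Polynomial K) (z : E) (a : L) : Prop :=
  ∃ (f : Polynomial K) (i : ℕ) (P : Polynomial k),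
    f ≠ 0 ∧ f.natDegree < φ.natDegree ∧ P.coeff 0 ≠ 0 ∧
    M.v a = M.v (Polynomial.aeval s f) + i * M.v (Polynomial.aeval s φ) ∧
    M.lc a = M.lc (Polynomial.aeval s f) * M.lc (Polynomial.aeval s φ) ^ i * Polynomial.aeval z P

/-- `z` is a uniformising residue attached to `φ`. -/
structure IsUnif (M : Model k K L E) (s : L) (φ : Polynomial K) (z : E) (e₁ : ℕ) : Prop
    extends M.IsMin s φ where
  e₁_pos : 0 < e₁
  z_tr : Transcendental k z
  repr : ∀ h : L, h ≠ 0 → M.Ψ h ∈ M.F0 → ∀ m : ℤ, M.v h + m * M.v (Polynomial.aeval s φ) = 0 →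
      ∃ j : ℤ, m = e₁ * j ∧ ∃ c : k, c ≠ 0 ∧
        M.lc h * M.lc (Polynomial.aeval s φ) ^ m = algebraMap k E c * z ^ j

lemma aeval_div (s : L) (φ h : Polynomial K) :
    Polynomial.aeval s h = Polynomial.aeval s (h %ₘ φ)
      + Polynomial.aeval s φ * Polynomial.aeval s (h /ₘ φ) := by
  rw [← map_mul, ← map_add, Polynomial.modByMonic_add_div]

lemma IsMin.exists_isUnif (hφ : M.IsMin s φ) : ∃ z e₁, IsUnif M s φ z e₁ := by
  obtain ⟨z, e₁, h1, h2, h3⟩ := hφ.exists_z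
  exact ⟨z, e₁, hφ, h1, h2, h3⟩

namespace IsUnif
variable {z : E} {e₁ : ℕ} (hz : IsUnif M s φ z e₁)
include hz

lemma z_ne : z ≠ 0 := by
  rintro rfl
  exact hz.z_tr isAlgebraic_zero

lemma aeval_ne {P : Polynomial k} (hP : P ≠ 0) : Polynomial.aeval z P ≠ 0 :=
  fun h => hz.z_tr ⟨P, hP, h⟩

lemma hasLead_add {f : Polynomial K} (hf : f ≠ 0) (hfd : f.natDegree < φ.natDegree)
    {b : L} (hb0 : b ≠ 0) (hb : HasLead M s φ z b) :
    M.v (Polynomial.aeval s f + Polynomial.aeval s φ * b)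
      = min (M.v (Polynomial.aeval s f)) (M.v (Polynomial.aeval s φ * b)) ∧
    HasLead M s φ z (Polynomial.aeval s f + Polynomial.aeval s φ * b) := by
  obtain ⟨f1, i, P, hf1, hfd1, hP, hv, hlc⟩ := hb
  have hA : Polynomial.aeval s f ≠ 0 := hz.ev_ne hf
  have hA1 : Polynomial.aeval s f1 ≠ 0 := hz.ev_ne hf1
  have hφ0 := hz.φ_ne
  have hB := mul_ne_zero hφ0 hb0
  have hvB := M.v_mul hφ0 hb0
  rcases lt_trichotomy (M.v (Polynomial.aeval s f)) (M.v (Polynomial.aeval s φ * b)) with h | h | h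
  · obtain ⟨h1, h2⟩ := M.v_add_of_lt hA hB h
    refine ⟨by rw [h1, min_eq_left h.le], f, 0, 1, hf, hfd, by simp, by simp [h1], by simp [h2]⟩
  · have hq0 : Polynomial.aeval s f1 * (Polynomial.aeval s f)⁻¹ ≠ 0 :=
      mul_ne_zero hA1 (inv_ne_zero hA)
    obtain ⟨j, hj, c, hc, hl⟩ := hz.repr (Polynomial.aeval s f1 * (Polynomial.aeval s f)⁻¹) hq0
      (by rw [map_mul, map_inv₀]; exact mul_mem (hz.mem _ hfd1) (inv_mem (hz.mem _ hfd)))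
      ((i : ℤ) + 1) (by
        rw [M.v_mul hA1 (inv_ne_zero hA), M.v_inv]
        rw [hvB, hv] at h
        linarith)
    have hj0 : 0 < j := by
      by_contra hcon
      have : (e₁ : ℤ) * j ≤ 0 := mul_nonpos_of_nonneg_of_nonpos (by positivity) (by omega)
      omega
    obtain ⟨j, rfl⟩ : ∃ n : ℕ, j = n := ⟨j.toNat, by omega⟩
    have hj1 : 0 < j := by exact_mod_cast hj0
    set Q : Polynomial k := 1 + Polynomial.C c * Polynomial.X ^ j * P with hQ
    have hQ0 : Q.coeff 0 = 1 := by
      rw [hQ, Polynomial.coeff_add, Polynomial.mul_coeff_zero, Polynomial.mul_coeff_zero,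
        Polynomial.coeff_X_pow, if_neg (by omega)]
      simp
    have hsum : M.lc (Polynomial.aeval s f) + M.lc (Polynomial.aeval s φ * b)
        = M.lc (Polynomial.aeval s f) * Polynomial.aeval z Q := by
      have hlA := M.lc_ne hA
      have e1 : M.lc (Polynomial.aeval s φ * b) = M.lc (Polynomial.aeval s f) *
          (M.lc (Polynomial.aeval s f1 * (Polynomial.aeval s f)⁻¹) *
            M.lc (Polynomial.aeval s φ) ^ ((i : ℤ) + 1)) * Polynomial.aeval z P := by
        rw [map_mul, hlc, map_mul, map_inv₀]
        have : M.lc (Polynomial.aeval s φ) ^ ((i : ℤ) + 1)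
          = M.lc (Polynomial.aeval s φ) ^ (i + 1) := by
          rw [← zpow_natCast]; push_cast; rfl
        rw [this]
        field_simp
        ring
      rw [e1, hl, hQ]
      simp only [zpow_natCast, map_add, map_one, map_mul, Polynomial.aeval_C, map_pow,
        Polynomial.aeval_X]
      ring
    have hne : M.lc (Polynomial.aeval s f) + M.lc (Polynomial.aeval s φ * b) ≠ 0 := by
      rw [hsum]
      refine mul_ne_zero (M.lc_ne hA) (hz.aeval_ne ?_)
      intro h0
      rw [h0] at hQ0
      simp at hQ0
    obtain ⟨h1, h2⟩ := M.v_add_of_eq h hne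
    refine ⟨by rw [h1, ← h, min_self], f, 0, Q, hf, hfd, by simp [hQ0], by simp [h1], ?_⟩
    rw [h2, hsum]
    simp
  · obtain ⟨h1, h2⟩ := M.v_add_of_lt hB hA h
    rw [add_comm] at h1 h2
    refine ⟨by rw [h1, min_eq_right h.le], f1, i + 1, P, hf1, hfd1, hP, ?_, ?_⟩
    · rw [h1, hvB, hv]; push_cast; ring
    · rw [h2, map_mul, hlc]; ring

lemma natDegree_mod_lt (h : Polynomial K) : (h %ₘ φ).natDegree < φ.natDegree :=
  Polynomial.natDegree_modByMonic_lt h hz.monic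
    fun h1 => by have := hz.natDegree_pos; rw [h1] at this; simp at this

lemma hasLead (h : Polynomial K) (hh : h ≠ 0) : HasLead M s φ z (Polynomial.aeval s h) := by
  induction hn : h.natDegree using Nat.strong_induction_on generalizing h with
  | _ n ih =>
  subst hn
  have hnp := hz.natDegree_pos
  by_cases hd : h.natDegree < φ.natDegree
  · exact ⟨h, 0, 1, hh, hd, by simp, by simp, by simp⟩
  have hdeg : (h /ₘ φ).natDegree = h.natDegree - φ.natDegree :=
    Polynomial.natDegree_divByMonic h hz.monic
  have hq0 : h /ₘ φ ≠ 0 := by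
    rw [Ne, Polynomial.divByMonic_eq_zero_iff hz.monic]
    exact fun hlt => hd (Polynomial.natDegree_lt_natDegree hh hlt)
  have hq := ih _ (by omega) _ hq0 rfl
  rw [aeval_div s φ h]
  by_cases hr : h %ₘ φ = 0
  · obtain ⟨f1, i, P, hf1, hfd1, hP, hv, hlc⟩ := hq
    refine ⟨f1, i + 1, P, hf1, hfd1, hP, ?_, ?_⟩
    · rw [hr, map_zero, zero_add, M.v_mul hz.φ_ne (hz.ev_ne hq0), hv]; push_cast; ring
    · rw [hr, map_zero, zero_add, map_mul, hlc]; ring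
  · exact (hz.hasLead_add hr (hz.natDegree_mod_lt h) (hz.ev_ne hq0) hq).2

end IsUnif
end Model
end FieldGen

namespace FieldGen
namespace Model
variable {k K L E : Type} [Field k] [Field K] [Field L] [Field E] [Algebra k K]
    [Algebra K L] [Algebra k L] [Algebra k E] (M : Model k K L E)

/-- The valuation ring of the model. -/
noncomputable def V : Subring L where
  carrier := {l | 0 ≤ (M.ι l).orderTop}
  mul_mem' hx hy := by
    simp only [Set.mem_ofPred_eq, map_mul] at *
    exact orderTop_mul_nonneg hx hy
  one_mem' := by simp
  add_mem' hx hy := by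
    simp only [Set.mem_ofPred_eq, map_add] at *
    exact orderTop_add_nonneg hx hy
  zero_mem' := by simp
  neg_mem' hx := by
    simpa using hx

lemma mem_V {l : L} : l ∈ M.V ↔ 0 ≤ M.v l := by
  change 0 ≤ (M.ι l).orderTop ↔ _
  rw [HahnSeries.zero_le_orderTop_iff]; rfl

/-- The residue map of the model. -/
noncomputable def res : M.V →+* E where
  toFun l := (M.ι l).coeff 0
  map_zero' := by simp
  map_one' := by simp
  map_add' x y := by simp
  map_mul' x y := by
    simp only [Subring.coe_mul, map_mul]
    exact coeff_zero_mul x.2 y.2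

lemma res_apply (l : M.V) : M.res l = (M.ι l).coeff 0 := rfl

lemma res_of_pos {l : M.V} (h : 0 < M.v l) : M.res l = 0 :=
  HahnSeries.coeff_eq_zero_of_lt_order h

lemma res_of_eq {l : M.V} (h : M.v l = 0) : M.res l = M.lc l := by
  rw [lc_apply, HahnSeries.leadingCoeff_eq, res_apply]
  change _ = (M.ι l).coeff (M.v l)
  rw [h]

lemma res_mem {l : M.V} (h : M.Ψ l ∈ M.F0) : M.res l ∈ M.F0 := by
  rcases (M.mem_V.1 l.2).lt_or_eq with h1 | h1
  · rw [M.res_of_pos h1]; exact zero_mem _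
  · rw [M.res_of_eq h1.symm]; exact M.lc_mem h h1.symm

lemma Ψ_eq_of_lead {a b : L} {c : E} (hv : M.v a = M.v b) (hl : M.lc a = M.lc b * c) :
    M.Ψ a = M.Ψ b * c ^ M.e := by
  rw [Ψ_apply, Ψ_apply, hv, hl]; ring

variable {M} {s : L} {φ : Polynomial K}

namespace IsUnif
variable {z : E} {e₁ : ℕ} (hz : IsUnif M s φ z e₁)
include hz

lemma Ψ_φ : ∃ (j : ℕ) (c : k), c ≠ 0 ∧
    M.Ψ (Polynomial.aeval s φ) = algebraMap k E c * z ^ j := by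
  obtain ⟨j, hj, c, hc, h⟩ := hz.repr (algebraMap K L M.t ^ M.v (Polynomial.aeval s φ))
    (zpow_ne_zero _ ((map_ne_zero _).2 M.t_ne)) (by rw [← map_zpow₀]; exact M.Ψ_K _) M.e (by
      rw [M.v_zpow, M.v_t]; ring)
  have hj0 : 0 ≤ j := by
    by_contra hcon
    have h1 := hz.e₁_pos
    have := M.e_pos
    have : (e₁ : ℤ) * j < 0 := mul_neg_of_pos_of_neg (by omega) (by omega)
    omega
  obtain ⟨j, rfl⟩ := Int.eq_ofNat_of_zero_le hj0
  refine ⟨j, c, hc, ?_⟩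
  rw [zpow_natCast, zpow_natCast, map_zpow₀] at h
  rw [← h, Ψ_apply, θ, mul_comm]

lemma Ψ_poly (h : Polynomial K) (hh : h ≠ 0) : ∃ (m : ℕ) (c : k) (P : Polynomial k), c ≠ 0 ∧
    P.coeff 0 ≠ 0 ∧
    M.Ψ (Polynomial.aeval s h) = algebraMap k E c * z ^ m * Polynomial.aeval z P ^ M.e := by
  obtain ⟨f, i, P, hf, hfd, hP, hv, hl⟩ := hz.hasLead h hh
  obtain ⟨j, c, hc, hj⟩ := hz.Ψ_φ
  obtain ⟨c', hc'⟩ := hz.mem f hfd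
  refine ⟨j * i, c' * c ^ i, P, mul_ne_zero ?_ (pow_ne_zero _ hc), hP, ?_⟩
  · rintro rfl
    rw [map_zero, eq_comm, map_eq_zero] at hc'
    exact hz.ev_ne hf hc'
  · rw [M.Ψ_eq_of_lead (b := Polynomial.aeval s f * Polynomial.aeval s φ ^ i)
      (c := Polynomial.aeval z P) ?_ ?_, map_mul, map_pow, hj, ← hc']
    · simp only [map_mul, map_pow]; ring
    · rw [hv, M.v_mul (hz.ev_ne hf) (pow_ne_zero _ hz.φ_ne), M.v_pow]
    · rw [hl, map_mul, map_pow]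

lemma Ψ_poly_mem (h : Polynomial K) :
    ∃ Q : Polynomial k, M.Ψ (Polynomial.aeval s h) = Polynomial.aeval z Q := by
  by_cases hh : h = 0
  · exact ⟨0, by simp [hh]⟩
  obtain ⟨m, c, P, -, -, h1⟩ := hz.Ψ_poly h hh
  exact ⟨Polynomial.C c * Polynomial.X ^ m * P ^ M.e, by rw [h1]; simp⟩

lemma exists_res_quot (N : ℕ) (h : Polynomial K) (hd : h.natDegree ≤ φ.natDegree * N)
    (hV : Polynomial.aeval s h / Polynomial.aeval s φ ^ N ∈ M.V) :
    ∃ hκ : algebraMap K L (h.coeff (φ.natDegree * N)) ∈ M.V, ∃ p : Polynomial k,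
      M.res ⟨_, hV⟩ = Polynomial.aeval z⁻¹ p ∧ algebraMap k E (p.coeff 0) = M.res ⟨_, hκ⟩ := by
  induction N generalizing h with
  | zero =>
    have h0 : h = Polynomial.C (h.coeff 0) := Polynomial.eq_C_of_natDegree_eq_zero (by simpa using hd)
    have h1 : Polynomial.aeval s h / Polynomial.aeval s φ ^ 0 = algebraMap K L (h.coeff 0) := by
      conv_lhs => rw [h0]
      simp
    have hκ : algebraMap K L (h.coeff 0) ∈ M.V := h1 ▸ hV
    obtain ⟨c, hc⟩ := M.res_mem (l := ⟨_, hκ⟩) (M.Ψ_K _)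
    refine ⟨by simpa using hκ, Polynomial.C c, ?_, ?_⟩
    · simp only [h1, Polynomial.aeval_C]; exact hc.symm
    · simpa using hc
  | succ N ih =>
    set f := h %ₘ φ with hf
    set h1 := h /ₘ φ with hh1
    have hfd : f.natDegree < φ.natDegree := hz.natDegree_mod_lt h
    have hsplit := aeval_div s φ h
    rw [← hf, ← hh1] at hsplit
    have hh : f + φ * h1 = h := Polynomial.modByMonic_add_div h φ
    have hd1 : h1.natDegree ≤ φ.natDegree * N := by
      rw [hh1, Polynomial.natDegree_divByMonic h hz.monic]
      rw [Nat.mul_succ] at hd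
      omega
    have hcoef : h.coeff (φ.natDegree * (N + 1)) = h1.coeff (φ.natDegree * N) := by
      rw [← hh, Polynomial.coeff_add, Polynomial.coeff_eq_zero_of_natDegree_lt (p := f)
        (hfd.trans_le (Nat.le_mul_of_pos_right _ (by omega))), zero_add, Nat.mul_succ,
        add_comm (φ.natDegree * N), Polynomial.coeff_mul_add_eq_of_natDegree_le le_rfl hd1,
        Polynomial.coeff_natDegree, hz.monic.leadingCoeff, one_mul]
    have hφ0 := hz.φ_ne
    have hval : Polynomial.aeval s h / Polynomial.aeval s φ ^ (N + 1)
        = Polynomial.aeval s f / Polynomial.aeval s φ ^ (N + 1)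
          + Polynomial.aeval s h1 / Polynomial.aeval s φ ^ N := by
      rw [hsplit]; field_simp; ring
    have hboth : Polynomial.aeval s f / Polynomial.aeval s φ ^ (N + 1) ∈ M.V ∧
        Polynomial.aeval s h1 / Polynomial.aeval s φ ^ N ∈ M.V := by
      by_cases hf0 : f = 0
      · rw [hval] at hV
        simp only [hf0, map_zero, zero_div, zero_add] at hV ⊢
        exact ⟨zero_mem _, hV⟩
      by_cases hh0 : h1 = 0
      · rw [hval] at hV
        simp only [hh0, map_zero, zero_div, add_zero] at hV ⊢
        exact ⟨hV, zero_mem _⟩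
      have hmin := (hz.hasLead_add hf0 hfd (hz.ev_ne hh0) (hz.hasLead h1 hh0)).1
      rw [← hsplit, M.v_mul hφ0 (hz.ev_ne hh0)] at hmin
      have hh0' : h ≠ 0 := by
        intro h0
        rw [h0] at hh1
        exact hh0 (by rw [hh1, Polynomial.zero_divByMonic])
      rw [M.mem_V, div_eq_mul_inv, M.v_mul (hz.ev_ne hh0') (inv_ne_zero (pow_ne_zero _ hφ0)),
        M.v_inv, M.v_pow] at hV
      rw [M.mem_V, M.mem_V, div_eq_mul_inv, div_eq_mul_inv,
        M.v_mul (hz.ev_ne hf0) (inv_ne_zero (pow_ne_zero _ hφ0)),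
        M.v_mul (hz.ev_ne hh0) (inv_ne_zero (pow_ne_zero _ hφ0)), M.v_inv, M.v_inv, M.v_pow, M.v_pow]
      push_cast at hV ⊢
      rw [hmin] at hV
      constructor
      · have := min_le_left (M.v (Polynomial.aeval s f))
          (M.v (Polynomial.aeval s φ) + M.v (Polynomial.aeval s h1))
        linarith
      · have := min_le_right (M.v (Polynomial.aeval s f))
          (M.v (Polynomial.aeval s φ) + M.v (Polynomial.aeval s h1))
        linarith
    obtain ⟨hfV, h1V⟩ := hboth
    obtain ⟨hκ, p, hp, hp0⟩ := ih h1 hd1 h1V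
    have hκ' : algebraMap K L (h.coeff (φ.natDegree * (N + 1))) ∈ M.V := by rw [hcoef]; exact hκ
    have hres : M.res ⟨_, hV⟩ = M.res ⟨_, hfV⟩ + M.res ⟨_, h1V⟩ := by
      rw [← map_add]
      congr 1
      exact Subtype.ext hval
    have hκκ : M.res ⟨_, hκ'⟩ = M.res ⟨_, hκ⟩ := by
      congr 1
      exact Subtype.ext (congrArg (algebraMap K L) hcoef)
    refine ⟨hκ', ?_⟩
    rw [hres, hκκ, hp, ← hp0]
    by_cases hf0 : f = 0
    · refine ⟨p, ?_, rfl⟩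
      rw [res_apply]
      simp [hf0]
    rcases (M.mem_V.1 hfV).lt_or_eq with h2 | h2
    · refine ⟨p, ?_, rfl⟩
      rw [M.res_of_pos h2, zero_add]
    · obtain ⟨j, hj, c, hc, hl⟩ := hz.repr (Polynomial.aeval s f) (hz.ev_ne hf0) (hz.mem f hfd)
        (-(N + 1 : ℕ)) (by
          rw [div_eq_mul_inv, M.v_mul (hz.ev_ne hf0) (inv_ne_zero (pow_ne_zero _ hφ0)),
            M.v_inv, M.v_pow] at h2
          linarith)
      have hj0 : j < 0 := by
        by_contra hcon
        have : 0 ≤ (e₁ : ℤ) * j := mul_nonneg (by positivity) (by omega)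
        push_cast at hj
        omega
      obtain ⟨i, rfl⟩ : ∃ i : ℕ, j = -(i : ℤ) := ⟨(-j).toNat, by omega⟩
      refine ⟨p + Polynomial.C c * Polynomial.X ^ i, ?_, ?_⟩
      · rw [M.res_of_eq h2.symm, map_div₀, map_pow, div_eq_mul_inv, ← zpow_natCast, ← zpow_neg, hl]
        simp only [zpow_neg, zpow_natCast, map_add, map_mul, Polynomial.aeval_C, map_pow,
          Polynomial.aeval_X, inv_pow]
        ring
      · rw [Polynomial.coeff_add, Polynomial.coeff_C_mul, Polynomial.coeff_X_pow,
          if_neg (by omega), mul_zero, add_zero]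

end IsUnif

lemma dvd_v_of_isUnif_X {z : E} {e₁ : ℕ} (hz : IsUnif M s Polynomial.X z e₁)
    (hs : M.v s = 0) (h : Polynomial K) (hh : h ≠ 0) : (M.e : ℤ) ∣ M.v (Polynomial.aeval s h) := by
  obtain ⟨f, i, P, hf, hfd, -, hv, -⟩ := hz.hasLead h hh
  rw [Polynomial.natDegree_X, Nat.lt_one_iff] at hfd
  rw [Polynomial.eq_C_of_natDegree_eq_zero hfd] at hv hf
  rw [Polynomial.aeval_C, Polynomial.aeval_X, hs, mul_zero, add_zero] at hv
  obtain ⟨c0, -, m, hm, -⟩ := M.order_K (f.coeff 0) (by simpa using hf)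
  rw [hv, v, hm]
  exact ⟨-m, by ring⟩

end Model
end FieldGen

namespace FieldGen

section Seidenberg
variable {T L : Type} [CommRing T] [Field L] (f : T →+* L) (P : Ideal T) (u : L)

lemma exists_linear_relation (hker : ∀ a, f a = 0 → a ∈ P)
    (hint : ∀ Q : Polynomial T, Q.Monic → ∀ g, Polynomial.eval₂ f g Q = 0 → ∃ c, f c = g)
    (Q : Polynomial T) (hQ : Polynomial.eval₂ f u Q = 0) (hQP : ∃ i, Q.coeff i ∉ P) :
    ∃ a b, f a * u = f b ∧ ¬ (a ∈ P ∧ b ∈ P) := by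
  induction hn : Q.natDegree using Nat.strong_induction_on generalizing Q with
  | _ n ih =>
  subst hn
  obtain ⟨i, hi⟩ := hQP
  by_cases hd : Q.natDegree = 0
  · exfalso
    rw [Polynomial.eq_C_of_natDegree_eq_zero hd, Polynomial.eval₂_C] at hQ
    by_cases h0 : i = 0
    · exact hi (h0 ▸ hker _ hQ)
    · exact hi (by rw [Polynomial.coeff_eq_zero_of_natDegree_lt (by omega)]; exact zero_mem _)
  have hQ0 : Q ≠ 0 := by rintro rfl; simp at hd
  have h1 : Polynomial.eval₂ f (f Q.leadingCoeff * u) Q.integralNormalization = 0 := by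
    rw [Polynomial.integralNormalization_eval₂_leadingCoeff_mul (by omega), hQ, mul_zero]
  obtain ⟨b, hb⟩ := hint _ (Polynomial.monic_integralNormalization hQ0) _ h1
  by_cases hP : Q.leadingCoeff ∈ P ∧ b ∈ P
  swap
  · exact ⟨_, _, hb.symm, hP⟩
  set Q' := Q.eraseLead + Polynomial.C b * Polynomial.X ^ (Q.natDegree - 1) with hQ'
  refine ih Q'.natDegree ?_ Q' ?_ ⟨i, ?_⟩ rfl
  · have h2 : Q'.natDegree ≤ Q.natDegree - 1 :=
      (Polynomial.natDegree_add_le _ _).trans (max_le (Polynomial.eraseLead_natDegree_le _)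
        (Polynomial.natDegree_C_mul_X_pow_le _ _))
    omega
  · have h3 := Polynomial.eraseLead_add_monomial_natDegree_leadingCoeff Q
    rw [hQ', Polynomial.eval₂_add, Polynomial.eval₂_mul, Polynomial.eval₂_C, Polynomial.eval₂_pow,
      Polynomial.eval₂_X, hb]
    rw [← h3, Polynomial.eval₂_add, Polynomial.eval₂_monomial] at hQ
    have h4 : u ^ Q.natDegree = u * u ^ (Q.natDegree - 1) := by
      rw [← pow_succ', Nat.sub_add_cancel (by omega)]
    rw [h4] at hQ
    linear_combination hQ
  · have h5 : Q.coeff i = Q'.coeff i + ((if i = Q.natDegree then Q.leadingCoeff else 0)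
        - (if i = Q.natDegree - 1 then b else 0)) := by
      rw [hQ', Polynomial.coeff_add, Polynomial.coeff_C_mul, Polynomial.coeff_X_pow,
        Polynomial.eraseLead_coeff]
      by_cases h6 : i = Q.natDegree
      · subst h6; simp
      · simp [h6]
    intro hc
    apply hi
    rw [h5]
    refine add_mem hc (sub_mem ?_ ?_)
    · split_ifs
      exacts [hP.1, zero_mem _]
    · split_ifs
      exacts [hP.2, zero_mem _]

lemma exists_relation_or_valuation [P.IsPrime] (hker : ∀ a, f a = 0 → a ∈ P)
    (hint : ∀ Q : Polynomial T, Q.Monic → ∀ g, Polynomial.eval₂ f g Q = 0 → ∃ c, f c = g) :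
    (∃ a b, f a * u = f b ∧ ¬ (a ∈ P ∧ b ∈ P)) ∨
    ∃ W : ValuationSubring L, (∀ Q : Polynomial T, Polynomial.eval₂ f u Q ∈ W) ∧
      (∀ Q : Polynomial T, (∃ i, Q.coeff i ∉ P) → (Polynomial.eval₂ f u Q)⁻¹ ∈ W) ∧
      ∀ a ∈ P, f a ≠ 0 → (f a)⁻¹ ∉ W := by
  by_cases hrel : ∃ Q : Polynomial T, Polynomial.eval₂ f u Q = 0 ∧ ∃ i, Q.coeff i ∉ P
  · obtain ⟨Q, h1, h2⟩ := hrel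
    exact Or.inl (exists_linear_relation f P u hker hint Q h1 h2)
  right
  push Not at hrel
  have : (P.map (Polynomial.C : T →+* Polynomial T)).IsPrime := Ideal.isPrime_map_C_of_isPrime
  have hnot : ∀ Q : Polynomial T, Q ∉ P.map (Polynomial.C : T →+* Polynomial T) ↔
      ∃ i, Q.coeff i ∉ P := by
    intro Q
    rw [Ideal.mem_map_C_iff]
    push Not
    rfl
  have hunit : ∀ y : (P.map (Polynomial.C : T →+* Polynomial T)).primeCompl,
      IsUnit (Polynomial.eval₂RingHom f u y) := by
    intro y
    rw [isUnit_iff_ne_zero]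
    intro h
    obtain ⟨i, hi⟩ := (hnot _).1 y.2
    exact hi (hrel _ h i)
  let R := Localization.AtPrime (P.map (Polynomial.C : T →+* Polynomial T))
  let F : R →+* L := IsLocalization.lift hunit
  have hF : ∀ Q, F (algebraMap _ R Q) = Polynomial.eval₂ f u Q := fun Q =>
    IsLocalization.lift_eq hunit Q
  obtain ⟨W, hW, hloc⟩ := IsLocalRing.exists_factor_valuationRing F
  refine ⟨W, fun Q => hF Q ▸ hW _, fun Q hQ => ?_, fun a ha ha0 hinv => ?_⟩
  · have h1 : IsUnit (algebraMap _ R Q) :=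
      IsLocalization.map_units R (⟨Q, (hnot Q).2 hQ⟩ :
        (P.map (Polynomial.C : T →+* Polynomial T)).primeCompl)
    obtain ⟨y, hy⟩ := h1.exists_right_inv
    have h2 := hW y
    have h3 : F (algebraMap _ R Q) * F y = 1 := by rw [← map_mul, hy, map_one]
    rw [hF] at h3
    rwa [inv_eq_of_mul_eq_one_right h3]
  · have h1 : F (algebraMap _ R (Polynomial.C a)) = f a := by rw [hF, Polynomial.eval₂_C]
    have h2 : IsUnit (F.codRestrict W.toSubring hW (algebraMap _ R (Polynomial.C a))) := by
      refine IsUnit.of_mul_eq_one ⟨(f a)⁻¹, hinv⟩ (Subtype.ext ?_)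
      change F (algebraMap _ R (Polynomial.C a)) * (f a)⁻¹ = 1
      rw [h1, mul_inv_cancel₀ ha0]
    have h3 := hloc.map_nonunit _ h2
    rw [IsLocalization.AtPrime.isUnit_to_map_iff R (P.map (Polynomial.C : T →+* Polynomial T))] at h3
    obtain ⟨i, hi⟩ := (hnot _).1 h3
    rw [Polynomial.coeff_C] at hi
    split_ifs at hi
    exacts [hi ha, hi (zero_mem _)]

end Seidenberg

/-- An element algebraic integral over a subring with the valuation dichotomy lies in it. -/
lemma mem_of_monic_relation {L : Type} [Field L] (V : Subring L)
    (hV : ∀ x : L, x ∈ V ∨ x⁻¹ ∈ V) (g : L) (d : ℕ) (b : ℕ → L) (hb : ∀ i, b i ∈ V)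
    (h : g ^ (d + 1) + ∑ i ∈ Finset.range (d + 1), b i * g ^ i = 0) : g ∈ V := by
  by_cases hg : g = 0
  · exact hg ▸ zero_mem _
  rcases hV g with h1 | h1
  · exact h1
  have h2 : g = -∑ i ∈ Finset.range (d + 1), b i * g⁻¹ ^ (d - i) := by
    have h3 : (g⁻¹) ^ d * (g ^ (d + 1) + ∑ i ∈ Finset.range (d + 1), b i * g ^ i)
        = g + ∑ i ∈ Finset.range (d + 1), b i * g⁻¹ ^ (d - i) := by
      rw [mul_add, Finset.mul_sum, pow_succ, ← mul_assoc, ← mul_pow, inv_mul_cancel₀ hg, one_pow,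
        one_mul]
      congr 1
      refine Finset.sum_congr rfl fun i hi => ?_
      have : d = (d - i) + i := by rw [Finset.mem_range] at hi; omega
      conv_lhs => rw [this]
      rw [pow_add]
      have h5 : g⁻¹ ^ i * g ^ i = 1 := by rw [← mul_pow, inv_mul_cancel₀ hg, one_pow]
      linear_combination (b i * g⁻¹ ^ (d - i)) * h5
    rw [h, mul_zero] at h3
    exact eq_neg_of_add_eq_zero_left h3.symm
  rw [h2]
  exact neg_mem (sum_mem fun i _ => mul_mem (hb i) (pow_mem h1 _))

lemma exists_aeval_of_monic_relation {K L : Type} [Field K] [Field L] [Algebra K L] {s : L}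
    (tr : Transcendental K s)
    (gen : ∀ l : L, ∃ h h' : Polynomial K, Polynomial.aeval s h' ≠ 0 ∧
      l * Polynomial.aeval s h' = Polynomial.aeval s h) (g : L) (d : ℕ) (b : ℕ → Polynomial K)
    (h : g ^ (d + 1) + ∑ i ∈ Finset.range (d + 1), Polynomial.aeval s (b i) * g ^ i = 0) :
    ∃ c : Polynomial K, Polynomial.aeval s c = g := by
  have hinj' : Function.Injective (Polynomial.aeval s : Polynomial K →ₐ[K] L) :=
    (transcendental_iff_injective (R := K) (x := s)).1 tr
  let _ : Algebra (Polynomial K) L := (Polynomial.aeval s : Polynomial K →ₐ[K] L).toRingHom.toAlgebra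
  have hal : ∀ c, algebraMap (Polynomial K) L c = Polynomial.aeval s c := fun _ => rfl
  have hinj : Function.Injective (algebraMap (Polynomial K) L) := hinj'
  have : FaithfulSMul (Polynomial K) L := (faithfulSMul_iff_algebraMap_injective _ _).2 hinj
  have : IsFractionRing (Polynomial K) L := by
    refine IsFractionRing.of_field _ _ fun l => ?_
    obtain ⟨h, h', h0, h1⟩ := gen l
    exact ⟨h, h', by rw [hal, hal, eq_div_iff h0, h1]⟩
  refine (IsIntegrallyClosed.isIntegral_iff (R := Polynomial K) (x := g)).1 ?_
  refine ⟨Polynomial.X ^ (d + 1) + ∑ i ∈ Finset.range (d + 1),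
    Polynomial.C (b i) * Polynomial.X ^ i, Polynomial.monic_X_pow_add ?_, ?_⟩
  · refine (Polynomial.degree_sum_le _ _).trans_lt ?_
    rw [Finset.sup_lt_iff (by exact WithBot.bot_lt_coe _)]
    intro i hi
    refine (Polynomial.degree_C_mul_X_pow_le _ _).trans_lt ?_
    rw [Finset.mem_range] at hi
    exact_mod_cast hi
  · rw [← h]
    simp [Polynomial.eval₂_finsetSum, hal]

end FieldGen

namespace FieldGen
namespace Model

variable {k K L E : Type} [Field k] [Field K] [Field L] [Field E] [Algebra k K]
    [Algebra K L] [Algebra k L] [Algebra k E] (M : Model k K L E)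

lemma mem_V_or_inv_mem (x : L) : x ∈ M.V ∨ x⁻¹ ∈ M.V := by
  rw [mem_V, mem_V, v_inv]
  omega

lemma algebraMap_mem_V (c : k) : algebraMap k L c ∈ M.V := by
  rw [mem_V, v, ι_k, HahnSeries.order_C]

lemma res_algebraMap (c : k) (h : algebraMap k L c ∈ M.V) : M.res ⟨_, h⟩ = algebraMap k E c := by
  rw [res_apply, ι_k, HahnSeries.C_apply, HahnSeries.coeff_single_same]

/-- Quotients `h(s) / φ(s)^N` lying in the valuation ring, with `deg h ≤ N deg φ`, together with
the corresponding top coefficient. -/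
def topPairs (s : L) (φ : Polynomial K) (hφ : φ.Monic) : Subring (L × K) where
  carrier := {g | g.1 ∈ M.V ∧ ∃ (N : ℕ) (h : Polynomial K), h.natDegree ≤ φ.natDegree * N ∧
    Polynomial.aeval s h = g.1 * Polynomial.aeval s φ ^ N ∧ h.coeff (φ.natDegree * N) = g.2}
  mul_mem' := by
    rintro ⟨g1, c1⟩ ⟨g2, c2⟩ ⟨hg1, N1, h1, hd1, e1, hc1⟩ ⟨hg2, N2, h2, hd2, e2, hc2⟩
    refine ⟨mul_mem hg1 hg2, N1 + N2, h1 * h2, ?_, ?_, ?_⟩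
    · rw [mul_add]; exact Polynomial.natDegree_mul_le_of_le hd1 hd2
    · rw [map_mul, e1, e2, Prod.mk_mul_mk]; ring
    · rw [mul_add, Polynomial.coeff_mul_add_eq_of_natDegree_le hd1 hd2, hc1, hc2, Prod.mk_mul_mk]
  one_mem' := ⟨one_mem _, 0, 1, by simp, by simp, by simp⟩
  add_mem' := by
    rintro ⟨g1, c1⟩ ⟨g2, c2⟩ ⟨hg1, N1, h1, hd1, e1, hc1⟩ ⟨hg2, N2, h2, hd2, e2, hc2⟩
    have hp1 := hφ.natDegree_pow N1
    have hp2 := hφ.natDegree_pow N2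
    have hl1 : (φ ^ N1).coeff (φ.natDegree * N1) = 1 := by
      have := (hφ.pow N1).coeff_natDegree
      rwa [hp1, mul_comm] at this
    have hl2 : (φ ^ N2).coeff (φ.natDegree * N2) = 1 := by
      have := (hφ.pow N2).coeff_natDegree
      rwa [hp2, mul_comm] at this
    have hq1 : (φ ^ N1).natDegree ≤ φ.natDegree * N1 := by rw [hp1, mul_comm]
    have hq2 : (φ ^ N2).natDegree ≤ φ.natDegree * N2 := by rw [hp2, mul_comm]
    refine ⟨add_mem hg1 hg2, N1 + N2, h1 * φ ^ N2 + φ ^ N1 * h2, ?_, ?_, ?_⟩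
    · rw [mul_add]
      exact Polynomial.natDegree_add_le_of_degree_le (Polynomial.natDegree_mul_le_of_le hd1 hq2)
        (Polynomial.natDegree_mul_le_of_le hq1 hd2)
    · simp only [map_add, map_mul, map_pow, e1, e2, Prod.mk_add_mk]; ring
    · rw [mul_add, Polynomial.coeff_add, Polynomial.coeff_mul_add_eq_of_natDegree_le hd1 hq2,
        Polynomial.coeff_mul_add_eq_of_natDegree_le hq1 hd2, hl1, hl2, hc1, hc2, mul_one, one_mul,
        Prod.mk_add_mk]
  zero_mem' := ⟨zero_mem _, 0, 0, by simp, by simp, by simp⟩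
  neg_mem' := by
    rintro ⟨g1, c1⟩ ⟨hg1, N1, h1, hd1, e1, hc1⟩
    exact ⟨neg_mem hg1, N1, -h1, by simpa using hd1, by simp [e1], by simp [hc1]⟩

variable {M} {s : L} {φ : Polynomial K}

lemma exists_raise {hφ : φ.Monic} {g : L × K} (hg : g ∈ M.topPairs s φ hφ) :
    ∃ N0 : ℕ, ∀ N ≥ N0, ∃ h : Polynomial K, h.natDegree ≤ φ.natDegree * N ∧
      Polynomial.aeval s h = g.1 * Polynomial.aeval s φ ^ N ∧
      h.coeff (φ.natDegree * N) = g.2 := by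
  obtain ⟨-, N0, h, hd, he, hc⟩ := hg
  refine ⟨N0, fun N hN => ?_⟩
  obtain ⟨j, rfl⟩ := Nat.exists_eq_add_of_le hN
  have hl : (φ ^ j).coeff (φ.natDegree * j) = 1 := by
    have := (hφ.pow j).coeff_natDegree
    rwa [hφ.natDegree_pow, mul_comm] at this
  have hq : (φ ^ j).natDegree ≤ φ.natDegree * j := by rw [hφ.natDegree_pow, mul_comm]
  refine ⟨h * φ ^ j, ?_, ?_, ?_⟩
  · rw [mul_add]; exact Polynomial.natDegree_mul_le_of_le hd hq
  · rw [map_mul, he, map_pow]; ring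
  · rw [mul_add, Polynomial.coeff_mul_add_eq_of_natDegree_le hd hq, hl, hc, mul_one]

namespace IsUnif
variable {z : E} {e₁ : ℕ} (hz : IsUnif M s φ z e₁)
include hz

lemma snd_mem_V {g : L × K} (hg : g ∈ M.topPairs s φ hz.monic) : algebraMap K L g.2 ∈ M.V := by
  obtain ⟨hV, N, h, hd, he, hc⟩ := hg
  have h1 : Polynomial.aeval s h / Polynomial.aeval s φ ^ N = g.1 := by
    rw [he, mul_div_cancel_right₀ _ (pow_ne_zero _ hz.φ_ne)]
  obtain ⟨hκ, -⟩ := hz.exists_res_quot N h hd (h1 ▸ hV)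
  rwa [hc] at hκ

lemma eq_zero_of_fst {g : L × K} (hg : g ∈ M.topPairs s φ hz.monic) (h0 : g.1 = 0) : g.2 = 0 := by
  obtain ⟨hV, N, h, hd, he, hc⟩ := hg
  rw [h0, zero_mul] at he
  by_contra h2
  refine hz.ev_ne (h := h) ?_ he
  rintro rfl
  exact h2 hc.symm

lemma topPairs_integral
    (gen : ∀ l : L, ∃ h h' : Polynomial K, Polynomial.aeval s h' ≠ 0 ∧
      l * Polynomial.aeval s h' = Polynomial.aeval s h)
    (Q : Polynomial (M.topPairs s φ hz.monic)) (hQ : Q.Monic) (g : L)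
    (h : Polynomial.eval₂ ((RingHom.fst L K).comp (M.topPairs s φ hz.monic).subtype) g Q = 0) :
    ∃ c : M.topPairs s φ hz.monic, c.1.1 = g := by
  set n := φ.natDegree with hn
  obtain ⟨d, hd⟩ : ∃ d, Q.natDegree = d + 1 := by
    refine Nat.exists_eq_succ_of_ne_zero fun h0 => ?_
    rw [hQ.natDegree_eq_zero.1 h0] at h
    simp at h
  rw [Polynomial.eval₂_eq_sum_range, hd, Finset.sum_range_succ, ← hd, hQ.coeff_natDegree, map_one,
    one_mul, hd, add_comm] at h
  change g ^ (d + 1) + ∑ i ∈ Finset.range (d + 1), (Q.coeff i).1.1 * g ^ i = 0 at h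
  have hgV : g ∈ M.V := mem_of_monic_relation M.V M.mem_V_or_inv_mem g d _
    (fun i => (Q.coeff i).2.1) h
  choose N0 hN0 using fun i => exists_raise (Q.coeff i).2
  obtain ⟨N, hN⟩ : ∃ N, ∀ i ∈ Finset.range (d + 1), N0 i ≤ N :=
    ⟨∑ i ∈ Finset.range (d + 1), N0 i, fun i hi =>
      Finset.single_le_sum (f := N0) (fun _ _ => Nat.zero_le _) hi⟩
  have : ∀ i, ∃ h : Polynomial K, i ∈ Finset.range (d + 1) → h.natDegree ≤ n * N ∧
      Polynomial.aeval s h = (Q.coeff i).1.1 * Polynomial.aeval s φ ^ N := by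
    intro i
    by_cases hi : i ∈ Finset.range (d + 1)
    · obtain ⟨h, h1, h2, -⟩ := hN0 i N (hN i hi)
      exact ⟨h, fun _ => ⟨h1, h2⟩⟩
    · exact ⟨0, fun h => absurd h hi⟩
  choose H hH using this
  set a := Polynomial.aeval s φ with ha
  have h2 : (g * a ^ N) ^ (d + 1) + ∑ i ∈ Finset.range (d + 1),
      Polynomial.aeval s (H i * φ ^ (N * (d - i))) * (g * a ^ N) ^ i = 0 := by
    have h3 := congrArg (fun y => a ^ (N * (d + 1)) * y) h
    simp only [mul_zero] at h3
    rw [← h3, mul_add, Finset.mul_sum]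
    congr 1
    · rw [mul_pow, ← pow_mul]; ring
    · refine Finset.sum_congr rfl fun i hi => ?_
      rw [map_mul, (hH i hi).2, map_pow, ← ha]
      have h4 : N * (d + 1) = N + N * (d - i) + N * i := by
        rw [Finset.mem_range] at hi
        obtain ⟨j, rfl⟩ := Nat.exists_eq_add_of_le (Nat.lt_succ_iff.1 hi)
        rw [Nat.add_sub_cancel_left]
        ring
      rw [h4, mul_pow, ← pow_mul]
      ring
  obtain ⟨c, hc⟩ := exists_aeval_of_monic_relation hz.tr gen _ d _ h2
  have h5 : c ^ (d + 1) = - ∑ i ∈ Finset.range (d + 1), H i * φ ^ (N * (d - i)) * c ^ i := by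
    rw [eq_neg_iff_add_eq_zero]
    by_contra h6
    apply hz.ev_ne h6
    rw [← hc] at h2
    simpa using h2
  have h6 : c.natDegree ≤ n * N := by
    by_contra hlt
    push Not at hlt
    have h7 : (c ^ (d + 1)).natDegree ≤ (d + 1) * c.natDegree - 1 := by
      rw [h5, Polynomial.natDegree_neg]
      refine Polynomial.natDegree_sum_le_of_forall_le _ _ fun i hi => ?_
      refine (Polynomial.natDegree_mul_le_of_le (Polynomial.natDegree_mul_le_of_le (hH i hi).1
        (Polynomial.natDegree_pow_le)) (Polynomial.natDegree_pow_le)).trans ?_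
      rw [Finset.mem_range] at hi
      obtain ⟨j, rfl⟩ := Nat.exists_eq_add_of_le (Nat.lt_succ_iff.1 hi)
      rw [Nat.add_sub_cancel_left, ← hn]
      have : (j + 1) * (n * N + 1) ≤ (j + 1) * c.natDegree := Nat.mul_le_mul_left _ hlt
      refine Nat.le_sub_of_add_le ?_
      nlinarith
    rw [Polynomial.natDegree_pow] at h7
    have : 0 < (d + 1) * c.natDegree := Nat.mul_pos (by omega) (by omega)
    omega
  exact ⟨⟨(g, c.coeff (n * N)), hgV, N, c, h6, hc, rfl⟩, rfl⟩

/-- The residue of the top coefficient. -/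
noncomputable def topRes : M.topPairs s φ hz.monic →+* E :=
  M.res.comp ((((algebraMap K L).comp (RingHom.snd L K)).comp
    (M.topPairs s φ hz.monic).subtype).codRestrict M.V fun g => hz.snd_mem_V g.2)

lemma topRes_apply (g : M.topPairs s φ hz.monic) :
    hz.topRes g = M.res ⟨algebraMap K L g.1.2, hz.snd_mem_V g.2⟩ := rfl

lemma const_mem_topPairs (c : K) (hc : algebraMap K L c ∈ M.V) :
    (algebraMap K L c, c) ∈ M.topPairs s φ hz.monic :=
  ⟨hc, 0, Polynomial.C c, by simp, by simp, by simp⟩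

lemma not_exists_valuation [IsScalarTower k K L] (W : ValuationSubring L)
    (h1 : ∀ Q : Polynomial (M.topPairs s φ hz.monic),
      Polynomial.eval₂ ((RingHom.fst L K).comp (M.topPairs s φ hz.monic).subtype) M.u Q ∈ W)
    (h2 : ∀ Q : Polynomial (M.topPairs s φ hz.monic), (∃ i, Q.coeff i ∉ RingHom.ker hz.topRes) →
      (Polynomial.eval₂ ((RingHom.fst L K).comp (M.topPairs s φ hz.monic).subtype) M.u Q)⁻¹ ∈ W)
    (h3 : ∀ a ∈ RingHom.ker hz.topRes, a.1.1 ≠ 0 → (a.1.1)⁻¹ ∉ W) : False := by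
  have ht0 : algebraMap K L M.t ≠ 0 := (map_ne_zero _).2 M.t_ne
  have hep := M.e_pos
  have hkV : ∀ c : k, algebraMap K L (algebraMap k K c) ∈ M.V := fun c => by
    rw [← IsScalarTower.algebraMap_apply]; exact M.algebraMap_mem_V c
  let κ : k →+* M.topPairs s φ hz.monic :=
    (((algebraMap K L).comp (algebraMap k K)).prod (algebraMap k K)).codRestrict _
      fun c => hz.const_mem_topPairs _ (hkV c)
  have hκ : ∀ c : Polynomial k, Polynomial.eval₂
      ((RingHom.fst L K).comp (M.topPairs s φ hz.monic).subtype) M.u (c.map κ)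
        = Polynomial.aeval M.u c := by
    intro c
    rw [Polynomial.eval₂_map, Polynomial.aeval_def, IsScalarTower.algebraMap_eq k K L]
    rfl
  have hκ2 : ∀ c : k, c ≠ 0 → κ c ∉ RingHom.ker hz.topRes := by
    intro c hc
    rw [RingHom.mem_ker, topRes_apply]
    have h4 : M.res ⟨algebraMap K L (algebraMap k K c), hkV c⟩ = algebraMap k E c := by
      rw [← M.res_algebraMap c (M.algebraMap_mem_V c)]
      congr 2
      exact (IsScalarTower.algebraMap_apply k K L c).symm
    change M.res ⟨algebraMap K L (algebraMap k K c), hkV c⟩ ≠ 0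
    rw [h4]
    exact (map_ne_zero _).2 hc
  have htW : algebraMap K L M.t ∉ W := by
    have hv : M.v (algebraMap K L M.t⁻¹) = M.e := by rw [map_inv₀, v_inv, v_t, neg_neg]
    have hm : algebraMap K L M.t⁻¹ ∈ M.V := by rw [mem_V, hv]; positivity
    have h4 := h3 ⟨_, hz.const_mem_topPairs _ hm⟩ (by
      rw [RingHom.mem_ker, topRes_apply]
      exact M.res_of_pos (by rw [hv]; exact_mod_cast hep)) (by simpa using M.t_ne)
    simpa using h4
  have hdom := M.dom W (fun c hc => by
    rw [← hκ c]
    refine ⟨h1 _, h2 _ ⟨c.natDegree, ?_⟩⟩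
    rw [Polynomial.coeff_map]
    exact hκ2 _ (by simpa using hc)) htW
  set g : L := algebraMap K L M.t ^ (-M.v (Polynomial.aeval s φ)) * (Polynomial.aeval s φ ^ M.e)⁻¹
    with hg
  have hg0 : g ≠ 0 := mul_ne_zero (zpow_ne_zero _ ht0) (inv_ne_zero (pow_ne_zero _ hz.φ_ne))
  have hgv : M.v g = 0 := by
    rw [hg, M.v_mul (zpow_ne_zero _ ht0) (inv_ne_zero (pow_ne_zero _ hz.φ_ne)), v_zpow, v_t, v_inv,
      v_pow]
    ring
  have hgT : (g, 0) ∈ M.topPairs s φ hz.monic := by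
    refine ⟨M.mem_V.2 hgv.ge, M.e, Polynomial.C (M.t ^ (-M.v (Polynomial.aeval s φ))), by simp,
      ?_, ?_⟩
    · rw [Polynomial.aeval_C, map_zpow₀, hg, inv_mul_cancel_right₀ (pow_ne_zero _ hz.φ_ne)]
    · rw [Polynomial.coeff_C, if_neg]
      exact (Nat.mul_pos hz.natDegree_pos hep).ne'
  refine h3 ⟨_, hgT⟩ ?_ hg0 (hdom _ (inv_ne_zero hg0) ?_)
  · rw [RingHom.mem_ker, topRes_apply]
    have : (⟨algebraMap K L 0, hz.snd_mem_V hgT⟩ : M.V) = 0 := Subtype.ext (map_zero _)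
    exact this ▸ map_zero _
  · change M.v g⁻¹ = 0
    rw [v_inv, hgv, neg_zero]

/-- The residue field is generated by `z⁻¹` over `k`: there is a linear relation for `U`, whose
value at `z⁻¹ = 0` is computed by top coefficients. -/
theorem exists_relation [IsScalarTower k K L]
    (gen : ∀ l : L, ∃ h h' : Polynomial K, Polynomial.aeval s h' ≠ 0 ∧
      l * Polynomial.aeval s h' = Polynomial.aeval s h) :
    ∃ (h₁ h₂ : Polynomial K) (D : ℕ) (hκ₁ : algebraMap K L (h₁.coeff D) ∈ M.V)
      (hκ₂ : algebraMap K L (h₂.coeff D) ∈ M.V) (p₁ p₂ : Polynomial k),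
      h₁.natDegree ≤ D ∧ h₂.natDegree ≤ D ∧
      M.u * Polynomial.aeval s h₂ = Polynomial.aeval s h₁ ∧
      M.U * Polynomial.aeval z⁻¹ p₂ = Polynomial.aeval z⁻¹ p₁ ∧
      algebraMap k E (p₁.coeff 0) = M.res ⟨_, hκ₁⟩ ∧
      algebraMap k E (p₂.coeff 0) = M.res ⟨_, hκ₂⟩ ∧ ¬ (p₁.coeff 0 = 0 ∧ p₂.coeff 0 = 0) := by
  have hprime : (RingHom.ker hz.topRes).IsPrime := RingHom.ker_isPrime _
  rcases exists_relation_or_valuation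
    ((RingHom.fst L K).comp (M.topPairs s φ hz.monic).subtype) (RingHom.ker hz.topRes) M.u
    (fun a ha => by
      have h0 := hz.eq_zero_of_fst a.2 ha
      rw [RingHom.mem_ker, topRes_apply]
      have : (⟨algebraMap K L a.1.2, hz.snd_mem_V a.2⟩ : M.V) = 0 :=
        Subtype.ext ((congrArg (algebraMap K L) h0).trans (map_zero _))
      rw [this, map_zero]) (hz.topPairs_integral gen) with ⟨a, b, hab, hP⟩ | ⟨W, h1, h2, h3⟩
  swap
  · exact (hz.not_exists_valuation W h1 h2 h3).elim
  change a.1.1 * M.u = b.1.1 at hab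
  obtain ⟨Na, ha⟩ := exists_raise a.2
  obtain ⟨Nb, hb⟩ := exists_raise b.2
  obtain ⟨ha', hda, hea, hca⟩ := ha (max Na Nb) (le_max_left _ _)
  obtain ⟨hb', hdb, heb, hcb⟩ := hb (max Na Nb) (le_max_right _ _)
  set N := max Na Nb
  have key : ∀ (c : M.topPairs s φ hz.monic) (h : Polynomial K), h.natDegree ≤ φ.natDegree * N →
      Polynomial.aeval s h = c.1.1 * Polynomial.aeval s φ ^ N →
      h.coeff (φ.natDegree * N) = c.1.2 →
      ∃ (hκ : algebraMap K L (h.coeff (φ.natDegree * N)) ∈ M.V) (p : Polynomial k),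
        M.res ⟨c.1.1, c.2.1⟩ = Polynomial.aeval z⁻¹ p ∧ algebraMap k E (p.coeff 0) = M.res ⟨_, hκ⟩ ∧
        hz.topRes c = M.res ⟨_, hκ⟩ := by
    intro c h hd he hc
    have h1 : Polynomial.aeval s h / Polynomial.aeval s φ ^ N = c.1.1 := by
      rw [he, mul_div_cancel_right₀ _ (pow_ne_zero _ hz.φ_ne)]
    obtain ⟨hκ, p, hp1, hp2⟩ := hz.exists_res_quot N h hd (h1 ▸ c.2.1)
    refine ⟨hκ, p, ?_, hp2, ?_⟩
    · rw [← hp1]; congr 2; exact h1.symm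
    · rw [topRes_apply]; congr 2; rw [hc]
  obtain ⟨hκa, pa, ha1, ha2, ha3⟩ := key a ha' hda hea hca
  obtain ⟨hκb, pb, hb1, hb2, hb3⟩ := key b hb' hdb heb hcb
  refine ⟨hb', ha', φ.natDegree * N, hκb, hκa, pb, pa, hdb, hda, ?_, ?_, hb2, ha2, ?_⟩
  · rw [hea, heb, ← hab]; ring
  · rw [← ha1, ← hb1]
    have hu : M.u ∈ M.V := by rw [mem_V, v_u]
    have hru : M.res ⟨M.u, hu⟩ = M.U := by
      rw [res_apply, ι_u, HahnSeries.C_apply, HahnSeries.coeff_single_same]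
    rw [← hru, ← map_mul]
    congr 1
    exact Subtype.ext ((mul_comm _ _).trans hab)
  · rintro ⟨h1, h2⟩
    apply hP
    rw [RingHom.mem_ker, RingHom.mem_ker, ha3, hb3, ← ha2, ← hb2, h1, h2]
    simp

end IsUnif
end Model
end FieldGen

namespace FieldGen

lemma exists_valuation_not_mem {k E : Type} [Field k] [Field E] [Algebra k E] {f : E}
    (hf : Transcendental k f⁻¹) :
    ∃ W : ValuationSubring E, (∀ c : k, algebraMap k E c ∈ W) ∧ f ∉ W := by
  let B : Subring E := (Polynomial.aeval f⁻¹ : Polynomial k →ₐ[k] E).toRingHom.range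
  have hfB : f⁻¹ ∈ B := ⟨Polynomial.X, Polynomial.aeval_X _⟩
  have hne : Ideal.span {(⟨f⁻¹, hfB⟩ : B)} ≠ ⊤ := by
    rw [Ne, Ideal.span_singleton_eq_top]
    intro hu
    obtain ⟨⟨_, p, rfl⟩, hb⟩ := hu.exists_right_inv
    have h1 : Polynomial.aeval f⁻¹ (Polynomial.X * p - 1) = 0 := by
      have := congrArg Subtype.val hb
      change f⁻¹ * Polynomial.aeval f⁻¹ p = 1 at this
      simp [this]
    refine hf ⟨_, fun h2 => ?_, h1⟩
    have := congrArg (Polynomial.eval 0) h2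
    simp at this
  obtain ⟨W, hW, hI⟩ := Ideal.image_subset_nonunits_valuationSubring _ hne
  refine ⟨W, fun c => hW ⟨Polynomial.C c, Polynomial.aeval_C _ _⟩, ?_⟩
  have h1 : f⁻¹ ∈ W.nonunits := hI ⟨_, Ideal.subset_span rfl, rfl⟩
  rw [ValuationSubring.inv_mem_nonunits_iff] at h1
  rcases h1 with rfl | h1
  · exact (hf (by simpa using isAlgebraic_zero)).elim
  · exact h1

lemma mul_lt_one_of_le_one_of_lt_one {Γ : Type*} [LinearOrderedCommGroupWithZero Γ] {a b : Γ}
    (ha : a ≤ 1) (hb : b < 1) : a * b < 1 :=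
  (mul_le_of_le_one_left' ha).trans_lt hb

section
variable {k E : Type} [Field k] [Field E] [Algebra k E] {W : ValuationSubring E}
  (hk : ∀ c : k, algebraMap k E c ∈ W)
include hk

lemma valuation_algebraMap {c : k} (hc : c ≠ 0) : W.valuation (algebraMap k E c) = 1 := by
  refine le_antisymm ((W.valuation_le_one_iff _).2 (hk c)) ?_
  have h1 := (W.valuation_le_one_iff _).2 (hk c⁻¹)
  rw [map_inv₀, map_inv₀] at h1
  have h2 : 0 < W.valuation (algebraMap k E c) := by
    rw [zero_lt_iff, Ne, map_eq_zero, map_eq_zero]; exact hc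
  exact (inv_le_one₀ h2).1 h1

lemma eq_zero_of_valuation {c : k} (hc : W.valuation (algebraMap k E c) < 1) : c = 0 := by
  by_contra h
  exact hc.ne (valuation_algebraMap hk h)

lemma aeval_mem {x : E} (hx : x ∈ W) (p : Polynomial k) : Polynomial.aeval x p ∈ W := by
  rw [Polynomial.aeval_eq_sum_range]
  refine sum_mem fun i _ => ?_
  rw [Algebra.smul_def]
  exact mul_mem (hk _) (pow_mem hx _)

lemma valuation_aeval_sub {w : E} (hw : W.valuation w < 1) (p : Polynomial k) :
    W.valuation (Polynomial.aeval w p - algebraMap k E (p.coeff 0)) < 1 := by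
  conv_lhs => rw [← Polynomial.divX_mul_X_add p]
  have h1 : W.valuation (Polynomial.aeval w p.divX) ≤ 1 :=
    (W.valuation_le_one_iff _).2 (aeval_mem hk ((W.valuation_le_one_iff _).1 hw.le) _)
  have h2 : Polynomial.aeval w (p.divX * Polynomial.X + Polynomial.C (p.coeff 0))
      - algebraMap k E ((p.divX * Polynomial.X + Polynomial.C (p.coeff 0)).coeff 0)
      = Polynomial.aeval w p.divX * w := by simp
  rw [h2, map_mul]
  exact mul_lt_one_of_le_one_of_lt_one h1 hw

/-- If `U p₂(w) = p₁(w)` and `w` vanishes at the place `W`, then `U` takes the value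
`p₁(0) : p₂(0)` at `W`. -/
lemma value_of_relation {w U : E} (hw : W.valuation w < 1) {p₁ p₂ : Polynomial k}
    (h : U * Polynomial.aeval w p₂ = Polynomial.aeval w p₁) :
    (U ∈ W → W.valuation (U * algebraMap k E (p₂.coeff 0) - algebraMap k E (p₁.coeff 0)) < 1) ∧
    (U ∉ W → p₂.coeff 0 = 0) := by
  have h1 := valuation_aeval_sub hk hw p₁
  have h2 := valuation_aeval_sub hk hw p₂
  constructor
  · intro hU
    have h3 : U * algebraMap k E (p₂.coeff 0) - algebraMap k E (p₁.coeff 0)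
        = (Polynomial.aeval w p₁ - algebraMap k E (p₁.coeff 0))
          - U * (Polynomial.aeval w p₂ - algebraMap k E (p₂.coeff 0)) := by
      rw [← h]; ring
    rw [h3]
    refine Valuation.map_sub_lt _ h1 ?_
    rw [map_mul]
    exact mul_lt_one_of_le_one_of_lt_one ((W.valuation_le_one_iff _).2 hU) h2
  · intro hU
    have hU0 : U ≠ 0 := fun h0 => hU (h0 ▸ zero_mem _)
    have h3 : W.valuation U⁻¹ < 1 := by
      rw [map_inv₀]
      have : 1 < W.valuation U := not_le.1 fun hle => hU ((W.valuation_le_one_iff _).1 hle)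
      exact inv_lt_one_of_one_lt₀ this
    refine eq_zero_of_valuation hk ?_
    have h4 : algebraMap k E (p₂.coeff 0) = U⁻¹ * Polynomial.aeval w p₁
        - (Polynomial.aeval w p₂ - algebraMap k E (p₂.coeff 0)) := by
      rw [← h]; field_simp; ring
    rw [h4]
    refine Valuation.map_sub_lt _ ?_ h2
    rw [map_mul, mul_comm]
    exact mul_lt_one_of_le_one_of_lt_one ((W.valuation_le_one_iff _).2
      (aeval_mem hk ((W.valuation_le_one_iff _).1 hw.le) _)) h3

end

namespace Model
variable {k K L E : Type} [Field k] [Field K] [Field L] [Field E] [Algebra k K]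
    [Algebra K L] [Algebra k L] [Algebra k E]

/-- `s` generates `L` over `K`, and `u` takes the value `l : m` at the pole of `s`, in the sense
of leading forms. -/
structure IsPoint (M : Model k K L E) (s : L) (l m : k) : Prop where
  tr : Transcendental K s
  gen : ∀ g : L, ∃ h h' : Polynomial K, Polynomial.aeval s h' ≠ 0 ∧
    g * Polynomial.aeval s h' = Polynomial.aeval s h
  ne : ¬ (l = 0 ∧ m = 0)
  dir : ∀ (h₁ h₂ : Polynomial K) (D : ℕ), h₁.natDegree ≤ D → h₂.natDegree ≤ D →
    M.u * Polynomial.aeval s h₂ = Polynomial.aeval s h₁ →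
    ∀ (hκ₁ : algebraMap K L (h₁.coeff D) ∈ M.V) (hκ₂ : algebraMap K L (h₂.coeff D) ∈ M.V),
      algebraMap k E l * M.res ⟨_, hκ₂⟩ = algebraMap k E m * M.res ⟨_, hκ₁⟩

variable {M : Model k K L E} [IsScalarTower k K L]

lemma IsPoint.exists_relation {s : L} {l m : k} (hs : M.IsPoint s l m) {φ : Polynomial K} {z : E}
    {e₁ : ℕ} (hz : IsUnif M s φ z e₁) : ∃ (p₁ p₂ : Polynomial k),
      M.U * Polynomial.aeval z⁻¹ p₂ = Polynomial.aeval z⁻¹ p₁ ∧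
      l * p₂.coeff 0 = m * p₁.coeff 0 ∧ ¬ (p₁.coeff 0 = 0 ∧ p₂.coeff 0 = 0) := by
  obtain ⟨h₁, h₂, D, hκ₁, hκ₂, p₁, p₂, hd1, hd2, hu, hU, hp1, hp2, hne⟩ := hz.exists_relation hs.gen
  refine ⟨p₁, p₂, hU, ?_, hne⟩
  have h := hs.dir h₁ h₂ D hd1 hd2 hu hκ₁ hκ₂
  rw [← hp1, ← hp2, ← map_mul, ← map_mul] at h
  exact (algebraMap k E).injective h

/-- Two points in different directions have no common non-constant regular function. -/
lemma inter_eq {s₁ s₂ : L} {l₁ m₁ l₂ m₂ : k} (hs₁ : M.IsPoint s₁ l₁ m₁) (hs₂ : M.IsPoint s₂ l₂ m₂)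
    (hne : l₁ * m₂ ≠ l₂ * m₁) {φ₁ φ₂ : Polynomial K} {z₁ z₂ : E} {e₁ e₂ : ℕ}
    (hz₁ : IsUnif M s₁ φ₁ z₁ e₁) (hz₂ : IsUnif M s₂ φ₂ z₂ e₂) {f : E} {Q₁ Q₂ : Polynomial k}
    (h₁ : f = Polynomial.aeval z₁ Q₁) (h₂ : f = Polynomial.aeval z₂ Q₂) : f ∈ M.F0 := by
  by_contra hf
  obtain ⟨W, hk, hW⟩ := exists_valuation_not_mem (k := k) (f := f)
    (M.tr _ fun h => hf (inv_mem_iff.1 h))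
  have key : ∀ {z : E} {Q : Polynomial k}, f = Polynomial.aeval z Q → W.valuation z⁻¹ < 1 := by
    intro z Q h
    have hzW : z ∉ W := fun h1 => hW (h ▸ aeval_mem hk h1 Q)
    rw [map_inv₀]
    have : 1 < W.valuation z := not_le.1 fun hle => hzW ((W.valuation_le_one_iff _).1 hle)
    exact inv_lt_one_of_one_lt₀ this
  obtain ⟨p₁, p₂, hp, hd, h0⟩ := hs₁.exists_relation hz₁
  obtain ⟨q₁, q₂, hq, hd', h0'⟩ := hs₂.exists_relation hz₂
  obtain ⟨hp1, hp2⟩ := value_of_relation hk (key h₁) hp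
  obtain ⟨hq1, hq2⟩ := value_of_relation hk (key h₂) hq
  have hdet : p₁.coeff 0 * q₂.coeff 0 ≠ q₁.coeff 0 * p₂.coeff 0 := by
    intro hdet
    have hn1 := hs₁.ne
    have hn2 := hs₂.ne
    grind
  by_cases hU : M.U ∈ W
  · have h3 := hp1 hU
    have h4 := hq1 hU
    have h5 : algebraMap k E (q₁.coeff 0 * p₂.coeff 0 - p₁.coeff 0 * q₂.coeff 0)
        = algebraMap k E (q₂.coeff 0) *
          (M.U * algebraMap k E (p₂.coeff 0) - algebraMap k E (p₁.coeff 0))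
        - algebraMap k E (p₂.coeff 0) *
          (M.U * algebraMap k E (q₂.coeff 0) - algebraMap k E (q₁.coeff 0)) := by
      simp only [map_sub, map_mul]; ring
    refine hdet (sub_eq_zero.1 (eq_zero_of_valuation hk (W := W) ?_)).symm
    rw [h5]
    refine Valuation.map_sub_lt _ ?_ ?_ <;> rw [map_mul] <;>
    refine mul_lt_one_of_le_one_of_lt_one ((W.valuation_le_one_iff _).2 (hk _)) ?_
    · exact h3
    · exact h4
  · exact hdet (by rw [hp2 hU, hq2 hU, mul_zero, mul_zero])

end Model
end FieldGen

namespace FieldGen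
namespace Model
variable {k K L E : Type} [Field k] [Field K] [Field L] [Field E] [Algebra k K]
    [Algebra K L] [Algebra k L] [Algebra k E] {M : Model k K L E}

lemma IsPoint.exists_isUnif {s : L} {l m : k} (hs : M.IsPoint s l m) :
    ∃ φ z e₁, IsUnif M s φ z e₁ := by
  obtain ⟨φ, hφ⟩ := M.exists_isMin hs.tr hs.gen
  obtain ⟨z, e₁, hz⟩ := hφ.exists_isUnif
  exact ⟨φ, z, e₁, hz⟩

/-- If three points lie in pairwise different directions, all values are divisible by `e`. -/
theorem dvd_of_three_points [IsScalarTower k K L] {s : L} {l₁ m₁ l₂ m₂ l₃ m₃ : k} (h₁ : M.IsPoint s l₁ m₁)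
    (h₂ : M.IsPoint s⁻¹ l₂ m₂) (h₃ : M.IsPoint (s - 1)⁻¹ l₃ m₃) (h12 : l₁ * m₂ ≠ l₂ * m₁)
    (h13 : l₁ * m₃ ≠ l₃ * m₁) (h23 : l₂ * m₃ ≠ l₃ * m₂) (g : L) (hg : g ≠ 0) :
    (M.e : ℤ) ∣ M.v g := by
  obtain ⟨φ₁, z₁, e₁, hz₁⟩ := h₁.exists_isUnif
  obtain ⟨φ₂, z₂, e₂, hz₂⟩ := h₂.exists_isUnif
  obtain ⟨φ₃, z₃, e₃, hz₃⟩ := h₃.exists_isUnif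
  have hs0 : s ≠ 0 := by
    rintro rfl
    exact h₁.tr isAlgebraic_zero
  have hs1 : s - 1 ≠ 0 := by
    intro h
    refine h₁.tr ?_
    rw [sub_eq_zero.1 h]
    exact isAlgebraic_one
  have hm1 : M.Ψ (-1) ∈ M.F0 := by
    have := M.Ψ_K (-1)
    rwa [map_neg, map_one] at this
  by_cases hΨ : M.Ψ s ∈ M.F0
  · exfalso
    refine hz₁.not_mem ?_
    obtain ⟨Q₁, hQ₁⟩ := hz₁.Ψ_poly_mem φ₁
    obtain ⟨Q₂, hQ₂⟩ := hz₂.Ψ_poly_mem φ₁.reverse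
    obtain ⟨c, hc⟩ := pow_mem hΨ φ₁.natDegree
    refine inter_eq h₁ h₂ h12 hz₁ hz₂ hQ₁ (Q₂ := Polynomial.C c * Q₂) ?_
    rw [map_mul, ← hQ₂, Polynomial.aeval_C, hc, ← map_pow, ← map_mul]
    congr 1
    let _ : Invertible s := invertibleOfNonzero hs0
    have h4 := Polynomial.eval₂_reverse_mul_pow (algebraMap K L) s φ₁
    rw [invOf_eq_inv] at h4
    rw [Polynomial.aeval_def, ← h4, mul_comm]
    rfl
  rcases lt_trichotomy (M.v s) 0 with hv | hv | hv
  · exfalso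
    obtain ⟨Q₂, hQ₂⟩ := hz₂.Ψ_poly_mem Polynomial.X
    obtain ⟨Q₃, hQ₃⟩ := hz₃.Ψ_poly_mem Polynomial.X
    rw [Polynomial.aeval_X, map_inv₀] at hQ₂ hQ₃
    have h4 := M.v_add_of_lt hs0 (neg_ne_zero.2 one_ne_zero) (by
      have : M.v (-1) = 0 := by simp [v]
      rwa [this])
    rw [← sub_eq_add_neg] at h4
    rw [M.Ψ_apply, h4.1, h4.2, ← M.Ψ_apply] at hQ₃
    exact hΨ (inv_mem_iff.1 (inter_eq h₂ h₃ h23 hz₂ hz₃ hQ₂ hQ₃))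
  · obtain ⟨z, e, hz⟩ := (M.isMin_X h₁.tr hΨ).exists_isUnif
    obtain ⟨h, h', h0, h4⟩ := h₁.gen g
    have h'0 : h' ≠ 0 := by rintro rfl; simp at h0
    have hh0 : h ≠ 0 := by
      rintro rfl
      rw [map_zero] at h4
      exact (mul_ne_zero hg h0) h4
    have h5 := M.v_mul hg h0
    rw [h4] at h5
    rw [show M.v g = M.v (Polynomial.aeval s h) - M.v (Polynomial.aeval s h') by omega]
    exact dvd_sub (dvd_v_of_isUnif_X hz hv h hh0) (dvd_v_of_isUnif_X hz hv h' h'0)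
  · exfalso
    obtain ⟨Q₁, hQ₁⟩ := hz₁.Ψ_poly_mem Polynomial.X
    obtain ⟨Q₃, hQ₃⟩ := hz₃.Ψ_poly_mem (Polynomial.X + 1)
    obtain ⟨c, hc⟩ := hm1
    rw [Polynomial.aeval_X] at hQ₁
    have h4 := M.v_add_of_lt (neg_ne_zero.2 one_ne_zero) hs0 (by
      have : M.v (-1) = 0 := by simp [v]
      rwa [this])
    rw [show -1 + s = s - 1 by ring] at h4
    have h5 : M.Ψ (s - 1) = M.Ψ (-1) := by
      rw [M.Ψ_apply, h4.1, h4.2, ← M.Ψ_apply]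
    have h6 : Polynomial.aeval (s - 1)⁻¹ (Polynomial.X + 1 : Polynomial K) = (s - 1)⁻¹ * s := by
      rw [map_add, Polynomial.aeval_X, map_one]
      field_simp
      ring
    have h7 : M.Ψ (-1) ≠ 0 := (map_ne_zero _).2 (neg_ne_zero.2 one_ne_zero)
    refine hΨ (inter_eq h₁ h₃ h13 hz₁ hz₃ hQ₁ (Q₂ := Polynomial.C c * Q₃) ?_)
    rw [map_mul, ← hQ₃, Polynomial.aeval_C, hc, h6, map_mul, map_inv₀, h5]
    field_simp

end Model
end FieldGen

namespace FieldGen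

section
variable {R : Type} [Field R]

lemma leadingCoeff_pow (y : HahnSeries ℤ R) (n : ℕ) :
    (y ^ n).leadingCoeff = y.leadingCoeff ^ n := by
  induction n with
  | zero => simp
  | succ n ih => rw [pow_succ, HahnSeries.leadingCoeff_mul, ih, pow_succ]

/-- The order of a polynomial in an element of negative order. -/
lemma order_eval₂_of_neg {y : HahnSeries ℤ R} (hy : y.order < 0) (P : Polynomial R) (hP : P ≠ 0) :
    Polynomial.eval₂ HahnSeries.C y P ≠ 0 ∧
    (Polynomial.eval₂ HahnSeries.C y P).order = P.natDegree * y.order ∧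
    (Polynomial.eval₂ HahnSeries.C y P).leadingCoeff
      = P.leadingCoeff * y.leadingCoeff ^ P.natDegree := by
  have hy0 : y ≠ 0 := by rintro rfl; simp at hy
  induction hn : P.natDegree using Nat.strong_induction_on generalizing P with
  | _ n ih =>
  subst hn
  have hlead : P.leadingCoeff ≠ 0 := Polynomial.leadingCoeff_ne_zero.2 hP
  have hC : (HahnSeries.C P.leadingCoeff : HahnSeries ℤ R) ≠ 0 := (map_ne_zero _).2 hlead
  have h1 : (HahnSeries.C P.leadingCoeff : HahnSeries ℤ R) * y ^ P.natDegree ≠ 0 :=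
    mul_ne_zero hC (pow_ne_zero _ hy0)
  have h2 : ((HahnSeries.C P.leadingCoeff : HahnSeries ℤ R) * y ^ P.natDegree).order
      = P.natDegree * y.order := by
    rw [HahnSeries.order_mul hC (pow_ne_zero _ hy0), HahnSeries.order_C, HahnSeries.order_pow,
      zero_add, nsmul_eq_mul]
  have h3 : ((HahnSeries.C P.leadingCoeff : HahnSeries ℤ R) * y ^ P.natDegree).leadingCoeff
      = P.leadingCoeff * y.leadingCoeff ^ P.natDegree := by
    rw [HahnSeries.leadingCoeff_mul, leadingCoeff_pow, HahnSeries.C_apply,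
      HahnSeries.leadingCoeff_of_single]
  have h4 : Polynomial.eval₂ HahnSeries.C y P = HahnSeries.C P.leadingCoeff * y ^ P.natDegree
      + Polynomial.eval₂ HahnSeries.C y P.eraseLead := by
    conv_lhs => rw [← Polynomial.eraseLead_add_monomial_natDegree_leadingCoeff P]
    rw [Polynomial.eval₂_add, Polynomial.eval₂_monomial, add_comm]
  rw [h4]
  by_cases he : P.eraseLead = 0
  · rw [he, Polynomial.eval₂_zero, add_zero]
    exact ⟨h1, h2, h3⟩
  have hd : P.eraseLead.natDegree < P.natDegree := by
    rcases P.eraseLead_natDegree_lt_or_eraseLead_eq_zero with h | h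
    exacts [h, absurd h he]
  obtain ⟨e1, e2, e3⟩ := ih _ hd _ he rfl
  have h5 := order_add_of_lt h1 e1 (by
    rw [h2, e2]
    exact mul_lt_mul_of_neg_right (by exact_mod_cast hd) hy)
  rw [h5.1, h5.2]
  refine ⟨fun h0 => ?_, h2, h3⟩
  rw [h0] at h5
  simp only [HahnSeries.leadingCoeff_zero] at h5
  exact HahnSeries.leadingCoeff_ne_zero.2 h1 h5.2.symm

end

section
variable {k E : Type} [Field k] [Field E] (D : E →+* HahnSeries ℤ k)

/-- The valuation ring attached to an embedding into Laurent series. -/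
def ofEmbedding : ValuationSubring E where
  carrier := {x | 0 ≤ (D x).orderTop}
  mul_mem' hx hy := by
    simp only [Set.mem_ofPred_eq, map_mul] at *
    exact orderTop_mul_nonneg hx hy
  one_mem' := by simp
  add_mem' hx hy := by
    simp only [Set.mem_ofPred_eq, map_add] at *
    exact orderTop_add_nonneg hx hy
  zero_mem' := by simp
  neg_mem' hx := by simpa using hx
  mem_or_inv_mem' x := by
    simp only [Set.mem_ofPred_eq]
    by_cases hx : x = 0
    · simp [hx]
    have h1 := HahnSeries.order_mul ((map_ne_zero D).2 hx) ((map_ne_zero D).2 (inv_ne_zero hx))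
    rw [← map_mul, mul_inv_cancel₀ hx, map_one, HahnSeries.order_one] at h1
    rw [HahnSeries.zero_le_orderTop_iff, HahnSeries.zero_le_orderTop_iff]
    omega

lemma mem_ofEmbedding {x : E} : x ∈ ofEmbedding D ↔ 0 ≤ (D x).order :=
  HahnSeries.zero_le_orderTop_iff

lemma order_inv' (x : E) : (D x⁻¹).order = -(D x).order := by
  by_cases hx : x = 0
  · simp [hx]
  have h1 := HahnSeries.order_mul ((map_ne_zero D).2 hx) ((map_ne_zero D).2 (inv_ne_zero hx))
  rw [← map_mul, mul_inv_cancel₀ hx, map_one, HahnSeries.order_one] at h1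
  omega

lemma valuation_ofEmbedding_lt_one {x : E} (hx : 0 < (D x).order) :
    (ofEmbedding D).valuation x < 1 := by
  rw [← ValuationSubring.mem_nonunits_iff, ValuationSubring.mem_nonunits_iff_or]
  right
  rw [mem_ofEmbedding, order_inv']
  omega

variable [Algebra k E] (hD : ∀ c : k, D (algebraMap k E c) = HahnSeries.C c)
include hD

lemma algebraMap_mem_ofEmbedding (c : k) : algebraMap k E c ∈ ofEmbedding D := by
  rw [mem_ofEmbedding, hD, HahnSeries.order_C]

lemma map_aeval_embedding (x : E) (P : Polynomial k) :
    D (Polynomial.aeval x P) = Polynomial.eval₂ HahnSeries.C (D x) P := by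
  rw [Polynomial.aeval_def, Polynomial.hom_eval₂]
  congr 1
  exact RingHom.ext hD

end

namespace Model
variable {k K L E : Type} [Field k] [Field K] [Field L] [Field E] [Algebra k K]
    [Algebra K L] [Algebra k L] [Algebra k E] {M : Model k K L E}

section
variable {s : L} {φ : Polynomial K} {z : E} {e₁ : ℕ} (hz : IsUnif M s φ z e₁)
  (gen : ∀ l : L, ∃ h h' : Polynomial K, Polynomial.aeval s h' ≠ 0 ∧
      l * Polynomial.aeval s h' = Polynomial.aeval s h)
  {D : E →+* HahnSeries ℤ k} (hD : ∀ c : k, D (algebraMap k E c) = HahnSeries.C c)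
include hz gen hD

lemma IsUnif.dvd_order (h0 : (D z).order = 0) (g : L) (hg : g ≠ 0) :
    (M.e : ℤ) ∣ (D (M.Ψ g)).order := by
  have key : ∀ h : Polynomial K, h ≠ 0 →
      (M.e : ℤ) ∣ (D (M.Ψ (Polynomial.aeval s h))).order := by
    intro h hh
    obtain ⟨m, c, P, hc, hP, h1⟩ := hz.Ψ_poly h hh
    have hP0 : P ≠ 0 := by rintro rfl; simp at hP
    rw [h1, map_mul, map_mul, map_pow, map_pow, hD, HahnSeries.order_mul, HahnSeries.order_mul,
      HahnSeries.order_C, HahnSeries.order_pow, HahnSeries.order_pow, h0]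
    · simp
    · exact (map_ne_zero _).2 hc
    · exact pow_ne_zero _ ((map_ne_zero _).2 hz.z_ne)
    · exact mul_ne_zero ((map_ne_zero _).2 hc) (pow_ne_zero _ ((map_ne_zero _).2 hz.z_ne))
    · exact pow_ne_zero _ ((map_ne_zero _).2 (hz.aeval_ne hP0))
  obtain ⟨h, h', h'0, hgh⟩ := gen g
  have hh' : h' ≠ 0 := by rintro rfl; simp at h'0
  have hh : h ≠ 0 := by
    rintro rfl
    rw [map_zero] at hgh
    exact mul_ne_zero hg h'0 hgh
  have h5 : g = Polynomial.aeval s h * (Polynomial.aeval s h')⁻¹ := by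
    rw [← hgh, mul_inv_cancel_right₀ h'0]
  rw [h5, map_mul, map_inv₀, map_mul, HahnSeries.order_mul, order_inv']
  · exact dvd_add (key h hh) (dvd_neg.2 (key h' hh'))
  · exact (map_ne_zero _).2 ((map_ne_zero _).2 (hz.ev_ne hh))
  · exact (map_ne_zero _).2 (inv_ne_zero ((map_ne_zero _).2 h'0))

end

variable [IsScalarTower k K L]

/-- For a point in a direction different from `0` and `∞`, the orders at one of the two places
`0`, `∞` of all `Ψ`-values are divisible by `e`. -/
theorem IsPoint.dvd_order {s : L} {l m : k} (hs : M.IsPoint s l m) (hl : l ≠ 0) (hm : m ≠ 0)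
    {D D' : E →+* HahnSeries ℤ k} (hD : ∀ c : k, D (algebraMap k E c) = HahnSeries.C c)
    (hD' : ∀ c : k, D' (algebraMap k E c) = HahnSeries.C c) (hU : (D M.U).order = 1)
    (hU' : (D' M.U).order = -1) :
    (∀ g : L, g ≠ 0 → (M.e : ℤ) ∣ (D (M.Ψ g)).order) ∨
    (∀ g : L, g ≠ 0 → (M.e : ℤ) ∣ (D' (M.Ψ g)).order) := by
  obtain ⟨φ, z, e₁, hz⟩ := hs.exists_isUnif
  obtain ⟨p₁, p₂, hp, hlm, hne⟩ := hs.exists_relation hz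
  have hp1 : p₁.coeff 0 ≠ 0 := by
    intro h0
    rw [h0, mul_zero, mul_eq_zero] at hlm
    exact hne ⟨h0, hlm.resolve_left hl⟩
  have hp2 : p₂.coeff 0 ≠ 0 := by
    intro h0
    rw [h0, mul_zero, eq_comm, mul_eq_zero] at hlm
    exact hp1 (hlm.resolve_left hm)
  have h1 : 0 ≤ (D z).order := by
    by_contra hlt
    push Not at hlt
    obtain ⟨h2, -⟩ := value_of_relation (algebraMap_mem_ofEmbedding D hD)
      (valuation_ofEmbedding_lt_one D (x := z⁻¹) (by rw [order_inv']; omega)) hp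
    have h3 := h2 ((mem_ofEmbedding D).2 (by omega))
    refine hp1 (eq_zero_of_valuation (algebraMap_mem_ofEmbedding D hD) ?_)
    have h4 : algebraMap k E (p₁.coeff 0) = M.U * algebraMap k E (p₂.coeff 0)
      - (M.U * algebraMap k E (p₂.coeff 0) - algebraMap k E (p₁.coeff 0)) := by ring
    rw [h4]
    refine Valuation.map_sub_lt _ ?_ h3
    rw [map_mul, mul_comm]
    exact mul_lt_one_of_le_one_of_lt_one ((ValuationSubring.valuation_le_one_iff _ _).2
      (algebraMap_mem_ofEmbedding D hD _)) (valuation_ofEmbedding_lt_one D (by omega))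
  have h1' : 0 ≤ (D' z).order := by
    by_contra hlt
    push Not at hlt
    obtain ⟨-, h2⟩ := value_of_relation (algebraMap_mem_ofEmbedding D' hD')
      (valuation_ofEmbedding_lt_one D' (x := z⁻¹) (by rw [order_inv']; omega)) hp
    exact hp2 (h2 (by rw [mem_ofEmbedding]; omega))
  rcases h1.eq_or_lt' with h0 | hpos
  · exact Or.inl (hz.dvd_order hs.gen hD h0)
  rcases h1'.eq_or_lt' with h0 | hpos'
  · exact Or.inr (hz.dvd_order hs.gen hD' h0)
  exfalso
  have hp10 : p₁ ≠ 0 := by rintro rfl; simp at hp1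
  have hp20 : p₂ ≠ 0 := by rintro rfl; simp at hp2
  have key : ∀ {D : E →+* HahnSeries ℤ k} (_ : ∀ c : k, D (algebraMap k E c) = HahnSeries.C c),
      0 < (D z).order →
      (D M.U).order = ((p₂.natDegree : ℤ) - p₁.natDegree) * (D z).order := by
    intro D hD hpos
    have hneg : (D z⁻¹).order < 0 := by rw [order_inv']; omega
    have e1 := order_eval₂_of_neg hneg p₁ hp10
    have e2 := order_eval₂_of_neg hneg p₂ hp20
    have hU0 : M.U ≠ 0 := fun h => M.U_not_mem (h ▸ zero_mem _)
    have h3 := congrArg D hp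
    rw [map_mul, map_aeval_embedding D hD, map_aeval_embedding D hD] at h3
    have h4 := congrArg HahnSeries.order h3
    rw [HahnSeries.order_mul ((map_ne_zero _).2 hU0) e2.1, e1.2.1, e2.2.1, order_inv'] at h4
    linear_combination h4
  have k1 := key hD hpos
  have k2 := key hD' hpos'
  rw [hU] at k1
  rw [hU'] at k2
  rcases lt_or_ge (0 : ℤ) ((p₂.natDegree : ℤ) - p₁.natDegree) with h | h <;> nlinarith

end Model
end FieldGen

namespace FieldGen
variable {k : Type} [Field k]

/-- The substitution `x ↦ U^p T^a`, `y ↦ U^q T^b`. -/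
noncomputable def wt (a b p q : ℕ) :
    MvPolynomial (Fin 2) k →ₐ[k] Polynomial (Polynomial k) :=
  aeval ![Polynomial.monomial a (Polynomial.monomial p 1),
    Polynomial.monomial b (Polynomial.monomial q 1)]

lemma wt_monomial (a b p q : ℕ) (m : Fin 2 →₀ ℕ) (c : k) :
    wt a b p q (monomial m c)
      = Polynomial.monomial (a * m 0 + b * m 1) (Polynomial.monomial (p * m 0 + q * m 1) c) := by
  rw [wt, aeval_monomial, Finsupp.prod_fintype _ _ (by simp)]
  simp only [Fin.prod_univ_two, Matrix.cons_val_zero, Matrix.cons_val_one, Polynomial.monomial_pow,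
    Polynomial.monomial_mul_monomial, one_pow, mul_one]
  rw [IsScalarTower.algebraMap_apply k (Polynomial k) (Polynomial (Polynomial k))]
  simp [Polynomial.C_mul_monomial]

lemma coeff_wt {a b p q : ℕ} (h : a * q = b * p + 1) (H : MvPolynomial (Fin 2) k)
    (m : Fin 2 →₀ ℕ) :
    ((wt a b p q H).coeff (a * m 0 + b * m 1)).coeff (p * m 0 + q * m 1) = H.coeff m := by
  induction H using MvPolynomial.induction_on' with
  | monomial n c =>
    rw [wt_monomial, Polynomial.coeff_monomial, coeff_monomial]
    by_cases hn : n = m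
    · subst hn; simp
    · rw [if_neg hn]
      split_ifs with h1
      · rw [Polynomial.coeff_monomial, if_neg]
        intro h2
        apply hn
        have h1' : (a : ℤ) * n 0 + b * n 1 = a * m 0 + b * m 1 := by exact_mod_cast h1
        have h2' : (p : ℤ) * n 0 + q * n 1 = p * m 0 + q * m 1 := by exact_mod_cast h2
        have h' : (a : ℤ) * q = b * p + 1 := by exact_mod_cast h
        have e0 : (n 0 : ℤ) = m 0 := by
          linear_combination (-(n 0 : ℤ) + m 0) * h' + q * h1' - b * h2'
        have e1 : (n 1 : ℤ) = m 1 := by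
          linear_combination (-(n 1 : ℤ) + m 1) * h' - p * h1' + a * h2'
        ext i
        fin_cases i
        · exact_mod_cast e0
        · exact_mod_cast e1
      · simp
  | add P Q hP hQ => rw [map_add, Polynomial.coeff_add, Polynomial.coeff_add, hP, hQ, coeff_add]

lemma wt_injective {a b p q : ℕ} (h : a * q = b * p + 1) :
    Function.Injective (wt (k := k) a b p q) := by
  rw [injective_iff_map_eq_zero]
  intro H hH
  ext m
  rw [← coeff_wt h, hH]
  simp

lemma exists_monomial_of_coeff_wt {a b p q : ℕ} (H : MvPolynomial (Fin 2) k) (n r : ℕ)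
    (hne : ((wt a b p q H).coeff n).coeff r ≠ 0) :
    ∃ m : Fin 2 →₀ ℕ, a * m 0 + b * m 1 = n ∧ p * m 0 + q * m 1 = r := by
  induction H using MvPolynomial.induction_on' with
  | monomial m c =>
    rw [wt_monomial, Polynomial.coeff_monomial] at hne
    split_ifs at hne with h1
    · rw [Polynomial.coeff_monomial] at hne
      split_ifs at hne with h2
      · exact ⟨m, h1, h2⟩
      · exact absurd rfl hne
    · simp at hne
  | add P Q hP hQ =>
    by_cases h : ((wt a b p q P).coeff n).coeff r = 0
    · exact hQ fun h' => hne (by rw [map_add, Polynomial.coeff_add, Polynomial.coeff_add, h, h',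
        add_zero])
    · exact hP h

lemma le_natDegree_wt {a b p q : ℕ} (h : a * q = b * p + 1) {H : MvPolynomial (Fin 2) k}
    {m : Fin 2 →₀ ℕ} (hm : m ∈ H.support) :
    a * m 0 + b * m 1 ≤ (wt a b p q H).natDegree := by
  refine Polynomial.le_natDegree_of_ne_zero fun h0 => ?_
  rw [mem_support_iff, ← coeff_wt h, h0] at hm
  simp at hm

/-- Evaluation of a polynomial in `T` over `k[U]` at Laurent series, `T` having a simple pole. -/
noncomputable def toHahn : Polynomial (Polynomial k) →+* HahnSeries ℤ (RatFunc k) :=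
  (Polynomial.eval₂RingHom HahnSeries.C (HahnSeries.single (-1) 1)).comp
    (Polynomial.mapRingHom (algebraMap (Polynomial k) (RatFunc k)))

lemma toHahn_order (Q : Polynomial (Polynomial k)) (hQ : Q ≠ 0) :
    toHahn Q ≠ 0 ∧ (toHahn Q).order = -(Q.natDegree : ℤ) ∧
      (toHahn Q).leadingCoeff = algebraMap (Polynomial k) (RatFunc k) Q.leadingCoeff := by
  have hinj := IsFractionRing.injective (Polynomial k) (RatFunc k)
  have h := order_eval₂_of_neg (R := RatFunc k) (y := HahnSeries.single (-1) 1)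
    (by rw [HahnSeries.order_single one_ne_zero]; norm_num)
    (Q.map (algebraMap (Polynomial k) (RatFunc k))) ((Polynomial.map_ne_zero_iff hinj).2 hQ)
  rw [Polynomial.natDegree_map_eq_of_injective hinj, HahnSeries.order_single one_ne_zero,
    HahnSeries.leadingCoeff_of_single, one_pow, mul_one, Polynomial.leadingCoeff_map_of_injective hinj] at h
  exact ⟨h.1, by rw [← mul_neg_one]; exact h.2.1, h.2.2⟩

end FieldGen

namespace FieldGen

/-- A presentation of `L` as the fraction field of a polynomial ring in two variables over `k`,
with a polynomial `F` that generates `k(F) = RatFunc k` inside `L`. -/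
structure Coord (k L : Type) [Field k] [Field L] [Algebra k L] [Algebra (RatFunc k) L] where
  j : MvPolynomial (Fin 2) k →ₐ[k] L
  inj : Function.Injective j
  surj : ∀ l : L, ∃ H₁ H₂, j H₂ ≠ 0 ∧ l * j H₂ = j H₁
  F : MvPolynomial (Fin 2) k
  X_eq : algebraMap (RatFunc k) L RatFunc.X = j F

namespace Coord

variable {k L : Type} [Field k] [Field L] [Algebra k L] [Algebra (RatFunc k) L] (S : Coord k L)

lemma j_ne {H : MvPolynomial (Fin 2) k} (hH : H ≠ 0) : S.j H ≠ 0 :=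
  (map_ne_zero_iff _ S.inj).2 hH

lemma exists_extension {R : Type} [Field R] (f : MvPolynomial (Fin 2) k →+* R)
    (hf : Function.Injective f) : ∃ ι : L →+* R, ∀ H, ι (S.j H) = f H := by
  let _ := S.j.toRingHom.toAlgebra
  have : FaithfulSMul (MvPolynomial (Fin 2) k) L :=
    (faithfulSMul_iff_algebraMap_injective _ _).2 S.inj
  have : IsFractionRing (MvPolynomial (Fin 2) k) L := by
    refine IsFractionRing.of_field _ _ fun l => ?_
    obtain ⟨H₁, H₂, h, h'⟩ := S.surj l
    exact ⟨H₁, H₂, ((div_eq_iff h).2 h'.symm).symm⟩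
  exact ⟨IsFractionRing.lift hf, fun H => IsFractionRing.lift_algebraMap hf H⟩

end Coord

lemma eval₂_mem {R L : Type} [CommRing R] [Field L] (W : ValuationSubring L) (f : R →+* L)
    (hf : ∀ r, f r ∈ W) {z : L} (hz : z ∈ W) (Q : Polynomial R) : Polynomial.eval₂ f z Q ∈ W := by
  rw [Polynomial.eval₂_eq_sum_range]
  exact sum_mem fun i _ => mul_mem (hf _) (pow_mem hz _)

/-- A polynomial of degree `D` whose leading coefficient is a unit of `W` has the value of `z⁻¹ ^ D`
at `z⁻¹` when `z` is in the maximal ideal of `W`. -/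
lemma valuation_eval₂_inv {R L : Type} [CommRing R] [Field L] (W : ValuationSubring L)
    (f : R →+* L) (hf : ∀ r, f r ∈ W) {z : L} (hz0 : z ≠ 0) (hz : W.valuation z < 1)
    (Q : Polynomial R) (hQ : (f Q.leadingCoeff)⁻¹ ∈ W) (hQ0 : f Q.leadingCoeff ≠ 0) :
    W.valuation (Polynomial.eval₂ f z⁻¹ Q) = W.valuation z⁻¹ ^ Q.natDegree := by
  let _ : Invertible z⁻¹ := invertibleOfNonzero (inv_ne_zero hz0)
  have h := Polynomial.eval₂_reverse_mul_pow f z⁻¹ Q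
  rw [invOf_eq_inv, inv_inv] at h
  have hzW : z ∈ W := (W.valuation_le_one_iff _).1 hz.le
  have h1 : W.valuation (f Q.leadingCoeff) = 1 := by
    refine le_antisymm ((W.valuation_le_one_iff _).2 (hf _)) ?_
    have h2 := (W.valuation_le_one_iff _).2 hQ
    rw [map_inv₀] at h2
    exact (inv_le_one₀ (by rw [zero_lt_iff, Ne, map_eq_zero]; exact hQ0)).1 h2
  rw [← h, map_mul, map_pow]
  conv_lhs => rw [← Polynomial.divX_mul_X_add Q.reverse]
  rw [Polynomial.eval₂_add, Polynomial.eval₂_mul, Polynomial.eval₂_X, Polynomial.eval₂_C,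
    Polynomial.coeff_zero_reverse, Valuation.map_add_eq_of_lt_right, h1, one_mul]
  rw [h1, map_mul]
  exact mul_lt_one_of_le_one_of_lt_one
    ((W.valuation_le_one_iff _).2 (eval₂_mem W f hf hzW _)) hz

namespace Coord

variable {k L : Type} [Field k] [Field L] [Algebra k L] [Algebra (RatFunc k) L]
  [IsScalarTower k (RatFunc k) L] (S : Coord k L)

lemma algebraMap_algebraMap (P : Polynomial k) :
    algebraMap (RatFunc k) L (algebraMap (Polynomial k) (RatFunc k) P)
      = S.j (Polynomial.aeval S.F P) := by
  have h : ((algebraMap (RatFunc k) L).comp (algebraMap (Polynomial k) (RatFunc k)))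
      = S.j.toRingHom.comp (Polynomial.aeval S.F).toRingHom := by
    refine Polynomial.ringHom_ext (fun c => ?_) ?_
    · simp only [RingHom.comp_apply, AlgHom.toRingHom_eq_coe, RingHom.coe_coe,
        RatFunc.algebraMap_C, Polynomial.aeval_C, AlgHom.commutes, ← RatFunc.algebraMap_eq_C]
      exact (IsScalarTower.algebraMap_apply _ _ _ _).symm
    · simp [S.X_eq]
  exact congrArg (fun f => f P) h

/-- The weighted degree valuation attached to a pair of complementary weights. -/
theorem exists_model {a b p q : ℕ} (h : a * q = b * p + 1)
    (he : 0 < (wt a b p q S.F).natDegree) :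
    ∃ M : Model k (RatFunc k) L (RatFunc k),
      (∀ H, M.ι (S.j H) = toHahn (wt a b p q H)) ∧ M.t = RatFunc.X ∧
      M.e = (wt a b p q S.F).natDegree ∧
      M.u = S.j (X 1) ^ a / S.j (X 0) ^ b ∧ M.U = RatFunc.X := by
  have hwt := wt_injective (k := k) h
  obtain ⟨ι, hι⟩ := S.exists_extension (toHahn.comp (wt a b p q).toRingHom)
    ((injective_iff_map_eq_zero _).2 fun H hH => by
      by_contra h0
      exact (toHahn_order _ ((map_ne_zero_iff _ hwt).2 h0)).1 hH)
  replace hι : ∀ H, ι (S.j H) = toHahn (wt a b p q H) := hι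
  have hord : ∀ H, H ≠ 0 → (ι (S.j H)).order = -((wt a b p q H).natDegree : ℤ) := fun H hH => by
    rw [hι]; exact (toHahn_order _ ((map_ne_zero_iff _ hwt).2 hH)).2.1
  have hF : S.F ≠ 0 := by rintro h0; simp [h0] at he
  have hk : ∀ c : k, ι (algebraMap k L c) = HahnSeries.C (algebraMap k (RatFunc k) c) := by
    intro c
    have : algebraMap k L c = S.j (C c) := (S.j.commutes c).symm
    rw [this, hι, ← algebraMap_eq, AlgHom.commutes]
    simp [toHahn, IsScalarTower.algebraMap_apply k (Polynomial k) (Polynomial (Polynomial k)),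
      RatFunc.algebraMap_eq_C]
  have hx := S.j_ne (X_ne_zero (R := k) (0 : Fin 2))
  have hy := S.j_ne (X_ne_zero (R := k) (1 : Fin 2))
  have hT : ∀ (H : MvPolynomial (Fin 2) k) (n r : ℕ), wt a b p q H
      = Polynomial.monomial n (Polynomial.monomial r 1) → ι (S.j H)
      = HahnSeries.C (RatFunc.X ^ r) * HahnSeries.single (-1) 1 ^ n := by
    intro H n r hH
    rw [hι, hH]
    have h1 : algebraMap (Polynomial k) (RatFunc k) (Polynomial.monomial r 1) = RatFunc.X ^ r := by
      rw [← Polynomial.X_pow_eq_monomial, map_pow, RatFunc.algebraMap_X]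
    simp only [toHahn, RingHom.comp_apply, Polynomial.coe_mapRingHom, Polynomial.map_monomial,
      Polynomial.coe_eval₂RingHom, Polynomial.eval₂_monomial, h1]
  have hιx : ι (S.j (X 0)) = HahnSeries.C (RatFunc.X ^ p) * HahnSeries.single (-1) 1 ^ a :=
    hT _ _ _ (by simp [wt])
  have hιy : ι (S.j (X 1)) = HahnSeries.C (RatFunc.X ^ q) * HahnSeries.single (-1) 1 ^ b :=
    hT _ _ _ (by simp [wt])
  have hu : ι (S.j (X 1) ^ a / S.j (X 0) ^ b) = HahnSeries.C RatFunc.X := by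
    have h0 : ι (S.j (X 0) ^ b) ≠ 0 := (map_ne_zero _).2 (pow_ne_zero _ hx)
    rw [map_div₀, div_eq_iff h0, map_pow, map_pow, hιx, hιy, map_pow HahnSeries.C,
      map_pow HahnSeries.C, mul_pow, mul_pow, ← pow_mul, ← pow_mul, ← pow_mul, ← pow_mul,
      ← mul_assoc, mul_comm q a, h, mul_comm p b, pow_succ', mul_comm b a]
  have hpoly : ∀ P : Polynomial k, ι (algebraMap (RatFunc k) L (algebraMap _ _ P))
      = Polynomial.eval₂ HahnSeries.C (ι (S.j S.F)) (P.map (algebraMap k (RatFunc k))) := by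
    intro P
    rw [S.algebraMap_algebraMap, ← Polynomial.aeval_algHom_apply, Polynomial.aeval_def,
      Polynomial.hom_eval₂, Polynomial.eval₂_map]
    congr 1
    ext1 c
    exact hk c
  have htr : ∀ z : RatFunc k, z ∉ (algebraMap k (RatFunc k)).fieldRange → Transcendental k z := by
    intro z hz
    refine RatFunc.transcendental_of_ne_C z ?_
    rintro ⟨c, hc⟩
    exact hz ⟨c, by rw [hc, RatFunc.algebraMap_eq_C]⟩
  refine ⟨{ ι := ι, ι_k := hk, t := RatFunc.X, e := _, e_pos := he,
            order_t := by rw [S.X_eq, hord _ hF]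
            order_K := ?_
            u := S.j (X 1) ^ a / S.j (X 0) ^ b, U := RatFunc.X
            ι_u := hu
            U_tr := RatFunc.transcendental_X
            tr := htr
            dom := ?_ }, hι, rfl, rfl, rfl, rfl⟩
  · intro c hc
    have hneg : (ι (S.j S.F)).order < 0 := by rw [hord _ hF]; simpa using he
    have key : ∀ P : Polynomial k, P ≠ 0 →
        (ι (algebraMap (RatFunc k) L (algebraMap _ _ P))) ≠ 0 ∧
        (ι (algebraMap (RatFunc k) L (algebraMap _ _ P))).order
          = -((wt a b p q S.F).natDegree * P.natDegree : ℤ) ∧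
        (ι (algebraMap (RatFunc k) L (algebraMap _ _ P))).leadingCoeff
          = algebraMap k (RatFunc k) P.leadingCoeff * (ι (S.j S.F)).leadingCoeff ^ P.natDegree := by
      intro P hP
      have hinj := (algebraMap k (RatFunc k)).injective
      have h1 := order_eval₂_of_neg hneg (P.map (algebraMap k (RatFunc k)))
        ((Polynomial.map_ne_zero_iff hinj).2 hP)
      rw [hpoly]
      rw [Polynomial.natDegree_map_eq_of_injective hinj,
        Polynomial.leadingCoeff_map_of_injective hinj, hord _ hF] at h1
      exact ⟨h1.1, by rw [h1.2.1]; ring, h1.2.2⟩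
    obtain ⟨n1, o1, l1⟩ := key c.num (RatFunc.num_ne_zero hc)
    obtain ⟨n2, o2, l2⟩ := key c.denom c.denom_ne_zero
    have hθ : (ι (S.j S.F)).leadingCoeff ≠ 0 := by
      rw [HahnSeries.leadingCoeff_ne_zero]; exact (map_ne_zero _).2 (S.j_ne hF)
    have hc' : ι (algebraMap (RatFunc k) L c) ≠ 0 := by
      rw [map_ne_zero, map_ne_zero]; exact hc
    have hq : ι (algebraMap (RatFunc k) L c)
        * ι (algebraMap (RatFunc k) L (algebraMap _ _ c.denom))
        = ι (algebraMap (RatFunc k) L (algebraMap _ _ c.num)) := by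
      rw [← map_mul, ← map_mul]
      congr 2
      nth_rw 1 [← RatFunc.num_div_denom c]
      refine div_mul_cancel₀ _ ?_
      rw [Ne, map_eq_zero_iff _ (RatFunc.algebraMap_injective k)]
      simpa using c.denom_ne_zero
    have ho := HahnSeries.order_mul hc' n2
    have hl : (ι (algebraMap (RatFunc k) L c)).leadingCoeff * _ = _ :=
      (HahnSeries.leadingCoeff_mul _ _).symm.trans (congrArg HahnSeries.leadingCoeff hq)
    rw [hq, o1, o2] at ho
    rw [l1, l2] at hl
    refine ⟨c.num.leadingCoeff / c.denom.leadingCoeff, div_ne_zero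
      (Polynomial.leadingCoeff_ne_zero.2 (RatFunc.num_ne_zero hc))
      (Polynomial.leadingCoeff_ne_zero.2 c.denom_ne_zero),
      (c.num.natDegree : ℤ) - c.denom.natDegree, by linear_combination -ho, ?_⟩
    have hd : algebraMap k (RatFunc k) c.denom.leadingCoeff ≠ 0 :=
      (map_ne_zero _).2 (Polynomial.leadingCoeff_ne_zero.2 c.denom_ne_zero)
    rw [S.X_eq, zpow_sub₀ hθ, zpow_natCast, zpow_natCast, map_div₀]
    rw [← eq_div_iff (mul_ne_zero hd (pow_ne_zero _ hθ))] at hl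
    rw [hl]
    field_simp
  · intro W hW hXW g hg hg0
    set x := S.j (X 0)
    set y := S.j (X 1)
    set u := y ^ a / x ^ b
    set z := y ^ p / x ^ q with hz
    have hz0 : z ≠ 0 := div_ne_zero (pow_ne_zero _ hy) (pow_ne_zero _ hx)
    have hfW : ∀ r, (Polynomial.aeval (R := k) u).toRingHom r ∈ W := by
      intro r
      by_cases hr : r = 0
      · simp [hr]
      · exact (hW r hr).1
    have hj : ∀ H, S.j H
        = Polynomial.eval₂ (Polynomial.aeval (R := k) u).toRingHom z⁻¹ (wt a b p q H) := by
      intro H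
      have h1 : S.j.toRingHom = (Polynomial.eval₂RingHom (Polynomial.aeval (R := k) u).toRingHom
          z⁻¹).comp (wt a b p q).toRingHom := by
        refine MvPolynomial.ringHom_ext (fun c => ?_) (fun i => ?_)
        · have : (wt a b p q) (C c) = Polynomial.C (Polynomial.C c) := (wt a b p q).commutes c
          simp only [AlgHom.toRingHom_eq_coe, RingHom.coe_coe, RingHom.comp_apply, this,
            Polynomial.coe_eval₂RingHom, Polynomial.eval₂_C, Polynomial.aeval_C]
          exact S.j.commutes c
        · have e1 : (wt a b p q) (X 0 : MvPolynomial (Fin 2) k)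
            = Polynomial.monomial a (Polynomial.monomial p 1) := by simp [wt]
          have e2 : (wt a b p q) (X 1 : MvPolynomial (Fin 2) k)
            = Polynomial.monomial b (Polynomial.monomial q 1) := by simp [wt]
          have e3 : u ^ p * z⁻¹ ^ a = x := by
            rw [hz, inv_div, div_pow, div_pow, ← pow_mul, ← pow_mul, ← pow_mul, ← pow_mul,
              mul_comm q a, h, mul_comm p a, pow_succ]
            field_simp
          have e4 : u ^ q * z⁻¹ ^ b = y := by
            rw [hz, inv_div, div_pow, div_pow, ← pow_mul, ← pow_mul, ← pow_mul, ← pow_mul,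
              h, mul_comm q b, mul_comm p b, pow_succ]
            field_simp
          fin_cases i
          · simp only [AlgHom.toRingHom_eq_coe, RingHom.coe_coe, RingHom.comp_apply,
              Polynomial.coe_eval₂RingHom, Fin.zero_eta, e1, Polynomial.eval₂_monomial,
              Polynomial.aeval_monomial, map_one, one_mul]
            exact e3.symm
          · simp only [AlgHom.toRingHom_eq_coe, RingHom.coe_coe, RingHom.comp_apply,
              Polynomial.coe_eval₂RingHom, Fin.mk_one, e2, Polynomial.eval₂_monomial,
              Polynomial.aeval_monomial, map_one, one_mul]
            exact e4.symm
      exact congrArg (fun f => f H) h1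
    have hzv : W.valuation z < 1 := by
      by_contra h1
      refine hXW ?_
      rw [S.X_eq, hj]
      refine eval₂_mem W _ hfW ?_ _
      rw [← W.valuation_le_one_iff, map_inv₀]
      exact inv_le_one_of_one_le₀ (not_lt.1 h1)
    have hval : ∀ H, H ≠ 0 → W.valuation (S.j H)
        = W.valuation z⁻¹ ^ (wt a b p q H).natDegree := by
      intro H hH
      have h1 : (wt a b p q H).leadingCoeff ≠ 0 :=
        Polynomial.leadingCoeff_ne_zero.2 ((map_ne_zero_iff _ hwt).2 hH)
      rw [hj]
      refine valuation_eval₂_inv W _ hfW hz0 hzv _ (hW _ h1).2 fun h0 => ?_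
      have h2 : ι (Polynomial.aeval u (wt a b p q H).leadingCoeff) = 0 := by
        rw [show Polynomial.aeval u (wt a b p q H).leadingCoeff = 0 from h0, map_zero]
      have h3 : ι (Polynomial.aeval u (wt a b p q H).leadingCoeff)
          = HahnSeries.C (Polynomial.aeval RatFunc.X (wt a b p q H).leadingCoeff) := by
        rw [Polynomial.aeval_def, Polynomial.aeval_def, Polynomial.hom_eval₂,
          Polynomial.hom_eval₂, hu]
        congr 1
        ext1 c
        exact hk c
      rw [h3, map_eq_zero] at h2
      exact (transcendental_iff.1 RatFunc.transcendental_X) _ h2 |> h1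
    obtain ⟨H₁, H₂, h2, h12⟩ := S.surj g
    have hH2 : H₂ ≠ 0 := by rintro rfl; simp at h2
    have hH1 : H₁ ≠ 0 := by
      rintro rfl
      rw [map_zero] at h12
      exact mul_ne_zero hg h2 h12
    have hd : (wt a b p q H₁).natDegree = (wt a b p q H₂).natDegree := by
      have h3 := congrArg (fun l => (ι l).order) h12
      simp only [map_mul] at h3
      rw [HahnSeries.order_mul ((map_ne_zero _).2 hg) ((map_ne_zero _).2 h2), hg0, hord _ hH1,
        hord _ hH2] at h3
      omega
    have h4 := congrArg W.valuation h12
    rw [map_mul, hval _ hH1, hval _ hH2, hd] at h4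
    have h5 : W.valuation z⁻¹ ^ (wt a b p q H₂).natDegree ≠ 0 :=
      pow_ne_zero _ ((Valuation.ne_zero_iff _).2 (inv_ne_zero hz0))
    rw [← W.valuation_le_one_iff]
    exact (mul_eq_right₀ h5).1 h4 |>.le

end Coord
end FieldGen

namespace FieldGen

/-- Two polynomials vanishing on a parametrized line have a common factor. -/
lemma not_isRelPrime_of_map_eq_zero {k : Type} [Field k]
    (ρ : MvPolynomial (Fin 2) k →ₐ[k] Polynomial k) (hρ : Function.Surjective ρ)
    {f₁ f₂ : MvPolynomial (Fin 2) k} (h2 : f₂ ≠ 0) (hf₁ : ρ f₁ = 0) (hf₂ : ρ f₂ = 0) :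
    ¬ IsRelPrime f₁ f₂ := by
  intro hrel
  have hker : (RingHom.ker ρ).IsPrime := RingHom.ker_isPrime _
  obtain ⟨φ, hφ, hp⟩ := hker.exists_mem_prime_of_ne_bot fun h => h2 (by
    have : f₂ ∈ RingHom.ker ρ := hf₂
    rwa [h] at this)
  by_cases hspan : RingHom.ker ρ ≤ Ideal.span {φ}
  · exact hp.not_isUnit (hrel (Ideal.mem_span_singleton.1 (hspan hf₁))
      (Ideal.mem_span_singleton.1 (hspan hf₂)))
  have hnm : ¬ (RingHom.ker ρ).IsMaximal := by
    intro hm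
    have h1 : IsField (MvPolynomial (Fin 2) k ⧸ RingHom.ker ρ) :=
      (Ideal.Quotient.maximal_ideal_iff_isField_quotient _).1 hm
    exact Polynomial.not_isField k
      ((RingHom.quotientKerEquivOfSurjective (f := ρ.toRingHom) hρ).symm.toMulEquiv.isField h1)
  obtain ⟨M, hM, hle⟩ := Ideal.exists_le_maximal _ hker.ne_top
  have hMp := hM.isPrime
  have hφp : (Ideal.span {φ}).IsPrime := (Ideal.span_singleton_prime hp.ne_zero).2 hp
  have hφ0 : ⊥ < Ideal.span {φ} := bot_lt_iff_ne_bot.2 (by simpa using hp.ne_zero)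
  have hφk : Ideal.span {φ} < RingHom.ker ρ :=
    lt_of_le_not_ge ((Ideal.span_singleton_le_iff_mem _).2 hφ) hspan
  have hkM : RingHom.ker ρ < M := lt_of_le_of_ne hle fun h => hnm (h ▸ hM)
  have e1 := Ideal.height_add_one_le_of_lt_of_isPrime hφ0
  have e2 := Ideal.height_add_one_le_of_lt_of_isPrime hφk
  have e3 := Ideal.height_add_one_le_of_lt_of_isPrime hkM
  have e4 := Ideal.height_le_ringKrullDim_of_isPrime (I := M)
  rw [MvPolynomial.ringKrullDim_of_isNoetherianRing, ringKrullDim_eq_zero_of_field,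
    Nat.card_fin, zero_add] at e4
  have e5 : M.height ≤ 2 := WithBot.coe_le_coe.1 e4
  have e6 : (3 : ℕ∞) ≤ M.height := by
    refine le_trans ?_ e3
    refine le_trans ?_ (add_le_add_left e2 1)
    refine le_trans ?_ (add_le_add_left (add_le_add_left e1 1) 1)
    rw [Ideal.height_bot]
    norm_num
  exact absurd (e6.trans e5) (by decide)

namespace Coord

variable {k L : Type} [Field k] [Field L] [Algebra k L] [Algebra (RatFunc k) L] {S : Coord k L}

/-- `Rel S ρ l c` means that the rational function `l` restricts to `c` on the parametrized curve
`ρ`. -/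
def Rel (S : Coord k L) (ρ : MvPolynomial (Fin 2) k →ₐ[k] Polynomial k) (l : L) (c : RatFunc k) :
    Prop :=
  ∃ H H', ρ H' ≠ 0 ∧ l * S.j H' = S.j H ∧
    c * algebraMap (Polynomial k) (RatFunc k) (ρ H') = algebraMap (Polynomial k) (RatFunc k) (ρ H)

variable {ρ ρ' : MvPolynomial (Fin 2) k →ₐ[k] Polynomial k} {l l' : L} {c c' : RatFunc k}

lemma algebraMap_ne {P : Polynomial k} (h : P ≠ 0) :
    algebraMap (Polynomial k) (RatFunc k) P ≠ 0 :=
  (map_ne_zero_iff _ (RatFunc.algebraMap_injective k)).2 h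

lemma Rel.j (H : MvPolynomial (Fin 2) k) : S.Rel ρ (S.j H) (algebraMap _ _ (ρ H)) :=
  ⟨H, 1, by simp, by simp, by simp⟩

lemma Rel.add (h : S.Rel ρ l c) (h' : S.Rel ρ l' c') : S.Rel ρ (l + l') (c + c') := by
  obtain ⟨A, B, h1, h2, h3⟩ := h
  obtain ⟨A', B', h1', h2', h3'⟩ := h'
  refine ⟨A * B' + A' * B, B * B', ?_, ?_, ?_⟩
  · rw [map_mul]; exact mul_ne_zero h1 h1'
  · simp only [map_mul, map_add, ← h2, ← h2']; ring
  · simp only [map_mul, map_add, ← h3, ← h3']; ring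

lemma Rel.mul (h : S.Rel ρ l c) (h' : S.Rel ρ l' c') : S.Rel ρ (l * l') (c * c') := by
  obtain ⟨A, B, h1, h2, h3⟩ := h
  obtain ⟨A', B', h1', h2', h3'⟩ := h'
  refine ⟨A * A', B * B', ?_, ?_, ?_⟩
  · rw [map_mul]; exact mul_ne_zero h1 h1'
  · simp only [map_mul, ← h2, ← h2']; ring
  · simp only [map_mul, ← h3, ← h3']; ring

lemma Rel.pow (h : S.Rel ρ l c) (n : ℕ) : S.Rel ρ (l ^ n) (c ^ n) := by
  induction n with
  | zero => simpa using Rel.j (S := S) (ρ := ρ) 1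
  | succ n ih => rw [pow_succ, pow_succ]; exact ih.mul h

lemma Rel.inv (h : S.Rel ρ l c) (hc : c ≠ 0) : S.Rel ρ l⁻¹ c⁻¹ := by
  obtain ⟨A, B, h1, h2, h3⟩ := h
  have hA : ρ A ≠ 0 := by
    intro h0
    rw [h0, map_zero] at h3
    exact mul_ne_zero hc (algebraMap_ne h1) h3
  have hl : l ≠ 0 := by
    rintro rfl
    rw [zero_mul, eq_comm, map_eq_zero_iff _ S.inj] at h2
    exact hA (by rw [h2, map_zero])
  exact ⟨B, A, hA, by rw [← h2, inv_mul_cancel_left₀ hl], by rw [← h3, inv_mul_cancel_left₀ hc]⟩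

lemma Rel.eq (h : S.Rel ρ l c) (h' : S.Rel ρ l c') : c = c' := by
  obtain ⟨A, B, h1, h2, h3⟩ := h
  obtain ⟨A', B', h1', h2', h3'⟩ := h'
  have e : A * B' = A' * B := S.inj (by rw [map_mul, map_mul, ← h2, ← h2']; ring)
  have e' := congrArg (fun H => algebraMap (Polynomial k) (RatFunc k) (ρ H)) e
  simp only [map_mul, ← h3, ← h3'] at e'
  have h4 := mul_ne_zero (algebraMap_ne h1) (algebraMap_ne h1')
  refine mul_right_cancel₀ h4 ?_
  linear_combination e'

lemma rel_or_rel_inv (hρ : Function.Surjective ρ) (g : L) :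
    (∃ c, S.Rel ρ g c) ∨ S.Rel ρ g⁻¹ 0 := by
  obtain ⟨H₁, H₂, h2, h12⟩ := S.surj g
  have hH2 : H₂ ≠ 0 := by rintro rfl; simp at h2
  obtain ⟨a, b, d, hrel, rfl, rfl⟩ :=
    UniqueFactorizationMonoid.exists_reduced_factors' H₁ H₂ hH2
  have hb : b ≠ 0 := right_ne_zero_of_mul hH2
  have hd : S.j d ≠ 0 := S.j_ne (left_ne_zero_of_mul hH2)
  have hab : g * S.j b = S.j a := by
    rw [map_mul, map_mul] at h12
    refine mul_left_cancel₀ hd ?_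
    linear_combination h12
  by_cases hρb : ρ b = 0
  · right
    have hρa : ρ a ≠ 0 := fun h => not_isRelPrime_of_map_eq_zero ρ hρ hb h hρb hrel
    have hg : g ≠ 0 := by
      rintro rfl
      rw [zero_mul, eq_comm, map_eq_zero_iff _ S.inj] at hab
      exact hρa (by rw [hab, map_zero])
    exact ⟨b, a, hρa, by rw [← hab, inv_mul_cancel_left₀ hg], by rw [hρb, zero_mul, map_zero]⟩
  · left
    exact ⟨algebraMap _ _ (ρ a) / algebraMap _ _ (ρ b), a, b, hρb, hab,
      div_mul_cancel₀ _ (algebraMap_ne hρb)⟩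

section
variable [IsScalarTower k (RatFunc k) L]

lemma Rel.const (hρ : ρ S.F = Polynomial.X) (c : RatFunc k) :
    S.Rel ρ (algebraMap (RatFunc k) L c) c := by
  have h : ∀ P : Polynomial k, ρ (Polynomial.aeval S.F P) = P := fun P => by
    rw [← Polynomial.aeval_algHom_apply, hρ, Polynomial.aeval_X_left_apply]
  have hc : c * algebraMap _ _ c.denom = algebraMap _ _ c.num := by
    nth_rw 1 [← RatFunc.num_div_denom c]
    exact div_mul_cancel₀ _ (algebraMap_ne c.denom_ne_zero)
  refine ⟨Polynomial.aeval S.F c.num, Polynomial.aeval S.F c.denom, ?_, ?_, ?_⟩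
  · rw [h]; exact c.denom_ne_zero
  · rw [← S.algebraMap_algebraMap, ← S.algebraMap_algebraMap, ← map_mul, hc]
  · rw [h, h, hc]

lemma Rel.aeval (hρ : ρ S.F = Polynomial.X) (h : S.Rel ρ l c) (P : Polynomial (RatFunc k)) :
    S.Rel ρ (Polynomial.aeval l P) (P.eval c) := by
  induction P using Polynomial.induction_on' with
  | add P Q hP hQ => rw [map_add, Polynomial.eval_add]; exact hP.add hQ
  | monomial n d =>
    rw [Polynomial.aeval_monomial, Polynomial.eval_monomial]
    exact (Rel.const hρ d).mul (h.pow n)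

lemma Rel.aeval_of_inv (hρ : ρ S.F = Polynomial.X) (hl : l ≠ 0) (h : S.Rel ρ l⁻¹ 0)
    (P : Polynomial (RatFunc k)) {D : ℕ} (hP : P.natDegree ≤ D) :
    S.Rel ρ (l⁻¹ ^ D * Polynomial.aeval l P) (P.coeff D) := by
  have h1 := h.aeval hρ (Polynomial.reflect D P)
  rw [← Polynomial.coeff_zero_eq_eval_zero, Polynomial.coeff_reflect, Polynomial.revAt_zero] at h1
  let _ : Invertible l := invertibleOfNonzero hl
  have h2 := Polynomial.eval₂_reflect_mul_pow (algebraMap (RatFunc k) L) l D P hP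
  rw [invOf_eq_inv] at h2
  rw [Polynomial.aeval_def] at h1 ⊢
  rwa [← h2, inv_pow, mul_comm, mul_inv_cancel_right₀ (pow_ne_zero _ hl)]

end

end Coord
end FieldGen

namespace FieldGen
namespace Coord

variable {k L : Type} [Field k] [Field L] [Algebra k L] [Algebra (RatFunc k) L]

/-- A parametrized curve on which `F` restricts to the parameter. -/
def IsSection (S : Coord k L) (ρ : MvPolynomial (Fin 2) k →ₐ[k] Polynomial k) : Prop :=
  ρ S.F = Polynomial.X

variable {S : Coord k L} {ρ ρ' : MvPolynomial (Fin 2) k →ₐ[k] Polynomial k}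

lemma IsSection.apply_aeval (hρ : S.IsSection ρ) (P : Polynomial k) :
    ρ (Polynomial.aeval S.F P) = P := by
  rw [← Polynomial.aeval_algHom_apply, show ρ S.F = Polynomial.X from hρ,
    Polynomial.aeval_X_left_apply]

lemma IsSection.surjective (hρ : S.IsSection ρ) : Function.Surjective ρ :=
  fun P => ⟨_, hρ.apply_aeval P⟩

lemma IsSection.not_injective (hρ : S.IsSection ρ) (hρ' : S.IsSection ρ') (hne : ρ ≠ ρ') :
    ∃ φ, φ ≠ 0 ∧ ρ φ = 0 := by
  by_contra! hcon
  refine hne (MvPolynomial.algHom_ext fun i => ?_)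
  have h : X i - Polynomial.aeval S.F (ρ (X i)) = 0 := by
    by_contra h0
    exact hcon _ h0 (by rw [map_sub, hρ.apply_aeval, sub_self])
  have h' := congrArg ρ' h
  rw [map_sub, hρ'.apply_aeval, map_zero, sub_eq_zero] at h'
  exact h'.symm

section Gen
variable {K : Type} [Field K] [Algebra K L] {s s' : L}

lemma adjoin_eq_top_of_mem (hs : IntermediateField.adjoin K {s} = ⊤)
    (h : s ∈ IntermediateField.adjoin K {s'}) : IntermediateField.adjoin K {s'} = ⊤ := by
  rw [eq_top_iff, ← hs]
  exact IntermediateField.adjoin_simple_le_iff.2 h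

lemma exists_fraction (hs : IntermediateField.adjoin K {s} = ⊤) (g : L) :
    ∃ h h' : Polynomial K, Polynomial.aeval s h' ≠ 0 ∧
      g * Polynomial.aeval s h' = Polynomial.aeval s h := by
  obtain ⟨h, h', rfl⟩ := (IntermediateField.mem_adjoin_simple_iff K g).1
    (hs ▸ IntermediateField.mem_top (x := g))
  by_cases h0 : Polynomial.aeval s h' = 0
  · exact ⟨0, 1, by simp, by simp [h0]⟩
  · exact ⟨h, h', h0, div_mul_cancel₀ _ h0⟩

end Gen

variable [IsScalarTower k (RatFunc k) L] {s : L}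

lemma IsSection.transcendental (hρ : S.IsSection ρ) (hρ' : S.IsSection ρ') (hne : ρ ≠ ρ')
    (hs : IntermediateField.adjoin (RatFunc k) {s} = ⊤) : Transcendental (RatFunc k) s := by
  intro halg
  obtain ⟨φ, hφ, hφ0⟩ := hρ.not_injective hρ' hne
  have h1 := IntermediateField.isAlgebraic_adjoin_simple halg.isIntegral
  have h2 : IsAlgebraic (RatFunc k) (S.j φ) := by
    have h3 := h1.isAlgebraic ⟨S.j φ, hs ▸ IntermediateField.mem_top⟩
    exact h3.algebraMap (A := L)
  have h4 := (Rel.j (S := S) (ρ := ρ) φ).aeval hρ (minpoly (RatFunc k) (S.j φ))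
  rw [minpoly.aeval, hφ0, map_zero, ← Polynomial.coeff_zero_eq_eval_zero] at h4
  have h5 := Rel.j (S := S) (ρ := ρ) 0
  rw [map_zero, map_zero, map_zero] at h5
  exact minpoly.coeff_zero_ne_zero h2.isIntegral (S.j_ne hφ) (h4.eq h5)

lemma IsSection.eq_of_rel_inv (hρ : S.IsSection ρ) (hρ' : S.IsSection ρ')
    (hs : IntermediateField.adjoin (RatFunc k) {s} = ⊤) (hs0 : s ≠ 0)
    (h : S.Rel ρ s⁻¹ 0) (h' : S.Rel ρ' s⁻¹ 0) : ρ = ρ' := by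
  refine MvPolynomial.algHom_ext fun i => ?_
  obtain ⟨P, Q, hQ, hPQ⟩ := exists_fraction hs (S.j (X i))
  set D := max P.natDegree Q.natDegree
  have key : ∀ σ : MvPolynomial (Fin 2) k →ₐ[k] Polynomial k, S.IsSection σ → S.Rel σ s⁻¹ 0 →
      algebraMap _ (RatFunc k) (σ (X i)) * Q.coeff D = P.coeff D := by
    intro σ hσ hr
    have h1 := (Rel.j (S := S) (ρ := σ) (X i)).mul
      (hr.aeval_of_inv hσ hs0 Q (le_max_right P.natDegree Q.natDegree))
    rw [mul_left_comm, hPQ] at h1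
    exact h1.eq (hr.aeval_of_inv hσ hs0 P (le_max_left P.natDegree Q.natDegree))
  have hQD : Q.coeff D ≠ 0 := by
    intro h0
    have h1 := key ρ hρ h
    rw [h0, mul_zero] at h1
    have hQ0 : Q ≠ 0 := by rintro rfl; simp at hQ
    rcases max_choice P.natDegree Q.natDegree with h2 | h2
    · have hP0 : P = 0 := by
        rw [← Polynomial.leadingCoeff_eq_zero, Polynomial.leadingCoeff, ← h2]
        exact h1.symm
      rw [hP0, Polynomial.natDegree_zero] at h2
      have h3 : Q.natDegree = D := by
        have := le_max_right P.natDegree Q.natDegree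
        rw [hP0, Polynomial.natDegree_zero] at this
        simp only [D, hP0, Polynomial.natDegree_zero]
        omega
      rw [← h3] at h0
      exact hQ0 (Polynomial.leadingCoeff_eq_zero.1 h0)
    · rw [show D = Q.natDegree from h2] at h0
      exact hQ0 (Polynomial.leadingCoeff_eq_zero.1 h0)
  exact RatFunc.algebraMap_injective k
    (mul_right_cancel₀ hQD ((key ρ hρ h).trans (key ρ' hρ' h').symm))

lemma Rel.sub_const {l : L} {c : RatFunc k} (hρ : S.IsSection ρ) (h : S.Rel ρ l c)
    (d : RatFunc k) : S.Rel ρ (l - algebraMap (RatFunc k) L d) (c - d) := by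
  rw [sub_eq_add_neg, sub_eq_add_neg, ← map_neg]
  exact h.add (Rel.const hρ _)

/-- A generator of the pencil taking the values `∞`, `0`, `1` at three given sections. -/
lemma exists_generator {ρ₁ ρ₂ ρ₃ : MvPolynomial (Fin 2) k →ₐ[k] Polynomial k}
    (h₁ : S.IsSection ρ₁) (h₂ : S.IsSection ρ₂) (h₃ : S.IsSection ρ₃)
    (h12 : ρ₁ ≠ ρ₂) (h13 : ρ₁ ≠ ρ₃) (h23 : ρ₂ ≠ ρ₃) {g : L}
    (hg : IntermediateField.adjoin (RatFunc k) {g} = ⊤) :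
    ∃ s : L, IntermediateField.adjoin (RatFunc k) {s} = ⊤ ∧ S.Rel ρ₁ s⁻¹ 0 ∧
      S.Rel ρ₂ s 0 ∧ S.Rel ρ₃ (s - 1) 0 := by
  have hmem : ∀ (s : L), s ∈ IntermediateField.adjoin (RatFunc k) {s} := fun s =>
    IntermediateField.mem_adjoin_simple_self _ _
  obtain ⟨s, hs, hr⟩ : ∃ s : L, IntermediateField.adjoin (RatFunc k) {s} = ⊤ ∧
      S.Rel ρ₁ s⁻¹ 0 := by
    rcases rel_or_rel_inv h₁.surjective g with ⟨c, hc⟩ | h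
    · refine ⟨(g - algebraMap (RatFunc k) L c)⁻¹, adjoin_eq_top_of_mem hg ?_, ?_⟩
      · have h := add_mem (inv_mem (hmem (g - algebraMap (RatFunc k) L c)⁻¹))
          (IntermediateField.algebraMap_mem _ c)
        rwa [inv_inv, sub_add_cancel] at h
      · have h := hc.sub_const h₁ c
        rwa [sub_self, ← inv_inv (g - _)] at h
    · exact ⟨g, hg, h⟩
  have htr := h₁.transcendental h₂ h12 hs
  have hs0 : s ≠ 0 := by rintro rfl; exact htr isAlgebraic_zero
  obtain ⟨c₂, hc₂⟩ := (rel_or_rel_inv h₂.surjective s).resolve_right fun h =>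
    h12 (h₁.eq_of_rel_inv h₂ hs hs0 hr h)
  obtain ⟨c₃, hc₃⟩ := (rel_or_rel_inv h₃.surjective s).resolve_right fun h =>
    h13 (h₁.eq_of_rel_inv h₃ hs hs0 hr h)
  have hsub : ∀ c, s - algebraMap (RatFunc k) L c ≠ 0 := fun c h =>
    htr (by rw [sub_eq_zero.1 h]; exact isAlgebraic_algebraMap c)
  have hc : c₃ - c₂ ≠ 0 := by
    intro h
    rw [sub_eq_zero] at h
    subst h
    refine h23 (h₂.eq_of_rel_inv h₃ (s := (s - algebraMap (RatFunc k) L c₃)⁻¹)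
      (adjoin_eq_top_of_mem hs ?_) (inv_ne_zero (hsub _)) ?_ ?_)
    · have h := add_mem (inv_mem (hmem (s - algebraMap (RatFunc k) L c₃)⁻¹))
          (IntermediateField.algebraMap_mem _ c₃)
      rwa [inv_inv, sub_add_cancel] at h
    · rw [inv_inv, ← sub_self c₃]; exact hc₂.sub_const h₂ c₃
    · rw [inv_inv, ← sub_self c₃]; exact hc₃.sub_const h₃ c₃
  have hcL : algebraMap (RatFunc k) L (c₃ - c₂) ≠ 0 := (map_ne_zero _).2 hc
  set s' := (s - algebraMap (RatFunc k) L c₂) * algebraMap (RatFunc k) L (c₃ - c₂)⁻¹ with hs'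
  have hr' : ∀ {ρ : MvPolynomial (Fin 2) k →ₐ[k] Polynomial k} (hρ : S.IsSection ρ) {c : RatFunc k},
      S.Rel ρ s c → S.Rel ρ s' ((c - c₂) * (c₃ - c₂)⁻¹) := fun hρ _ h =>
    (h.sub_const hρ c₂).mul (Rel.const hρ _)
  refine ⟨s', adjoin_eq_top_of_mem hs ?_, ?_, ?_, ?_⟩
  · have h := add_mem (mul_mem (hmem s')
      (IntermediateField.algebraMap_mem _ (c₃ - c₂))) (IntermediateField.algebraMap_mem _ c₂)
    have e : s' * algebraMap (RatFunc k) L (c₃ - c₂) + algebraMap (RatFunc k) L c₂ = s := by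
      rw [hs', map_inv₀, inv_mul_cancel_right₀ hcL, sub_add_cancel]
    rwa [e] at h
  · have e : s'⁻¹ = s⁻¹ * algebraMap (RatFunc k) L (c₃ - c₂) *
        (1 + s⁻¹ * algebraMap (RatFunc k) L (-c₂))⁻¹ := by
      rw [hs', map_inv₀, mul_inv, inv_inv, map_neg, mul_right_comm, ← mul_inv]
      congr 2
      field_simp
      ring
    have h1 : S.Rel ρ₁ 1 1 := by simpa using Rel.const (S := S) h₁ 1
    have h2 := (hr.mul (Rel.const h₁ (c₃ - c₂))).mul
      ((h1.add (hr.mul (Rel.const h₁ (-c₂)))).inv (by simp))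
    rw [zero_mul, zero_mul] at h2
    rwa [e]
  · have h := hr' h₂ hc₂
    rwa [sub_self, zero_mul] at h
  · have h := (hr' h₃ hc₃).sub_const h₃ 1
    rwa [mul_inv_cancel₀ hc, sub_self, map_one] at h

end Coord
end FieldGen

namespace FieldGen

namespace Model
variable {k L E : Type} [Field k] [Field L] [Field E] [Algebra (RatFunc k) L] [Algebra k L]
  [Algebra k E] [IsScalarTower k (RatFunc k) L] (M : Model k (RatFunc k) L E)

lemma res_aeval_inv (ht : M.t = RatFunc.X) (Q : Polynomial k) :
    ∃ h : algebraMap (RatFunc k) L (Polynomial.aeval RatFunc.X⁻¹ Q) ∈ M.V,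
      M.res ⟨_, h⟩ = algebraMap k E (Q.eval 0) := by
  have hX : (M.e : ℤ) = M.v (algebraMap (RatFunc k) L RatFunc.X⁻¹) := by
    rw [← ht, map_inv₀, M.v_inv, M.v_t, neg_neg]
  have he := M.e_pos
  have hXV : algebraMap (RatFunc k) L RatFunc.X⁻¹ ∈ M.V := by
    rw [M.mem_V, ← hX]; positivity
  have hX0 : M.res ⟨_, hXV⟩ = 0 := M.res_of_pos (by
    change 0 < M.v (algebraMap (RatFunc k) L RatFunc.X⁻¹)
    rw [← hX]; exact_mod_cast he)
  induction Q using Polynomial.induction_on' with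
  | add P Q hP hQ =>
    obtain ⟨h, h'⟩ := hP
    obtain ⟨g, g'⟩ := hQ
    refine ⟨by rw [map_add, map_add]; exact add_mem h g, ?_⟩
    rw [Polynomial.eval_add, map_add (algebraMap k E), ← h', ← g', ← M.res.map_add]
    congr 1
    ext
    simp
  | monomial n c =>
    have hc : algebraMap k L c ∈ M.V := M.algebraMap_mem_V c
    have e : algebraMap (RatFunc k) L (Polynomial.aeval RatFunc.X⁻¹ (Polynomial.monomial n c))
        = algebraMap k L c * algebraMap (RatFunc k) L RatFunc.X⁻¹ ^ n := by
      rw [Polynomial.aeval_monomial, map_mul, map_pow, ← IsScalarTower.algebraMap_apply]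
    refine ⟨by rw [e]; exact mul_mem hc (pow_mem hXV n), ?_⟩
    rw [Polynomial.eval_monomial, map_mul (algebraMap k E), map_pow (algebraMap k E),
      map_zero (algebraMap k E), ← hX0, ← M.res_algebraMap c hc, ← M.res.map_pow, ← M.res.map_mul]
    congr 1
    ext
    exact e

lemma res_mul_X_inv_pow (ht : M.t = RatFunc.X) (P : Polynomial k) {D : ℕ} (hP : P.natDegree ≤ D) :
    ∃ h : algebraMap (RatFunc k) L
        (algebraMap (Polynomial k) (RatFunc k) P * RatFunc.X⁻¹ ^ D) ∈ M.V,
      M.res ⟨_, h⟩ = algebraMap k E (P.coeff D) := by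
  have h1 := M.res_aeval_inv ht (Polynomial.reflect D P)
  rw [← Polynomial.coeff_zero_eq_eval_zero, Polynomial.coeff_reflect, Polynomial.revAt_zero] at h1
  let _ : Invertible (RatFunc.X : RatFunc k) := invertibleOfNonzero RatFunc.X_ne_zero
  have h2 := Polynomial.eval₂_reflect_mul_pow (algebraMap k (RatFunc k)) RatFunc.X D P hP
  rw [invOf_eq_inv, ← Polynomial.aeval_def, ← Polynomial.aeval_def] at h2
  have h3 : Polynomial.aeval RatFunc.X P = algebraMap (Polynomial k) (RatFunc k) P := by
    rw [← RatFunc.algebraMap_X, Polynomial.aeval_algebraMap_apply, Polynomial.aeval_X_left_apply]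
  rw [h3] at h2
  have h4 : Polynomial.aeval RatFunc.X⁻¹ (Polynomial.reflect D P)
      = algebraMap (Polynomial k) (RatFunc k) P * RatFunc.X⁻¹ ^ D := by
    rw [← h2, inv_pow, mul_inv_cancel_right₀ (pow_ne_zero _ RatFunc.X_ne_zero)]
  rwa [← h4]

end Model

/-- The degree of the leading form of a parametrized curve for the weights `(a, b)`. -/
noncomputable def wdeg {k : Type} [Field k] (a b : ℕ)
    (ρ : MvPolynomial (Fin 2) k →ₐ[k] Polynomial k) : ℕ :=
  max (a * (ρ (X 1)).natDegree) (b * (ρ (X 0)).natDegree)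

/-- First coordinate of the direction of a parametrized curve for the weights `(a, b)`. -/
noncomputable def dirY {k : Type} [Field k] (a b : ℕ)
    (ρ : MvPolynomial (Fin 2) k →ₐ[k] Polynomial k) : k :=
  (ρ (X 1) ^ a).coeff (wdeg a b ρ)

/-- Second coordinate of the direction of a parametrized curve for the weights `(a, b)`. -/
noncomputable def dirX {k : Type} [Field k] (a b : ℕ)
    (ρ : MvPolynomial (Fin 2) k →ₐ[k] Polynomial k) : k :=
  (ρ (X 0) ^ b).coeff (wdeg a b ρ)

lemma coeff_pow_mul_natDegree_ne {k : Type} [Field k] {P : Polynomial k} (hP : P ≠ 0) (n : ℕ) :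
    (P ^ n).coeff (n * P.natDegree) ≠ 0 := by
  rw [Polynomial.coeff_pow_mul_natDegree]
  exact pow_ne_zero _ (Polynomial.leadingCoeff_ne_zero.2 hP)

lemma dir_ne {k : Type} [Field k] {a : ℕ} (ha : 0 < a) (b : ℕ)
    {ρ : MvPolynomial (Fin 2) k →ₐ[k] Polynomial k}
    (hρ : 0 < (ρ (X 0)).natDegree ∨ 0 < (ρ (X 1)).natDegree) :
    ¬ (dirY a b ρ = 0 ∧ dirX a b ρ = 0) := by
  rintro ⟨h1, h2⟩
  rw [dirY] at h1
  rw [dirX] at h2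
  have hx : wdeg a b ρ = b * (ρ (X 0)).natDegree → b = 0 ∨ ρ (X 0) = 0 := by
    intro h
    by_contra! hcon
    rw [h] at h2
    exact coeff_pow_mul_natDegree_ne hcon.2 _ h2
  have hy : wdeg a b ρ = a * (ρ (X 1)).natDegree → ρ (X 1) = 0 := by
    intro h
    by_contra hcon
    rw [h] at h1
    exact coeff_pow_mul_natDegree_ne hcon _ h1
  have hle1 : a * (ρ (X 1)).natDegree ≤ wdeg a b ρ := le_max_left _ _
  rcases max_choice (a * (ρ (X 1)).natDegree) (b * (ρ (X 0)).natDegree) with h | h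
  · have h0 := hy h
    have hw : wdeg a b ρ = 0 := by rw [wdeg, h, h0]; simp
    rw [hw] at h2 hx
    rw [h0, Polynomial.natDegree_zero] at hρ
    have hx' : 0 < (ρ (X 0)).natDegree := hρ.resolve_right (lt_irrefl _)
    have hb : b = 0 := by
      have := le_max_right (a * (ρ (X 1)).natDegree) (b * (ρ (X 0)).natDegree)
      rw [← wdeg, hw] at this
      by_contra hb
      exact absurd this (by simp [hb, hx'.ne'])
    simp [hb] at h2
  · have hbx := hx h
    have hw : wdeg a b ρ = 0 := by
      rw [wdeg, h]
      rcases hbx with h | h <;> simp [h]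
    rw [hw] at h2 hle1
    have h3 : (ρ (X 1)).natDegree = 0 := by
      by_contra h3
      exact absurd hle1 (by simp [h3, ha.ne'])
    rcases hbx with h | h
    · simp [h] at h2
    · rw [h, h3] at hρ
      simp at hρ

namespace Coord

variable {k L : Type} [Field k] [Field L] [Algebra k L] [Algebra (RatFunc k) L] {S : Coord k L}
  {ρ : MvPolynomial (Fin 2) k →ₐ[k] Polynomial k}

lemma IsSection.nonconstant (hρ : S.IsSection ρ) :
    0 < (ρ (X 0)).natDegree ∨ 0 < (ρ (X 1)).natDegree := by
  by_contra! hcon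
  obtain ⟨c0, h0⟩ := Polynomial.natDegree_eq_zero.1 (Nat.le_zero.1 hcon.1)
  obtain ⟨c1, h1⟩ := Polynomial.natDegree_eq_zero.1 (Nat.le_zero.1 hcon.2)
  have h : ρ = Polynomial.CAlgHom.comp (MvPolynomial.aeval ![c0, c1]) := by
    refine MvPolynomial.algHom_ext fun i => ?_
    fin_cases i
    · simpa [Polynomial.CAlgHom] using h0.symm
    · simpa [Polynomial.CAlgHom] using h1.symm
  have hX : ρ S.F = Polynomial.X := hρ
  rw [h] at hX
  exact Polynomial.X_ne_C _ hX.symm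

variable [IsScalarTower k (RatFunc k) L] {s : L}

lemma IsSection.isPoint (hρ : S.IsSection ρ) {M : Model k (RatFunc k) L (RatFunc k)} {a b : ℕ}
    (ha : 0 < a) (ht : M.t = RatFunc.X) (hu : M.u = S.j (X 1) ^ a / S.j (X 0) ^ b)
    (hs : IntermediateField.adjoin (RatFunc k) {s} = ⊤) (htr : Transcendental (RatFunc k) s)
    (hr : S.Rel ρ s⁻¹ 0) : M.IsPoint s (dirY a b ρ) (dirX a b ρ) where
  tr := htr
  gen := exists_fraction hs
  ne := dir_ne ha b hρ.nonconstant
  dir := by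
    intro h₁ h₂ D hd1 hd2 hrel hκ₁ hκ₂
    have hs0 : s ≠ 0 := by rintro rfl; exact htr isAlgebraic_zero
    have hx := S.j_ne (X_ne_zero (R := k) (0 : Fin 2))
    rw [hu, div_mul_eq_mul_div, div_eq_iff (pow_ne_zero _ hx)] at hrel
    have r1 := ((Rel.j (S := S) (ρ := ρ) (X 1)).pow a).mul (hr.aeval_of_inv hρ hs0 h₂ hd2)
    have r2 := ((Rel.j (S := S) (ρ := ρ) (X 0)).pow b).mul (hr.aeval_of_inv hρ hs0 h₁ hd1)
    rw [mul_left_comm, hrel, mul_comm (Polynomial.aeval s h₁), mul_left_comm] at r1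
    have h3 := r1.eq r2
    obtain ⟨m1, e1⟩ := M.res_mul_X_inv_pow ht (ρ (X 1) ^ a) (D := wdeg a b ρ)
      (Polynomial.natDegree_pow_le.trans (le_max_left _ _))
    obtain ⟨m2, e2⟩ := M.res_mul_X_inv_pow ht (ρ (X 0) ^ b) (D := wdeg a b ρ)
      (Polynomial.natDegree_pow_le.trans (le_max_right _ _))
    rw [dirY, dirX, ← e1, ← e2, ← map_mul, ← map_mul]
    congr 1
    ext
    simp only [Subring.coe_mul, ← map_mul]
    congr 1
    rw [map_pow (algebraMap (Polynomial k) (RatFunc k)),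
      map_pow (algebraMap (Polynomial k) (RatFunc k))]
    linear_combination RatFunc.X⁻¹ ^ wdeg a b ρ * h3

end Coord
end FieldGen

namespace FieldGen

/-- The places of `k(U)` over `k` sending `U` to a power of the uniformizer. -/
lemma exists_place {k : Type} [Field k] {n : ℤ} (hn : n ≠ 0) :
    ∃ D : RatFunc k →+* HahnSeries ℤ k, (∀ c : k, D (algebraMap k _ c) = HahnSeries.C c) ∧
      ∀ Q : Polynomial k, Q ≠ 0 → ∃ i : ℕ, Q.coeff i ≠ 0 ∧
        (D (algebraMap (Polynomial k) (RatFunc k) Q)).order = n * i := by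
  let f : Polynomial k →+* HahnSeries ℤ k :=
    Polynomial.eval₂RingHom HahnSeries.C (HahnSeries.single n 1)
  have hf : ∀ (Q : Polynomial k) (m : ℤ), (f Q).coeff m =
      ∑ i ∈ Finset.range (Q.natDegree + 1), if m = n * i then Q.coeff i else 0 := by
    intro Q m
    have : f Q = ∑ i ∈ Finset.range (Q.natDegree + 1), HahnSeries.single (n * i) (Q.coeff i) := by
      simp only [f, Polynomial.coe_eval₂RingHom, Polynomial.eval₂_eq_sum_range]
      refine Finset.sum_congr rfl fun i _ => ?_
      rw [HahnSeries.single_pow, HahnSeries.C_apply, HahnSeries.single_mul_single]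
      simp [mul_comm]
    rw [this, HahnSeries.coeff_sum]
    refine Finset.sum_congr rfl fun i _ => ?_
    rw [HahnSeries.coeff_single]
    congr
  have hinj : Function.Injective f := by
    rw [injective_iff_map_eq_zero]
    intro Q hQ
    by_contra hQ0
    have h := hf Q (n * Q.natDegree)
    rw [Finset.sum_eq_single_of_mem Q.natDegree (by simp), if_pos rfl, hQ] at h
    · exact Polynomial.leadingCoeff_ne_zero.2 hQ0 h.symm
    · intro i _ hi
      refine if_neg fun h' => hi ?_
      exact_mod_cast (mul_left_cancel₀ hn h').symm
  refine ⟨IsFractionRing.lift hinj, fun c => ?_, fun Q hQ => ?_⟩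
  · rw [IsScalarTower.algebraMap_apply k (Polynomial k) (RatFunc k), IsFractionRing.lift_algebraMap]
    simp [f]
  · rw [IsFractionRing.lift_algebraMap]
    have h0 : (f Q).coeff (f Q).order ≠ 0 :=
      HahnSeries.coeff_order_eq_zero.not.2 ((map_ne_zero_iff _ hinj).2 hQ)
    rw [hf] at h0
    obtain ⟨i, -, hi⟩ := Finset.exists_ne_zero_of_sum_ne_zero h0
    split_ifs at hi with h
    · exact ⟨i, hi, h⟩
    · exact absurd rfl hi

namespace Coord

variable {k L : Type} [Field k] [Field L] [Algebra k L] [Algebra (RatFunc k) L] {S : Coord k L}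
  {ρ₁ ρ₂ ρ₃ : MvPolynomial (Fin 2) k →ₐ[k] Polynomial k}
  [IsScalarTower k (RatFunc k) L] {a b p q : ℕ}

lemma wt_X_zero : wt a b p q (X 0 : MvPolynomial (Fin 2) k)
    = Polynomial.monomial a (Polynomial.monomial p 1) := by simp [wt]

lemma wt_X_one : wt a b p q (X 1 : MvPolynomial (Fin 2) k)
    = Polynomial.monomial b (Polynomial.monomial q 1) := by simp [wt]

lemma toHahn_monomial (a p : ℕ) :
    (toHahn (Polynomial.monomial a (Polynomial.monomial p (1 : k)))).order = -(a : ℤ) ∧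
    (toHahn (Polynomial.monomial a (Polynomial.monomial p (1 : k)))).leadingCoeff
      = algebraMap (Polynomial k) (RatFunc k) (Polynomial.monomial p 1) := by
  have h := toHahn_order (Polynomial.monomial a (Polynomial.monomial p (1 : k))) (by simp)
  rw [Polynomial.natDegree_monomial_eq _ (by simp), Polynomial.leadingCoeff_monomial] at h
  exact h.2

/-- If three sections have pairwise distinct directions for given weights then `F` has weighted
degree one. -/
theorem natDegree_wt_eq_one (h₁ : S.IsSection ρ₁) (h₂ : S.IsSection ρ₂) (h₃ : S.IsSection ρ₃)
    {g : L} (hg : IntermediateField.adjoin (RatFunc k) {g} = ⊤)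
    (ha : 0 < a) (h : a * q = b * p + 1) (he : 0 < (wt a b p q S.F).natDegree)
    (h12 : dirY a b ρ₁ * dirX a b ρ₂ ≠ dirY a b ρ₂ * dirX a b ρ₁)
    (h13 : dirY a b ρ₁ * dirX a b ρ₃ ≠ dirY a b ρ₃ * dirX a b ρ₁)
    (h23 : dirY a b ρ₂ * dirX a b ρ₃ ≠ dirY a b ρ₃ * dirX a b ρ₂) :
    (wt a b p q S.F).natDegree = 1 := by
  have n12 : ρ₁ ≠ ρ₂ := by rintro rfl; exact h12 rfl
  have n13 : ρ₁ ≠ ρ₃ := by rintro rfl; exact h13 rfl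
  have n23 : ρ₂ ≠ ρ₃ := by rintro rfl; exact h23 rfl
  obtain ⟨s, hs, r1, r2, r3⟩ := exists_generator h₁ h₂ h₃ n12 n13 n23 hg
  obtain ⟨M, hι, ht, hMe, hu, -⟩ := S.exists_model h he
  have hs' : IntermediateField.adjoin (RatFunc k) {s⁻¹} = ⊤ := adjoin_eq_top_of_mem hs (by
    simpa using inv_mem (IntermediateField.mem_adjoin_simple_self (RatFunc k) s⁻¹))
  have hs'' : IntermediateField.adjoin (RatFunc k) {(s - 1)⁻¹} = ⊤ := adjoin_eq_top_of_mem hs (by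
    simpa using add_mem (inv_mem (IntermediateField.mem_adjoin_simple_self (RatFunc k) (s - 1)⁻¹))
      (one_mem _))
  have p1 := h₁.isPoint ha ht hu hs (h₁.transcendental h₂ n12 hs) r1
  have p2 := h₂.isPoint ha ht hu hs' (h₁.transcendental h₂ n12 hs') (by rwa [inv_inv])
  have p3 := h₃.isPoint ha ht hu hs'' (h₁.transcendental h₂ n12 hs'') (by rwa [inv_inv])
  have hx := S.j_ne (X_ne_zero (R := k) (0 : Fin 2))
  have hy := S.j_ne (X_ne_zero (R := k) (1 : Fin 2))
  have hd := M.dvd_of_three_points p1 p2 p3 h12 h13 h23 (S.j (X 1) ^ p * (S.j (X 0) ^ q)⁻¹)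
    (mul_ne_zero (pow_ne_zero _ hy) (inv_ne_zero (pow_ne_zero _ hx)))
  rw [M.v_mul (pow_ne_zero _ hy) (inv_ne_zero (pow_ne_zero _ hx)), M.v_inv, M.v_pow, M.v_pow,
    Model.v, Model.v, hι, hι, wt_X_zero, wt_X_one, (toHahn_monomial _ _).1,
    (toHahn_monomial _ _).1, hMe] at hd
  have h' : (a : ℤ) * q = b * p + 1 := by exact_mod_cast h
  have e1 : (p : ℤ) * -b - q * -a = 1 := by linear_combination h'
  rw [sub_eq_add_neg] at e1
  rw [e1] at hd
  exact_mod_cast Int.eq_one_of_dvd_one (by positivity) hd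

/-- If a section has a finite nonzero direction for given positive weights then one of the weights
is one. -/
theorem eq_one_or_eq_one (h₁ : S.IsSection ρ₁) (h₂ : S.IsSection ρ₂) (h₃ : S.IsSection ρ₃)
    (n12 : ρ₁ ≠ ρ₂) (n13 : ρ₁ ≠ ρ₃) (n23 : ρ₂ ≠ ρ₃)
    {g : L} (hg : IntermediateField.adjoin (RatFunc k) {g} = ⊤)
    (ha : 0 < a) (h : a * q = b * p + 1) (he : 0 < (wt a b p q S.F).natDegree)
    (hl : dirY a b ρ₁ ≠ 0) (hm : dirX a b ρ₁ ≠ 0) : a = 1 ∨ b = 1 := by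
  obtain ⟨s, hs, r1, r2, r3⟩ := exists_generator h₁ h₂ h₃ n12 n13 n23 hg
  obtain ⟨M, hι, ht, hMe, hu, hU⟩ := S.exists_model h he
  have p1 := h₁.isPoint ha ht hu hs (h₁.transcendental h₂ n12 hs) r1
  have hx := S.j_ne (X_ne_zero (R := k) (0 : Fin 2))
  have hy := S.j_ne (X_ne_zero (R := k) (1 : Fin 2))
  have hQ : wt a b p q S.F ≠ 0 := by
    intro h0
    rw [h0] at he
    simp at he
  have hθ : M.θ = algebraMap (Polynomial k) (RatFunc k) (wt a b p q S.F).leadingCoeff := by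
    rw [Model.θ, M.lc_apply, ht, S.X_eq, hι, (toHahn_order _ hQ).2.2]
  set e := (wt a b p q S.F).natDegree with he_def
  have key : ∀ n : ℤ, n = 1 ∨ n = -1 → ∀ D : RatFunc k →+* HahnSeries ℤ k,
      (∀ Q : Polynomial k, Q ≠ 0 → ∃ i : ℕ, Q.coeff i ≠ 0 ∧
        (D (algebraMap (Polynomial k) (RatFunc k) Q)).order = n * i) →
      (∀ g : L, g ≠ 0 → (M.e : ℤ) ∣ (D (M.Ψ g)).order) → a = 1 ∨ b = 1 := by
    intro n hn D hD hdvd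
    obtain ⟨r, hr, hro⟩ := hD _ (Polynomial.leadingCoeff_ne_zero.2 hQ)
    rw [← hθ] at hro
    obtain ⟨m, hm1, hm2⟩ := exists_monomial_of_coeff_wt S.F e r hr
    have hmon : ∀ i : ℕ, (D (algebraMap (Polynomial k) (RatFunc k)
        (Polynomial.monomial i 1))).order = n * i := by
      intro i
      obtain ⟨i', hi, ho⟩ := hD (Polynomial.monomial i 1) (by simp)
      rw [Polynomial.coeff_monomial] at hi
      split_ifs at hi with h'
      · rw [ho, h']
      · exact absurd rfl hi
    have hord : ∀ (z : L) (w i : ℕ), z ≠ 0 → M.ι z = toHahn (Polynomial.monomial w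
        (Polynomial.monomial i (1 : k))) → (e : ℤ) ∣ w * r := by
      intro z w i hz hzw
      have h1 : M.Ψ z * M.θ ^ w = algebraMap (Polynomial k) (RatFunc k)
          (Polynomial.monomial i 1) ^ e := by
        rw [M.Ψ_apply, Model.v, M.lc_apply, hzw, (toHahn_monomial _ _).1, (toHahn_monomial _ _).2,
          hMe, mul_assoc, zpow_neg, zpow_natCast, inv_mul_cancel₀ (pow_ne_zero _ M.θ_ne), mul_one]
      have h2 := congrArg (fun t => (D t).order) h1
      have hΨ : D (M.Ψ z) ≠ 0 := (map_ne_zero _).2 ((map_ne_zero _).2 hz)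
      have hθ0 : D M.θ ≠ 0 := (map_ne_zero _).2 M.θ_ne
      simp only [map_mul, map_pow] at h2
      rw [HahnSeries.order_mul hΨ (pow_ne_zero _ hθ0), HahnSeries.order_pow, HahnSeries.order_pow,
        hro, hmon, nsmul_eq_mul, nsmul_eq_mul] at h2
      obtain ⟨c, hc⟩ := hdvd z hz
      rw [hMe] at hc
      have h3 : (e : ℤ) ∣ n * (w * r) := ⟨n * i - c, by
        rw [hc] at h2
        linear_combination h2⟩
      rcases hn with rfl | rfl
      · simpa using h3
      · simpa using h3
    have d1 := hord _ a p hx (by rw [hι, wt_X_zero])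
    have d2 := hord _ b q hy (by rw [hι, wt_X_one])
    have h' : (a : ℤ) * q = b * p + 1 := by exact_mod_cast h
    have hm1' : (a : ℤ) * m 0 + b * m 1 = e := by exact_mod_cast hm1
    have hm2' : (p : ℤ) * m 0 + q * m 1 = r := by exact_mod_cast hm2
    have d3 : (e : ℤ) ∣ m 0 := by
      have : (m 0 : ℤ) = q * e - b * r := by
        linear_combination (-(m 0 : ℤ)) * h' + q * hm1' - b * hm2'
      rw [this]
      exact dvd_sub (dvd_mul_left _ _) d2
    have d4 : (e : ℤ) ∣ m 1 := by
      have : (m 1 : ℤ) = a * r - p * e := by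
        linear_combination (-(m 1 : ℤ)) * h' - p * hm1' + a * hm2'
      rw [this]
      exact dvd_sub d1 (dvd_mul_left _ _)
    obtain ⟨i, hi⟩ := Int.natCast_dvd_natCast.1 d3
    obtain ⟨j, hj⟩ := Int.natCast_dvd_natCast.1 d4
    rw [hi, hj] at hm1
    have h1 : e * (a * i + b * j) = e * 1 := by linear_combination hm1
    have h2 := Nat.eq_of_mul_eq_mul_left he h1
    rcases Nat.eq_zero_or_pos (a * i) with h0 | h0
    · rw [h0, zero_add] at h2
      exact Or.inr (Nat.eq_one_of_mul_eq_one_right h2)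
    · have : b * j = 0 := by omega
      rw [this, add_zero] at h2
      exact Or.inl (Nat.eq_one_of_mul_eq_one_right h2)
  obtain ⟨D, hD1, hD2⟩ := exists_place (k := k) (n := 1) one_ne_zero
  obtain ⟨D', hD1', hD2'⟩ := exists_place (k := k) (n := -1) (by norm_num)
  have hX : ∀ (n : ℤ) (D : RatFunc k →+* HahnSeries ℤ k),
      (∀ Q : Polynomial k, Q ≠ 0 → ∃ i : ℕ, Q.coeff i ≠ 0 ∧
        (D (algebraMap (Polynomial k) (RatFunc k) Q)).order = n * i) → (D M.U).order = n := by
    intro n D hD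
    obtain ⟨i, hi, ho⟩ := hD Polynomial.X Polynomial.X_ne_zero
    rw [Polynomial.coeff_X] at hi
    split_ifs at hi with h1
    · rw [hU, ← RatFunc.algebraMap_X, ho, ← h1, Nat.cast_one, mul_one]
    · exact absurd rfl hi
  rcases p1.dvd_order hl hm hD1 hD1' (hX _ _ hD2) (hX _ _ hD2') with hd | hd
  · exact key 1 (Or.inl rfl) D hD2 hd
  · exact key (-1) (Or.inr rfl) D' hD2' hd

end Coord
end FieldGen

namespace FieldGen

section Good
variable {k : Type} [Field k]

/-- `F` has degree at most one in one of the variables of some coordinate system. -/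
def IsGood (F : MvPolynomial (Fin 2) k) : Prop :=
  ∃ X' Y' : MvPolynomial (Fin 2) k,
    Function.Bijective ⇑(MvPolynomial.aeval (R := k) ![X', Y']) ∧
    ∃ α β : Polynomial k, F = Polynomial.aeval Y' α * X' + Polynomial.aeval Y' β

lemma IsGood.map {F : MvPolynomial (Fin 2) k} (h : IsGood F)
    (τ : MvPolynomial (Fin 2) k ≃ₐ[k] MvPolynomial (Fin 2) k) : IsGood (τ F) := by
  obtain ⟨X', Y', hb, α, β, hF⟩ := h
  refine ⟨τ X', τ Y', ?_, α, β, ?_⟩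
  · have e : MvPolynomial.aeval (R := k) ![τ X', τ Y']
        = (τ : MvPolynomial (Fin 2) k →ₐ[k] _).comp (MvPolynomial.aeval ![X', Y']) := by
      refine MvPolynomial.algHom_ext fun i => ?_
      fin_cases i <;> simp
    rw [e]
    exact τ.bijective.comp hb
  · rw [hF, map_add, map_mul, ← Polynomial.aeval_algHom_apply τ,
      ← Polynomial.aeval_algHom_apply τ]

lemma isGood_of_degree_le_one {F : MvPolynomial (Fin 2) k} (h : ∀ m ∈ F.support, m 0 ≤ 1) :
    IsGood F := by
  refine ⟨X 0, X 1, ?_, ?_⟩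
  · have e : MvPolynomial.aeval (R := k) ![X 0, X 1]
        = AlgHom.id k (MvPolynomial (Fin 2) k) := by
      refine MvPolynomial.algHom_ext fun i => ?_
      fin_cases i <;> simp
    rw [e]
    exact Function.bijective_id
  · suffices H : ∀ s : Finset (Fin 2 →₀ ℕ), (∀ m ∈ s, m 0 ≤ 1) → ∃ α β : Polynomial k,
        ∑ m ∈ s, monomial m (F.coeff m)
          = Polynomial.aeval (X 1) α * X 0 + Polynomial.aeval (X 1) β by
      obtain ⟨α, β, hs⟩ := H _ h
      exact ⟨α, β, by rw [← hs, ← F.as_sum]⟩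
    intro s
    induction s using Finset.induction_on with
    | empty => exact fun _ => ⟨0, 0, by simp⟩
    | insert m s hm ih =>
      intro hs
      obtain ⟨α, β, hab⟩ := ih fun n hn => hs n (Finset.mem_insert_of_mem hn)
      have hm1 := hs m (Finset.mem_insert_self _ _)
      have e : monomial m (F.coeff m)
          = Polynomial.aeval (X 1) (Polynomial.monomial (m 1) (F.coeff m)) * X 0 ^ m 0 := by
        rw [Polynomial.aeval_monomial, MvPolynomial.monomial_eq, Finsupp.prod_fintype _ _ (by simp),
          Fin.prod_univ_two, MvPolynomial.algebraMap_eq]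
        ring
      rw [Finset.sum_insert hm, hab, e]
      rcases Nat.le_one_iff_eq_zero_or_eq_one.1 hm1 with h0 | h0
      · exact ⟨α, β + Polynomial.monomial (m 1) (F.coeff m), by rw [h0, map_add]; ring⟩
      · exact ⟨α + Polynomial.monomial (m 1) (F.coeff m), β, by rw [h0, map_add]; ring⟩

/-- The exchange of the coordinates. -/
noncomputable def swapXY : MvPolynomial (Fin 2) k ≃ₐ[k] MvPolynomial (Fin 2) k :=
  MvPolynomial.renameEquiv k (Equiv.swap 0 1)

/-- The elementary automorphism `y ↦ y - c x ^ b`. -/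
noncomputable def elemXY (c : k) (b : ℕ) : MvPolynomial (Fin 2) k ≃ₐ[k] MvPolynomial (Fin 2) k :=
  AlgEquiv.ofAlgHom (aeval ![X 0, X 1 - C c * X 0 ^ b]) (aeval ![X 0, X 1 + C c * X 0 ^ b])
    (by
      refine MvPolynomial.algHom_ext fun i => ?_
      fin_cases i <;> simp [← MvPolynomial.algebraMap_eq])
    (by
      refine MvPolynomial.algHom_ext fun i => ?_
      fin_cases i <;> simp [← MvPolynomial.algebraMap_eq])

lemma swapXY_zero : swapXY (X 0 : MvPolynomial (Fin 2) k) = X 1 := by simp [swapXY]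

lemma swapXY_one : swapXY (X 1 : MvPolynomial (Fin 2) k) = X 0 := by simp [swapXY]

lemma elemXY_zero (c : k) (b : ℕ) : elemXY c b (X 0 : MvPolynomial (Fin 2) k) = X 0 := by
  simp [elemXY]

lemma elemXY_one (c : k) (b : ℕ) :
    elemXY c b (X 1 : MvPolynomial (Fin 2) k) = X 1 - C c * X 0 ^ b := by
  simp [elemXY]

/-- The degree of the first coordinate of a parametrized curve. -/
noncomputable def degX (ρ : MvPolynomial (Fin 2) k →ₐ[k] Polynomial k) : ℕ := (ρ (X 0)).natDegree

/-- The degree of the second coordinate of a parametrized curve. -/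
noncomputable def degY (ρ : MvPolynomial (Fin 2) k →ₐ[k] Polynomial k) : ℕ := (ρ (X 1)).natDegree

variable (ρ : MvPolynomial (Fin 2) k →ₐ[k] Polynomial k)

lemma degX_swap : degX (ρ.comp (swapXY (k := k) : _ →ₐ[k] MvPolynomial (Fin 2) k)) = degY ρ := by
  simp [degX, degY, swapXY_zero]

lemma degY_swap : degY (ρ.comp (swapXY (k := k) : _ →ₐ[k] MvPolynomial (Fin 2) k)) = degX ρ := by
  simp [degX, degY, swapXY_one]

lemma wdeg_swap (a b : ℕ) :
    wdeg a b (ρ.comp (swapXY (k := k) : _ →ₐ[k] MvPolynomial (Fin 2) k)) = wdeg b a ρ := by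
  simp [wdeg, swapXY_one, swapXY_zero, max_comm]

lemma dirX_swap (a b : ℕ) :
    dirX a b (ρ.comp (swapXY (k := k) : _ →ₐ[k] MvPolynomial (Fin 2) k)) = dirY b a ρ := by
  simp [dirX, dirY, wdeg_swap, swapXY_zero]

lemma dirY_swap (a b : ℕ) :
    dirY a b (ρ.comp (swapXY (k := k) : _ →ₐ[k] MvPolynomial (Fin 2) k)) = dirX b a ρ := by
  simp [dirX, dirY, wdeg_swap, swapXY_one]

lemma degX_elem (c : k) (b : ℕ) :
    degX (ρ.comp (elemXY c b : _ →ₐ[k] MvPolynomial (Fin 2) k)) = degX ρ := by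
  simp [degX, elemXY_zero]

lemma apply_elemXY (c : k) (b : ℕ) :
    ρ (elemXY c b (X 1)) = ρ (X 1) - Polynomial.C c * ρ (X 0) ^ b := by
  rw [elemXY_one, map_sub, map_mul, map_pow, ← MvPolynomial.algebraMap_eq, ρ.commutes,
    Polynomial.algebraMap_eq]

variable {ρ} {a b : ℕ}

lemma dirY_ne (h : b * degX ρ ≤ a * degY ρ) (h0 : 0 < a * degY ρ) : dirY a b ρ ≠ 0 := by
  have hw : wdeg a b ρ = a * (ρ (X 1)).natDegree := max_eq_left h
  rw [dirY, hw]
  refine coeff_pow_mul_natDegree_ne (fun h' => ?_) a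
  rw [degY, h'] at h0
  simp at h0

lemma dirX_ne (h : a * degY ρ ≤ b * degX ρ) (h0 : 0 < b * degX ρ) : dirX a b ρ ≠ 0 := by
  have hw : wdeg a b ρ = b * (ρ (X 0)).natDegree := max_eq_right h
  rw [dirX, hw]
  refine coeff_pow_mul_natDegree_ne (fun h' => ?_) b
  rw [degX, h'] at h0
  simp at h0

lemma dirX_eq_zero (h : b * degX ρ < a * degY ρ) : dirX a b ρ = 0 := by
  have hw : wdeg a b ρ = a * (ρ (X 1)).natDegree := max_eq_left h.le
  rw [dirX, hw]
  exact Polynomial.coeff_eq_zero_of_natDegree_lt (Polynomial.natDegree_pow_le.trans_lt h)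

lemma dirY_eq_zero (h : a * degY ρ < b * degX ρ) : dirY a b ρ = 0 := by
  have hw : wdeg a b ρ = b * (ρ (X 0)).natDegree := max_eq_right h.le
  rw [dirY, hw]
  exact Polynomial.coeff_eq_zero_of_natDegree_lt (Polynomial.natDegree_pow_le.trans_lt h)

lemma coeff_elem (c : k) (b : ℕ) :
    (ρ (elemXY c b (X 1))).coeff (wdeg 1 b ρ) = dirY 1 b ρ - c * dirX 1 b ρ := by
  rw [apply_elemXY, Polynomial.coeff_sub, Polynomial.coeff_C_mul, dirY, dirX, pow_one]

lemma le_degY_elem {c : k} (h : dirY 1 b ρ ≠ c * dirX 1 b ρ) :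
    b * degX ρ ≤ degY (ρ.comp (elemXY c b : _ →ₐ[k] MvPolynomial (Fin 2) k)) := by
  refine (le_max_right (1 * (ρ (X 1)).natDegree) _).trans (Polynomial.le_natDegree_of_ne_zero ?_)
  change (ρ (elemXY c b (X 1))).coeff (wdeg 1 b ρ) ≠ 0
  rw [coeff_elem]
  exact sub_ne_zero.2 h

lemma degY_elem_lt {c : k} (hc : c ≠ 0) (hY : dirY 1 b ρ = c * dirX 1 b ρ)
    (h : ¬ (dirY 1 b ρ = 0 ∧ dirX 1 b ρ = 0)) (h0 : 0 < degX ρ ∨ 0 < degY ρ) (hb : 0 < b) :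
    degY ρ = b * degX ρ ∧
      degY (ρ.comp (elemXY c b : _ →ₐ[k] MvPolynomial (Fin 2) k)) < b * degX ρ := by
  have hX : dirX 1 b ρ ≠ 0 := fun h' => h ⟨by rw [hY, h', mul_zero], h'⟩
  have hY' : dirY 1 b ρ ≠ 0 := by rw [hY]; exact mul_ne_zero hc hX
  have he : degY ρ = b * degX ρ := by
    rcases lt_trichotomy (1 * degY ρ) (b * degX ρ) with h1 | h1 | h1
    · exact absurd (dirY_eq_zero h1) hY'
    · rwa [one_mul] at h1
    · exact absurd (dirX_eq_zero h1) hX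
  have hpos : 0 < b * degX ρ := by
    rcases h0 with h0 | h0
    · exact Nat.mul_pos hb h0
    · rwa [← he]
  refine ⟨he, ?_⟩
  have hw : wdeg 1 b ρ = b * degX ρ := by
    change max (1 * degY ρ) (b * degX ρ) = _
    rw [one_mul, he, max_self]
  have hle : (ρ (elemXY c b (X 1))).natDegree ≤ b * degX ρ := by
    rw [apply_elemXY]
    refine (Polynomial.natDegree_sub_le _ _).trans (max_le he.le ?_)
    exact (Polynomial.natDegree_C_mul_le _ _).trans Polynomial.natDegree_pow_le
  change (ρ (elemXY c b (X 1))).natDegree < _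
  refine lt_of_le_of_ne hle fun h1 => ?_
  have h2 := coeff_elem (ρ := ρ) c b
  rw [hY, sub_self, hw, ← h1] at h2
  rw [Polynomial.leadingCoeff_eq_zero.1 h2, Polynomial.natDegree_zero] at h1
  omega

end Good

namespace Coord
variable {k L : Type} [Field k] [Field L] [Algebra k L] [Algebra (RatFunc k) L]

/-- Change of coordinates. -/
noncomputable def change (S : Coord k L) (τ : MvPolynomial (Fin 2) k ≃ₐ[k] MvPolynomial (Fin 2) k) :
    Coord k L where
  j := S.j.comp τ
  inj := S.inj.comp τ.injective
  surj l := by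
    obtain ⟨H₁, H₂, h0, h⟩ := S.surj l
    exact ⟨τ.symm H₁, τ.symm H₂, by simpa using h0, by simpa using h⟩
  F := τ.symm S.F
  X_eq := by simpa using S.X_eq

lemma IsSection.change {S : Coord k L} {ρ : MvPolynomial (Fin 2) k →ₐ[k] Polynomial k}
    (h : S.IsSection ρ) (τ : MvPolynomial (Fin 2) k ≃ₐ[k] MvPolynomial (Fin 2) k) :
    (S.change τ).IsSection (ρ.comp (τ : _ →ₐ[k] MvPolynomial (Fin 2) k)) := by
  change ρ (τ (τ.symm S.F)) = Polynomial.X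
  rw [AlgEquiv.apply_symm_apply]
  exact h

lemma IsSection.eq_of_const {S : Coord k L} {ρ ρ' : MvPolynomial (Fin 2) k →ₐ[k] Polynomial k}
    (h : S.IsSection ρ) (h' : S.IsSection ρ') {c : k} (hc : ρ (X 1) = Polynomial.C c)
    (hc' : ρ' (X 1) = Polynomial.C c) : ρ = ρ' := by
  let f : MvPolynomial (Fin 2) k →ₐ[k] Polynomial k := aeval ![Polynomial.X, Polynomial.C c]
  have key : ∀ σ : MvPolynomial (Fin 2) k →ₐ[k] Polynomial k, σ (X 1) = Polynomial.C c →
      S.IsSection σ → (f S.F).comp (σ (X 0)) = Polynomial.X := by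
    intro σ hσ hs
    have e : σ = (Polynomial.aeval (σ (X 0))).comp f := by
      refine MvPolynomial.algHom_ext fun i => ?_
      fin_cases i
      · simp [f]
      · simpa [f] using hσ
    have h1 : σ S.F = Polynomial.X := hs
    rw [e] at h1
    exact h1
  have h1 := key ρ hc h
  have h2 := key ρ' hc' h'
  have hd : (f S.F).natDegree = 1 := by
    have := congrArg Polynomial.natDegree h1
    rw [Polynomial.natDegree_comp, Polynomial.natDegree_X] at this
    exact Nat.eq_one_of_mul_eq_one_right this
  obtain ⟨u, hu, w, huw⟩ := Polynomial.natDegree_eq_one.1 hd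
  rw [← huw] at h1 h2
  simp only [Polynomial.add_comp, Polynomial.mul_comp, Polynomial.C_comp, Polynomial.X_comp]
    at h1 h2
  refine MvPolynomial.algHom_ext fun i => ?_
  fin_cases i
  · refine mul_left_cancel₀ (Polynomial.C_ne_zero.2 hu) ?_
    exact add_right_cancel (h1.trans h2.symm)
  · exact hc.trans hc'.symm

end Coord
end FieldGen

namespace FieldGen

lemma exists_mul_eq_mul_add_one {a b : ℕ} (ha : 0 < a) (h : a.Coprime b) :
    ∃ p q : ℕ, a * q = b * p + 1 := by
  rcases Nat.lt_or_ge 1 b with hb | hb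
  · obtain ⟨q, -, hq⟩ := Nat.exists_mul_mod_eq_one_of_coprime h hb
    exact ⟨a * q / b, q, by rw [← hq, Nat.div_add_mod]⟩
  · rcases Nat.le_one_iff_eq_zero_or_eq_one.1 hb with rfl | rfl
    · exact ⟨0, 1, by rw [Nat.coprime_zero_right] at h; rw [h]⟩
    · exact ⟨a - 1, 1, by omega⟩

/-- Three distinct sections of a field generator that is not good. -/
structure Conf {k L : Type} [Field k] [Field L] [Algebra k L] [Algebra (RatFunc k) L] (g : L)
    (S : Coord k L) (ρ₁ ρ₂ ρ₃ : MvPolynomial (Fin 2) k →ₐ[k] Polynomial k) : Prop where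
  gen : IntermediateField.adjoin (RatFunc k) {g} = ⊤
  bad : ¬ IsGood S.F
  h₁ : S.IsSection ρ₁
  h₂ : S.IsSection ρ₂
  h₃ : S.IsSection ρ₃
  n12 : ρ₁ ≠ ρ₂
  n13 : ρ₁ ≠ ρ₃
  n23 : ρ₂ ≠ ρ₃

/-- Two parametrized curves have the same direction for the weights `(a, b)`. -/
def SameDir {k : Type} [Field k] (a b : ℕ)
    (ρ ρ' : MvPolynomial (Fin 2) k →ₐ[k] Polynomial k) : Prop :=
  dirY a b ρ * dirX a b ρ' = dirY a b ρ' * dirX a b ρ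

lemma SameDir.symm {k : Type} [Field k] {a b : ℕ}
    {ρ ρ' : MvPolynomial (Fin 2) k →ₐ[k] Polynomial k} (h : SameDir a b ρ ρ') :
    SameDir a b ρ' ρ := Eq.symm h

lemma sameDir_swap {k : Type} [Field k] {a b : ℕ}
    {ρ ρ' : MvPolynomial (Fin 2) k →ₐ[k] Polynomial k} :
    SameDir b a (ρ.comp (swapXY (k := k) : _ →ₐ[k] MvPolynomial (Fin 2) k))
      (ρ'.comp (swapXY (k := k) : _ →ₐ[k] MvPolynomial (Fin 2) k)) ↔ SameDir a b ρ ρ' := by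
  rw [SameDir, SameDir, dirX_swap, dirX_swap, dirY_swap, dirY_swap, mul_comm, eq_comm,
    mul_comm (dirX a b ρ')]

lemma not_sameDir_of_dirX_eq_zero {k : Type} [Field k] {a b : ℕ}
    {ρ ρ' : MvPolynomial (Fin 2) k →ₐ[k] Polynomial k} (h : dirX a b ρ ≠ 0)
    (hX : dirX a b ρ' = 0) (hY : dirY a b ρ' ≠ 0) : ¬ SameDir a b ρ ρ' := by
  intro hs
  rw [SameDir, hX, mul_zero] at hs
  exact mul_ne_zero hY h hs.symm

lemma SameDir.exists_slope {k : Type} [Field k] {a b : ℕ}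
    {ρ ρ' : MvPolynomial (Fin 2) k →ₐ[k] Polynomial k} (h : SameDir a b ρ ρ')
    (hY : dirY a b ρ ≠ 0) (hX : dirX a b ρ' ≠ 0) :
    ∃ c : k, c ≠ 0 ∧ dirY a b ρ = c * dirX a b ρ ∧ dirY a b ρ' = c * dirX a b ρ' := by
  have hX' : dirX a b ρ ≠ 0 := by
    intro h0
    rw [SameDir, h0, mul_zero] at h
    exact mul_ne_zero hY hX h
  refine ⟨dirY a b ρ / dirX a b ρ, div_ne_zero hY hX', (div_mul_cancel₀ _ hX').symm, ?_⟩
  rw [div_mul_eq_mul_div, eq_div_iff hX', h]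

namespace Conf

variable {k L : Type} [Field k] [Field L] [Algebra k L] [Algebra (RatFunc k) L]
  {S : Coord k L} {g : L} {ρ₁ ρ₂ ρ₃ : MvPolynomial (Fin 2) k →ₐ[k] Polynomial k}

lemma swap12 (h : Conf g S ρ₁ ρ₂ ρ₃) : Conf g S ρ₂ ρ₁ ρ₃ :=
  ⟨h.gen, h.bad, h.h₂, h.h₁, h.h₃, h.n12.symm, h.n23, h.n13⟩

lemma swap23 (h : Conf g S ρ₁ ρ₂ ρ₃) : Conf g S ρ₁ ρ₃ ρ₂ :=
  ⟨h.gen, h.bad, h.h₁, h.h₃, h.h₂, h.n13, h.n12, h.n23.symm⟩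

lemma change (h : Conf g S ρ₁ ρ₂ ρ₃)
    (τ : MvPolynomial (Fin 2) k ≃ₐ[k] MvPolynomial (Fin 2) k) :
    Conf g (S.change τ) (ρ₁.comp (τ : _ →ₐ[k] MvPolynomial (Fin 2) k))
      (ρ₂.comp (τ : _ →ₐ[k] MvPolynomial (Fin 2) k))
      (ρ₃.comp (τ : MvPolynomial (Fin 2) k →ₐ[k] MvPolynomial (Fin 2) k)) := by
  have hne : ∀ {ρ ρ' : MvPolynomial (Fin 2) k →ₐ[k] Polynomial k}, ρ ≠ ρ' →
      ρ.comp (τ : MvPolynomial (Fin 2) k →ₐ[k] MvPolynomial (Fin 2) k) ≠ ρ'.comp (τ : _ →ₐ[k] MvPolynomial (Fin 2) k) := by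
    intro ρ ρ' hn he
    refine hn (AlgHom.ext fun H => ?_)
    simpa using DFunLike.congr_fun he (τ.symm H)
  refine ⟨h.gen, fun hg => h.bad ?_, h.h₁.change τ, h.h₂.change τ, h.h₃.change τ,
    hne h.n12, hne h.n13, hne h.n23⟩
  simpa [Coord.change] using hg.map τ

lemma pos₁ (h : Conf g S ρ₁ ρ₂ ρ₃) : 0 < degX ρ₁ ∨ 0 < degY ρ₁ := h.h₁.nonconstant

lemma pos₂ (h : Conf g S ρ₁ ρ₂ ρ₃) : 0 < degX ρ₂ ∨ 0 < degY ρ₂ := h.h₂.nonconstant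

lemma pos₃ (h : Conf g S ρ₁ ρ₂ ρ₃) : 0 < degX ρ₃ ∨ 0 < degY ρ₃ := h.h₃.nonconstant

lemma one_lt_natDegree_wt {a b p q : ℕ} (h : Conf g S ρ₁ ρ₂ ρ₃) (ha : 0 < a)
    (hpq : a * q = b * p + 1) : 1 < (wt a b p q S.F).natDegree := by
  by_contra! hle
  refine h.bad (isGood_of_degree_le_one fun m hm => ?_)
  have h1 := (le_natDegree_wt hpq hm).trans hle
  have h2 : m 0 ≤ a * m 0 := Nat.le_mul_of_pos_left _ ha
  omega

/-- Two sections with constant `Y` do not have the same direction for the weights `(1, 0)`. -/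
lemma not_sameDir_of_degY_eq_zero {ρ ρ' : MvPolynomial (Fin 2) k →ₐ[k] Polynomial k}
    (h : S.IsSection ρ) (h' : S.IsSection ρ') (hne : ρ ≠ ρ') (h0 : degY ρ = 0) :
    ¬ SameDir 1 0 ρ ρ' := by
  intro hs
  have hw : ∀ σ : MvPolynomial (Fin 2) k →ₐ[k] Polynomial k, wdeg 1 0 σ = degY σ := by
    intro σ
    simp [wdeg, degY]
  have hX : ∀ σ : MvPolynomial (Fin 2) k →ₐ[k] Polynomial k, degY σ = 0 → dirX 1 0 σ = 1 := by
    intro σ hσ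
    rw [dirX, hw, hσ]
    simp
  by_cases h0' : degY ρ' = 0
  · have e1 := hX _ h0
    have e2 := hX _ h0'
    rw [SameDir, e1, e2, mul_one, mul_one, dirY, dirY, hw, hw, h0, h0', pow_one, pow_one] at hs
    refine hne (h.eq_of_const h' (Polynomial.eq_C_of_natDegree_eq_zero h0) ?_)
    rw [hs]
    exact Polynomial.eq_C_of_natDegree_eq_zero h0'
  · rw [SameDir, dirX_eq_zero (ρ := ρ') (by omega), mul_zero, hX _ h0, mul_one] at hs
    exact dirY_ne (by omega) (by omega) hs.symm

variable [IsScalarTower k (RatFunc k) L]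

lemma sameDir {a b : ℕ} (h : Conf g S ρ₁ ρ₂ ρ₃) (ha : 0 < a) (hab : a.Coprime b) :
    SameDir a b ρ₁ ρ₂ ∨ SameDir a b ρ₁ ρ₃ ∨ SameDir a b ρ₂ ρ₃ := by
  by_contra! hcon
  obtain ⟨p, q, hpq⟩ := exists_mul_eq_mul_add_one ha hab
  have he := h.one_lt_natDegree_wt ha hpq
  have := Coord.natDegree_wt_eq_one h.h₁ h.h₂ h.h₃ h.gen ha hpq (by omega) hcon.1 hcon.2.1 hcon.2.2
  omega

lemma eq_one_or_eq_one {a b : ℕ} (h : Conf g S ρ₁ ρ₂ ρ₃) (ha : 0 < a) (hb : 0 < b)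
    (hab : a.Coprime b) (hd : a * degY ρ₁ = b * degX ρ₁) : a = 1 ∨ b = 1 := by
  obtain ⟨p, q, hpq⟩ := exists_mul_eq_mul_add_one ha hab
  have he := h.one_lt_natDegree_wt ha hpq
  have hpos : 0 < a * degY ρ₁ := by
    rcases h.pos₁ with h0 | h0
    · rw [hd]; exact Nat.mul_pos hb h0
    · exact Nat.mul_pos ha h0
  exact Coord.eq_one_or_eq_one h.h₁ h.h₂ h.h₃ h.n12 h.n13 h.n23 h.gen ha hpq (by omega)
    (dirY_ne hd.ge hpos) (dirX_ne hd.le (by rwa [← hd]))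

lemma degY_pos_of_degY_eq_zero (h : Conf g S ρ₁ ρ₂ ρ₃) (h1 : degY ρ₁ = 0) : 0 < degY ρ₂ := by
  by_contra! h2
  have h2 := Nat.le_zero.1 h2
  rcases h.sameDir one_pos (Nat.coprime_one_left 0) with hs | hs | hs
  · exact not_sameDir_of_degY_eq_zero h.h₁ h.h₂ h.n12 h1 hs
  · exact not_sameDir_of_degY_eq_zero h.h₁ h.h₃ h.n13 h1 hs
  · exact not_sameDir_of_degY_eq_zero h.h₂ h.h₃ h.n23 h2 hs

lemma degX_pos_of_degX_eq_zero (h : Conf g S ρ₁ ρ₂ ρ₃) (h1 : degX ρ₁ = 0) : 0 < degX ρ₂ := by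
  have := (h.change swapXY).degY_pos_of_degY_eq_zero (by rwa [degY_swap])
  rwa [degY_swap] at this

/-- The primitive weights for which a section has a nonzero finite direction. -/
lemma exists_weights {x y : ℕ} (hx : 0 < x) (hy : 0 < y) :
    ∃ a b : ℕ, 0 < a ∧ 0 < b ∧ a.Coprime b ∧ a * y = b * x := by
  obtain ⟨d, a, b, hd, hab, ha, hb⟩ := Nat.exists_coprime' (m := x) (n := y)
    (Nat.gcd_pos_of_pos_left _ hx)
  refine ⟨a, b, ?_, ?_, hab, by rw [ha, hb]; ring⟩
  · by_contra! h0
    rw [Nat.le_zero.1 h0, zero_mul] at ha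
    omega
  · by_contra! h0
    rw [Nat.le_zero.1 h0, zero_mul] at hb
    omega

/-- There is no configuration in which exactly one section lies above some slope. -/
lemma false_of_split (n : ℕ) : ∀ (S : Coord k L)
    (ρ₁ ρ₂ ρ₃ : MvPolynomial (Fin 2) k →ₐ[k] Polynomial k) (a b : ℕ), Conf g S ρ₁ ρ₂ ρ₃ → 0 < a →
    a * degY ρ₁ < b * degX ρ₁ → a * degY ρ₂ < b * degX ρ₂ → b * degX ρ₃ ≤ a * degY ρ₃ →
    degX ρ₁ + degY ρ₁ + (degX ρ₂ + degY ρ₂) = n → False := by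
  induction n using Nat.strong_induction_on with
  | _ n ih =>
  have step : ∀ (S : Coord k L) (ρ₁ ρ₂ ρ₃ : MvPolynomial (Fin 2) k →ₐ[k] Polynomial k) (b : ℕ),
      Conf g S ρ₁ ρ₂ ρ₃ → 0 < b → SameDir 1 b ρ₁ ρ₂ → degY ρ₁ = b * degX ρ₁ →
      ¬ SameDir 1 b ρ₁ ρ₃ → degX ρ₁ + degY ρ₁ + (degX ρ₂ + degY ρ₂) = n → False := by
    intro S ρ₁ ρ₂ ρ₃ b h hb hs h1 h3 hn
    have hpos : 0 < b * degX ρ₁ := by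
      rcases h.pos₁ with h0 | h0
      · exact Nat.mul_pos hb h0
      · rwa [← h1]
    have y1 : dirY 1 b ρ₁ ≠ 0 := dirY_ne (by omega) (by omega)
    have x1 : dirX 1 b ρ₁ ≠ 0 := dirX_ne (by omega) hpos
    have x2 : dirX 1 b ρ₂ ≠ 0 := by
      intro h0
      refine dir_ne one_pos b h.h₂.nonconstant ⟨?_, h0⟩
      rw [SameDir, h0, mul_zero, eq_comm] at hs
      exact (mul_eq_zero.1 hs).resolve_right x1
    obtain ⟨c, hc, c1, c2⟩ := hs.exists_slope y1 x2
    have d1 := degY_elem_lt hc c1 (fun h => y1 h.1) h.pos₁ hb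
    have d2 := degY_elem_lt hc c2 (fun h => x2 h.2) h.pos₂ hb
    have d3 := le_degY_elem (ρ := ρ₃) (b := b) (c := c) fun c3 => h3 (by
      rw [SameDir, c1, c3]; ring)
    refine ih _ ?_ _ _ _ _ 1 b (h.change (elemXY c b)) one_pos ?_ ?_ ?_ rfl
    · rw [degX_elem, degX_elem]; omega
    · rw [degX_elem]; omega
    · rw [degX_elem]; omega
    · rw [degX_elem]; omega
  intro S ρ₁ ρ₂ ρ₃ a b h ha l1 l2 l3 hn
  wlog H : degY ρ₂ * degX ρ₁ ≤ degY ρ₁ * degX ρ₂ generalizing ρ₁ ρ₂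
  · exact this ρ₂ ρ₁ h.swap12 l2 l1 (by omega) (Nat.le_of_not_le fun h' => H (by linarith))
  have hX1 : 0 < degX ρ₁ := Nat.pos_of_ne_zero fun h0 => by simp [h0] at l1
  have hX2 : 0 < degX ρ₂ := Nat.pos_of_ne_zero fun h0 => by simp [h0] at l2
  rcases Nat.eq_zero_or_pos (degY ρ₁) with hY1 | hY1
  · have := h.degY_pos_of_degY_eq_zero hY1
    rw [hY1, zero_mul, Nat.le_zero] at H
    exact (Nat.mul_pos this hX1).ne' H
  obtain ⟨a', b', ha', hb', hab, hd⟩ := exists_weights hX1 hY1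
  have s13 : degY ρ₁ * degX ρ₃ < degY ρ₃ * degX ρ₁ := by
    rcases Nat.eq_zero_or_pos (degX ρ₃) with h0 | h0
    · rw [h0, mul_zero]
      exact Nat.mul_pos (h.pos₃.resolve_left (by omega)) hX1
    · refine Nat.lt_of_mul_lt_mul_left (a := a) ?_
      calc a * (degY ρ₁ * degX ρ₃) = a * degY ρ₁ * degX ρ₃ := by ring
        _ < b * degX ρ₁ * degX ρ₃ := Nat.mul_lt_mul_of_pos_right l1 h0
        _ = b * degX ρ₃ * degX ρ₁ := by ring
        _ ≤ a * degY ρ₃ * degX ρ₁ := Nat.mul_le_mul_right _ l3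
        _ = a * (degY ρ₃ * degX ρ₁) := by ring
  have m3 : b' * degX ρ₃ < a' * degY ρ₃ := by
    refine Nat.lt_of_mul_lt_mul_left (a := degX ρ₁) ?_
    calc degX ρ₁ * (b' * degX ρ₃) = a' * (degY ρ₁ * degX ρ₃) := by
          linear_combination degX ρ₃ * hd.symm
      _ < a' * (degY ρ₃ * degX ρ₁) := Nat.mul_lt_mul_of_pos_left s13 ha'
      _ = degX ρ₁ * (a' * degY ρ₃) := by ring
  have m2 : a' * degY ρ₂ ≤ b' * degX ρ₂ := by
    refine Nat.le_of_mul_le_mul_left (c := degX ρ₁) ?_ hX1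
    calc degX ρ₁ * (a' * degY ρ₂) = a' * (degY ρ₂ * degX ρ₁) := by ring
      _ ≤ a' * (degY ρ₁ * degX ρ₂) := Nat.mul_le_mul_left _ H
      _ = degX ρ₁ * (b' * degX ρ₂) := by linear_combination degX ρ₂ * hd
  have x1 : dirX a' b' ρ₁ ≠ 0 := dirX_ne hd.le (Nat.mul_pos hb' hX1)
  have x2 : dirX a' b' ρ₂ ≠ 0 := dirX_ne m2 (Nat.mul_pos hb' hX2)
  have x3 := dirX_eq_zero m3
  have y3 : dirY a' b' ρ₃ ≠ 0 := dirY_ne m3.le (by omega)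
  have s1 := not_sameDir_of_dirX_eq_zero x1 x3 y3
  have s2 := not_sameDir_of_dirX_eq_zero x2 x3 y3
  have s3 := ((h.sameDir ha' hab).resolve_right (by tauto))
  rcases h.eq_one_or_eq_one ha' hb' hab hd with rfl | rfl
  · exact step S ρ₁ ρ₂ ρ₃ b' h hb' s3 (by omega) s1 hn
  · refine step _ _ _ _ a' (h.change swapXY) ha' (sameDir_swap.2 s3) ?_
      (fun h' => s1 (sameDir_swap.1 h')) ?_
    · rw [degX_swap, degY_swap]; omega
    · rw [degX_swap, degY_swap, degX_swap, degY_swap]; omega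

/-- There is no configuration: the degrees of the sections can always be lowered. -/
lemma false_of_conf (n : ℕ) : ∀ (S : Coord k L)
    (ρ₁ ρ₂ ρ₃ : MvPolynomial (Fin 2) k →ₐ[k] Polynomial k), Conf g S ρ₁ ρ₂ ρ₃ →
    degX ρ₁ + degY ρ₁ + (degX ρ₂ + degY ρ₂) + (degX ρ₃ + degY ρ₃) = n → False := by
  induction n using Nat.strong_induction_on with
  | _ n ih =>
  have step : ∀ (S : Coord k L) (ρ₁ ρ₂ ρ₃ : MvPolynomial (Fin 2) k →ₐ[k] Polynomial k) (b : ℕ)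
      (c : k), Conf g S ρ₁ ρ₂ ρ₃ → 0 < b → c ≠ 0 → dirY 1 b ρ₁ = c * dirX 1 b ρ₁ →
      dirY 1 b ρ₂ = c * dirX 1 b ρ₂ →
      degX ρ₁ + degY ρ₁ + (degX ρ₂ + degY ρ₂) + (degX ρ₃ + degY ρ₃) = n → False := by
    intro S ρ₁ ρ₂ ρ₃ b c h hb hc c1 c2 hn
    have d1 := degY_elem_lt hc c1 (dir_ne one_pos b h.h₁.nonconstant) h.pos₁ hb
    have d2 := degY_elem_lt hc c2 (dir_ne one_pos b h.h₂.nonconstant) h.pos₂ hb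
    by_cases c3 : dirY 1 b ρ₃ = c * dirX 1 b ρ₃
    · have d3 := degY_elem_lt hc c3 (dir_ne one_pos b h.h₃.nonconstant) h.pos₃ hb
      refine ih _ ?_ _ _ _ _ (h.change (elemXY c b)) rfl
      rw [degX_elem, degX_elem, degX_elem]; omega
    · have d3 := le_degY_elem c3
      refine false_of_split _ _ _ _ _ 1 b (h.change (elemXY c b)) one_pos ?_ ?_ ?_ rfl
      · rw [degX_elem]; omega
      · rw [degX_elem]; omega
      · rw [degX_elem]; omega
  have step' : ∀ (S : Coord k L) (ρ₁ ρ₂ ρ₃ : MvPolynomial (Fin 2) k →ₐ[k] Polynomial k) (b : ℕ),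
      Conf g S ρ₁ ρ₂ ρ₃ → 0 < b → degY ρ₂ = b * degX ρ₂ → b * degX ρ₁ ≤ degY ρ₁ →
      degY ρ₃ ≤ b * degX ρ₃ →
      degX ρ₁ + degY ρ₁ + (degX ρ₂ + degY ρ₂) + (degX ρ₃ + degY ρ₃) = n → False := by
    intro S ρ₁ ρ₂ ρ₃ b h hb h2 h1 h3 hn
    have p2 : 0 < b * degX ρ₂ := by
      rcases h.pos₂ with h0 | h0
      · exact Nat.mul_pos hb h0
      · rwa [← h2]
    have p1 : 0 < degY ρ₁ := by
      rcases h.pos₁ with h0 | h0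
      · exact (Nat.mul_pos hb h0).trans_le h1
      · exact h0
    have p3 : 0 < b * degX ρ₃ := by
      rcases h.pos₃ with h0 | h0
      · exact Nat.mul_pos hb h0
      · exact h0.trans_le h3
    have y1 : dirY 1 b ρ₁ ≠ 0 := dirY_ne (by omega) (by omega)
    have y2 : dirY 1 b ρ₂ ≠ 0 := dirY_ne (by omega) (by omega)
    have x2 : dirX 1 b ρ₂ ≠ 0 := dirX_ne (by omega) p2
    have x3 : dirX 1 b ρ₃ ≠ 0 := dirX_ne (by omega) p3
    rcases h.sameDir one_pos (Nat.coprime_one_left b) with hs | hs | hs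
    · obtain ⟨c, hc, c1, c2⟩ := hs.exists_slope y1 x2
      exact step S ρ₁ ρ₂ ρ₃ b c h hb hc c1 c2 hn
    · obtain ⟨c, hc, c1, c2⟩ := hs.exists_slope y1 x3
      exact step S ρ₁ ρ₃ ρ₂ b c h.swap23 hb hc c1 c2 (by omega)
    · obtain ⟨c, hc, c1, c2⟩ := hs.exists_slope y2 x3
      exact step S ρ₂ ρ₃ ρ₁ b c h.swap12.swap23 hb hc c1 c2 (by omega)
  have main : ∀ (S : Coord k L) (ρ₁ ρ₂ ρ₃ : MvPolynomial (Fin 2) k →ₐ[k] Polynomial k),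
      Conf g S ρ₁ ρ₂ ρ₃ → degY ρ₂ * degX ρ₁ ≤ degY ρ₁ * degX ρ₂ →
      degY ρ₃ * degX ρ₂ ≤ degY ρ₂ * degX ρ₃ →
      degX ρ₁ + degY ρ₁ + (degX ρ₂ + degY ρ₂) + (degX ρ₃ + degY ρ₃) = n → False := by
    intro S ρ₁ ρ₂ ρ₃ h H12 H23 hn
    rcases Nat.eq_zero_or_pos (degY ρ₂) with hY2 | hY2
    · have hX2 := h.pos₂.resolve_right (by omega)
      have := h.swap12.swap23.degY_pos_of_degY_eq_zero hY2
      rw [hY2, zero_mul, Nat.le_zero] at H23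
      exact (Nat.mul_pos this hX2).ne' H23
    rcases Nat.eq_zero_or_pos (degX ρ₂) with hX2 | hX2
    · have := h.swap12.degX_pos_of_degX_eq_zero hX2
      rw [hX2, mul_zero, Nat.le_zero] at H12
      exact (Nat.mul_pos hY2 this).ne' H12
    obtain ⟨a, b, ha, hb, hab, hd⟩ := exists_weights hX2 hY2
    have m1 : b * degX ρ₁ ≤ a * degY ρ₁ := by
      refine Nat.le_of_mul_le_mul_left (c := degX ρ₂) ?_ hX2
      calc degX ρ₂ * (b * degX ρ₁) = a * (degY ρ₂ * degX ρ₁) := by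
            linear_combination degX ρ₁ * hd.symm
        _ ≤ a * (degY ρ₁ * degX ρ₂) := Nat.mul_le_mul_left _ H12
        _ = degX ρ₂ * (a * degY ρ₁) := by ring
    have m3 : a * degY ρ₃ ≤ b * degX ρ₃ := by
      refine Nat.le_of_mul_le_mul_left (c := degX ρ₂) ?_ hX2
      calc degX ρ₂ * (a * degY ρ₃) = a * (degY ρ₃ * degX ρ₂) := by ring
        _ ≤ a * (degY ρ₂ * degX ρ₃) := Nat.mul_le_mul_left _ H23
        _ = degX ρ₂ * (b * degX ρ₃) := by linear_combination degX ρ₃ * hd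
    rcases h.swap12.eq_one_or_eq_one ha hb hab hd with rfl | rfl
    · exact step' S ρ₁ ρ₂ ρ₃ b h hb (by omega) (by omega) (by omega) hn
    · refine step' _ _ _ _ a (h.swap12.swap23.swap12.change swapXY) ha ?_ ?_ ?_ ?_
      all_goals simp only [degX_swap, degY_swap]; omega
  intro S ρ₁ ρ₂ ρ₃ h hn
  rcases le_total (degY ρ₂ * degX ρ₁) (degY ρ₁ * degX ρ₂) with H12 | H12 <;>
    rcases le_total (degY ρ₃ * degX ρ₂) (degY ρ₂ * degX ρ₃) with H23 | H23 <;>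
    rcases le_total (degY ρ₃ * degX ρ₁) (degY ρ₁ * degX ρ₃) with H13 | H13
  · exact main _ _ _ _ h H12 H23 hn
  · exact main _ _ _ _ h H12 H23 hn
  · exact main _ _ _ _ h.swap23 H13 (by linarith) (by omega)
  · exact main _ _ _ _ h.swap23.swap12 (by linarith) H12 (by omega)
  · exact main _ _ _ _ h.swap12 (by linarith) H13 (by omega)
  · exact main _ _ _ _ h.swap12.swap23 H23 (by linarith) (by omega)
  · exact main _ _ _ _ h.swap12.swap23.swap12 (by linarith) (by linarith) (by omega)
  · exact main _ _ _ _ h.swap12.swap23.swap12 (by linarith) (by linarith) (by omega)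

end Conf
end FieldGen

namespace FieldGen

variable {k : Type} [Field k]

lemma exists_section {F : MvPolynomial (Fin 2) k} {p : Ideal (MvPolynomial (Fin 2) k)}
    (hp : p ∈ GammaAlg k F) :
    ∃ ρ : MvPolynomial (Fin 2) k →ₐ[k] Polynomial k, ρ F = Polynomial.X ∧ RingHom.ker ρ = p := by
  let e : Polynomial k ≃ₐ[k] MvPolynomial (Fin 2) k ⧸ p :=
    AlgEquiv.ofBijective ((Ideal.Quotient.mkₐ k p).comp (Polynomial.aeval F)) hp.2
  refine ⟨(e.symm : _ →ₐ[k] Polynomial k).comp (Ideal.Quotient.mkₐ k p), ?_, ?_⟩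
  · have h : e Polynomial.X = Ideal.Quotient.mkₐ k p F := by
      change Ideal.Quotient.mkₐ k p (Polynomial.aeval F Polynomial.X) = _
      rw [Polynomial.aeval_X]
    exact (AlgEquiv.symm_apply_eq e).2 h.symm
  · ext H
    simp [RingHom.mem_ker, Ideal.Quotient.eq_zero_iff_mem]

variable {L : Type} [Field L] [Algebra (MvPolynomial (Fin 2) k) L]
  [IsFractionRing (MvPolynomial (Fin 2) k) L] [Algebra k L]
  [IsScalarTower k (MvPolynomial (Fin 2) k) L]

/-- A field generator with three sections is good. -/
lemma isGood_of_sections {F : MvPolynomial (Fin 2) k} {g : L}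
    (hg : IntermediateField.adjoin k {algebraMap (MvPolynomial (Fin 2) k) L F, g} = ⊤)
    {ρ₁ ρ₂ ρ₃ : MvPolynomial (Fin 2) k →ₐ[k] Polynomial k} (h₁ : ρ₁ F = Polynomial.X)
    (h₂ : ρ₂ F = Polynomial.X) (h₃ : ρ₃ F = Polynomial.X) (n12 : ρ₁ ≠ ρ₂) (n13 : ρ₁ ≠ ρ₃)
    (n23 : ρ₂ ≠ ρ₃) : IsGood F := by
  have hj : Function.Injective (algebraMap (MvPolynomial (Fin 2) k) L) :=
    IsFractionRing.injective _ _
  let f : Polynomial k →ₐ[k] L := Polynomial.aeval (algebraMap (MvPolynomial (Fin 2) k) L F)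
  have hfP : ∀ P, f P = algebraMap (MvPolynomial (Fin 2) k) L (Polynomial.aeval F P) := by
    intro P
    rw [Polynomial.aeval_algebraMap_apply]
  have hf : Function.Injective f := by
    intro P Q hPQ
    rw [hfP, hfP] at hPQ
    have := congrArg ρ₁ (hj hPQ)
    rwa [← Polynomial.aeval_algHom_apply, ← Polynomial.aeval_algHom_apply, h₁,
      Polynomial.aeval_X_left_apply, Polynomial.aeval_X_left_apply] at this
  let φ : RatFunc k →+* L := IsFractionRing.lift (g := (f : Polynomial k →+* L)) hf
  have hφ : ∀ P, φ (algebraMap (Polynomial k) (RatFunc k) P) = f P := fun P =>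
    IsFractionRing.lift_algebraMap _ P
  let _ : Algebra (RatFunc k) L := φ.toAlgebra
  have _ : IsScalarTower k (RatFunc k) L := IsScalarTower.of_algebraMap_eq fun c => by
    rw [IsScalarTower.algebraMap_apply k (Polynomial k) (RatFunc k)]
    exact ((hφ _).trans (f.commutes c)).symm
  let S : Coord k L :=
    { j := IsScalarTower.toAlgHom k (MvPolynomial (Fin 2) k) L
      inj := hj
      surj := fun l => by
        obtain ⟨a, b, hb, rfl⟩ := IsFractionRing.div_surjective (A := MvPolynomial (Fin 2) k) l
        have hb0 : algebraMap (MvPolynomial (Fin 2) k) L b ≠ 0 :=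
          (map_ne_zero_iff _ hj).2 (nonZeroDivisors.ne_zero hb)
        exact ⟨a, b, hb0, div_mul_cancel₀ _ hb0⟩
      F := F
      X_eq := by
        rw [← RatFunc.algebraMap_X]
        exact (hφ _).trans (by simp [f]) }
  have hgen : IntermediateField.adjoin (RatFunc k) {g} = ⊤ := by
    rw [eq_top_iff]
    intro l _
    have hl : l ∈ IntermediateField.adjoin k {algebraMap (MvPolynomial (Fin 2) k) L F, g} := by
      rw [hg]; trivial
    have hle : IntermediateField.adjoin k {algebraMap (MvPolynomial (Fin 2) k) L F, g} ≤
        (IntermediateField.adjoin (RatFunc k) {g}).restrictScalars k := by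
      rw [IntermediateField.adjoin_le_iff]
      rintro z (rfl | rfl)
      · change algebraMap (MvPolynomial (Fin 2) k) L F ∈ IntermediateField.adjoin (RatFunc k) {g}
        have e : algebraMap (MvPolynomial (Fin 2) k) L F = algebraMap (RatFunc k) L RatFunc.X :=
          S.X_eq.symm
        rw [e]
        exact IntermediateField.algebraMap_mem _ _
      · exact IntermediateField.mem_adjoin_simple_self (RatFunc k) _
    exact hle hl
  by_contra hbad
  exact Conf.false_of_conf _ S ρ₁ ρ₂ ρ₃ ⟨hgen, hbad, h₁, h₂, h₃, n12, n13, n23⟩ rfl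

end FieldGen

/-- If `F` is a field generator of `A = k[X,Y]` and `Γ(F,A)` has more than
two elements, then there is a coordinate system `(X',Y')` of `A` with
`F = α(Y')·X' + β(Y')`. -/
theorem stmt13 (k : Type) [Field k] (L : Type) [Field L]
    [Algebra (MvPolynomial (Fin 2) k) L] [IsFractionRing (MvPolynomial (Fin 2) k) L]
    [Algebra k L] [IsScalarTower k (MvPolynomial (Fin 2) k) L]
    (F : MvPolynomial (Fin 2) k)
    (hFG : ∃ g : L, IntermediateField.adjoin k
        {algebraMap (MvPolynomial (Fin 2) k) L F, g} = ⊤)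
    (hΓ : ∃ p q r, p ∈ GammaAlg k F ∧ q ∈ GammaAlg k F ∧ r ∈ GammaAlg k F ∧
        p ≠ q ∧ p ≠ r ∧ q ≠ r) :
    ∃ X' Y' : MvPolynomial (Fin 2) k,
      Function.Bijective ⇑(MvPolynomial.aeval (R := k) ![X', Y']) ∧
      ∃ α β : Polynomial k,
        F = Polynomial.aeval Y' α * X' + Polynomial.aeval Y' β := by
  obtain ⟨g, hg⟩ := hFG
  obtain ⟨p, q, r, hp, hq, hr, hpq, hpr, hqr⟩ := hΓ
  obtain ⟨ρ₁, h₁, e₁⟩ := FieldGen.exists_section hp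
  obtain ⟨ρ₂, h₂, e₂⟩ := FieldGen.exists_section hq
  obtain ⟨ρ₃, h₃, e₃⟩ := FieldGen.exists_section hr
  exact FieldGen.isGood_of_sections hg h₁ h₂ h₃ (fun h => hpq (by rw [← e₁, ← e₂, h]))
    (fun h => hpr (by rw [← e₁, ← e₃, h])) (fun h => hqr (by rw [← e₂, ← e₃, h]))
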